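/- arXiv:2307.07619 — 5 statements merged into one kernel-verified Lean document; each statement's English description precedes it below -/
import Mathlib

section
/- (Entropic stability estimate.) Let X be a linear subspace of ℝ^N and μ a probability measure on X with E_μ[e^{(h,ζ)}] < ∞ for all h ∈ X. For h ∈ X let T_hμ be the tilted probability measure with density e^{(h,ζ)}/E_μ[e^{(h,ζ)}] with respect to μ, and let cov(T_hμ) denote its covariance matrix. Let Σ̇ be a positive semidefinite symmetric matrix and α > 0, and assume that Σ̇ · cov(T_hμ) · Σ̇ ≤ α Σ̇ as quadratic forms for every h ∈ X. Then for every nonnegative measurable F with E_μ[F] = 1, (1/2) (m_F − m, Σ̇ (m_F − m)) ≤ α · Ent_μ(F), where m_F = E_μ[F(ζ) ζ] and m = E_μ[ζ]. -/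
open MeasureTheory Real Matrix

noncomputable section

/-- Entropy of `F` with respect to the measure `μ` (with `0 log 0 = 0`). -/
def entropy {X : Type*} [MeasurableSpace X] (μ : Measure X) (F : X → ℝ) : ℝ :=
  (∫ x, F x * Real.log (F x) ∂μ) - (∫ x, F x ∂μ) * Real.log (∫ x, F x ∂μ)

/-- Every vector agrees with a vector of `X` as a linear functional on `X`. -/
lemma exists_proj {N : ℕ} (X : Submodule ℝ (Fin N → ℝ)) (h : Fin N → ℝ) :
    ∃ p ∈ X, ∀ x ∈ X, p ⬝ᵥ x = h ⬝ᵥ x := by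
  let e := WithLp.linearEquiv 2 ℝ (Fin N → ℝ)
  let K : Submodule ℝ (EuclideanSpace ℝ (Fin N)) := X.comap e.toLinearMap
  obtain ⟨y, hy, z, hz, hyz⟩ := K.exists_add_mem_mem_orthogonal (WithLp.toLp 2 h)
  refine ⟨e y, hy, fun x hx => ?_⟩
  have hx' : WithLp.toLp 2 x ∈ K := by simpa [K, e] using hx
  have h0 := (Submodule.mem_orthogonal K z).1 hz _ hx'
  have hh : h = e y + e z := by
    have := congrArg e hyz
    simpa [e] using this
  have h1 : e z ⬝ᵥ x = 0 := by
    rw [← h0]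
    simp [e, PiLp.inner_apply, dotProduct]
  rw [hh, add_dotProduct, h1, add_zero]

/-- Quadratic bound on the cumulant generating function. -/
lemma cgf_bound {Ω : Type*} [MeasurableSpace Ω] (μ : Measure Ω) [IsProbabilityMeasure μ]
    (Y : Ω → ℝ) (hY : ProbabilityTheory.integrableExpSet Y μ = Set.univ) (C : ℝ)
    (hC : ∀ t, ProbabilityTheory.variance Y (μ.tilted (fun ω => t * Y ω)) ≤ C) (t : ℝ)
    (ht : 0 < t) :
    ProbabilityTheory.cgf Y μ t ≤ t * (∫ ω, Y ω ∂μ) + t ^ 2 / 2 * C := by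
  have hin : ∀ t, t ∈ interior (ProbabilityTheory.integrableExpSet Y μ) := by simp [hY]
  set m := ∫ ω, Y ω ∂μ
  have han : ∀ t, AnalyticAt ℝ (ProbabilityTheory.cgf Y μ) t :=
    fun t => ProbabilityTheory.analyticAt_cgf (hin t)
  set c := ProbabilityTheory.cgf Y μ with hc
  let g : ℝ → ℝ := fun t => t * m + t ^ 2 / 2 * C - c t
  have hg : ∀ t, HasDerivAt g (m + t * C - deriv c t) t := by
    intro t
    have h1 := ((hasDerivAt_id t).mul_const m)
    have h2 := (((hasDerivAt_id t).pow 2).div_const 2).mul_const C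
    have := (h1.add h2).sub (han t).differentiableAt.hasDerivAt
    refine this.congr_deriv ?_
    simp
  have hgd : deriv g = fun t => m + t * C - deriv c t := funext fun t => (hg t).deriv
  have hg2 : ∀ t, HasDerivAt (deriv g) (C - deriv (deriv c) t) t := by
    intro t
    rw [hgd]
    have h1 := ((hasDerivAt_id t).mul_const C).const_add m
    have := h1.sub (han t).deriv.differentiableAt.hasDerivAt
    refine this.congr_deriv ?_
    simp
  have hconv : ConvexOn ℝ Set.univ g := by
    refine convexOn_univ_of_deriv2_nonneg (fun t => (hg t).differentiableAt)
      (fun t => (hg2 t).differentiableAt) fun t => ?_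
    have h := hC t
    rw [ProbabilityTheory.variance_tilted_mul (hin t), iteratedDeriv_succ, iteratedDeriv_one] at h
    simp only [Function.iterate_succ, Function.iterate_zero, Function.comp, id]
    rw [(hg2 t).deriv]
    linarith
  have hs := hconv.le_slope_of_hasDerivAt (Set.mem_univ 0) (Set.mem_univ t) ht (hg 0)
  have hd0 : deriv c 0 = m := by
    rw [hc, ProbabilityTheory.deriv_cgf_zero (hin 0)]; simp [m]
  have hc0 : c 0 = 0 := by simp [hc]
  have : 0 ≤ (g t - g 0) / (t - 0) := by
    rw [hd0] at hs
    simpa [slope_def_field] using hs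
  rw [sub_zero] at this
  have h2 : 0 ≤ g t - g 0 := by
    by_contra hneg
    exact absurd this (not_le.2 (div_neg_of_neg_of_pos (not_le.1 hneg) ht))
  simp only [g, hc0] at h2
  norm_num at h2
  linarith

/-- Donsker-Varadhan inequality. -/
lemma entropy_ge {Ω : Type*} [MeasurableSpace Ω] (μ : Measure Ω) [IsProbabilityMeasure μ]
    (F Y : Ω → ℝ) (hF0 : ∀ ω, 0 ≤ F ω) (hF : Integrable F μ) (hF1 : ∫ ω, F ω ∂μ = 1)
    (hFl : Integrable (fun ω => F ω * Real.log (F ω)) μ)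
    (hFY : Integrable (fun ω => F ω * Y ω) μ)
    (hY : Integrable (fun ω => Real.exp (Y ω)) μ) :
    (∫ ω, F ω * Y ω ∂μ) - Real.log (∫ ω, Real.exp (Y ω) ∂μ) ≤ entropy μ F := by
  have hpos : 0 < ∫ ω, Real.exp (Y ω) ∂μ := integral_exp_pos hY
  set Z := ∫ ω, Real.exp (Y ω) ∂μ with hZ
  set c := Real.log Z with hc
  have key : ∀ ω, F ω * Y ω - c * F ω + F ω - Real.exp (Y ω) / Z ≤ F ω * Real.log (F ω) := by
    intro ω
    have hG : 0 < Real.exp (Y ω) / Z := by positivity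
    rcases (hF0 ω).eq_or_lt with h | h
    · rw [← h]; simp; positivity
    · have h1 := Real.log_le_sub_one_of_pos (div_pos hG h)
      rw [Real.log_div hG.ne' h.ne', Real.log_div (Real.exp_pos _).ne' hpos.ne', Real.log_exp] at h1
      have h2 := mul_le_mul_of_nonneg_left h1 h.le
      have h3 : F ω * (Real.exp (Y ω) / Z / F ω - 1) = Real.exp (Y ω) / Z - F ω := by
        field_simp
      rw [h3] at h2
      linarith
  have i1 := hFY.sub (hF.const_mul c)
  have i2 := i1.add hF
  have i3 := hY.div_const Z
  have hint := integral_mono (i2.sub i3) hFl key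
  have e : ∫ ω, ((((fun ω => F ω * Y ω) - fun ω => c * F ω) + F) - fun ω => Real.exp (Y ω) / Z) ω ∂μ
      = (∫ ω, F ω * Y ω ∂μ) - c := by
    rw [integral_sub' i2 i3, integral_add' i1 hF, integral_sub' hFY (hF.const_mul c),
      integral_const_mul, integral_div, hF1, ← hZ, div_self hpos.ne']
    ring
  rw [e] at hint
  unfold entropy
  rw [hF1]
  simpa using hint

/-- The variance of a linear functional in terms of the covariance matrix. -/
lemma variance_dot {N : ℕ} (ν : Measure (Fin N → ℝ)) [IsProbabilityMeasure ν]
    (hν : ∀ i, MemLp (fun ζ : Fin N → ℝ => ζ i) 2 ν) (u : Fin N → ℝ) :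
    ProbabilityTheory.variance (fun ζ => u ⬝ᵥ ζ) ν =
      u ⬝ᵥ (Matrix.of fun i j =>
          (∫ ζ, ζ i * ζ j ∂ν) - (∫ ζ, ζ i ∂ν) * (∫ ζ, ζ j ∂ν)).mulVec u := by
  have h1 : (fun ζ : Fin N → ℝ => u ⬝ᵥ ζ) = ∑ i, fun ζ : Fin N → ℝ => u i * ζ i := by
    ext ζ; simp [dotProduct]
  rw [h1, ProbabilityTheory.variance_sum' (fun i _ => (hν i).const_mul (u i))]
  simp only [dotProduct, mulVec, Matrix.of_apply, Finset.mul_sum]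
  refine Finset.sum_congr rfl fun i _ => Finset.sum_congr rfl fun j _ => ?_
  rw [ProbabilityTheory.covariance_const_mul_left, ProbabilityTheory.covariance_const_mul_right,
    ProbabilityTheory.covariance_eq_sub (hν i) (hν j)]
  simp only [Pi.mul_apply]
  ring

lemma memLp_coord {N : ℕ} (μ : Measure (Fin N → ℝ)) [IsProbabilityMeasure μ]
    (hexp : ∀ h : Fin N → ℝ, Integrable (fun ζ => Real.exp (h ⬝ᵥ ζ)) μ) (h : Fin N → ℝ)
    (i : Fin N) : MemLp (fun ζ : Fin N → ℝ => ζ i) 2 (μ.tilted fun ζ => h ⬝ᵥ ζ) := by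
  refine ProbabilityTheory.memLp_of_mem_interior_integrableExpSet ?_ 2
  have : ProbabilityTheory.integrableExpSet (fun ζ : Fin N → ℝ => ζ i)
      (μ.tilted fun ζ => h ⬝ᵥ ζ) = Set.univ := by
    ext t
    simp only [ProbabilityTheory.integrableExpSet, Set.mem_ofPred_eq, Set.mem_univ, iff_true]
    rw [integrable_tilted_iff (hexp h)]
    refine (hexp (h + Pi.single i t)).congr (Filter.Eventually.of_forall fun ζ => ?_)
    simp [add_dotProduct, Real.exp_add]
  simp [this]

/-- Entropic stability estimate: if the covariances of all exponential tilts `T_h μ`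
satisfy `Σ̇ cov(T_h μ) Σ̇ ≤ α Σ̇`, then for every density `F` with `E_μ[F] = 1`,
`½ (E_μ[Fζ] − E_μ[ζ], Σ̇ (E_μ[Fζ] − E_μ[ζ])) ≤ α · Ent_μ(F)`. -/
theorem entropic_stability {N : ℕ} (X : Submodule ℝ (Fin N → ℝ))
    (μ : Measure (Fin N → ℝ)) [IsProbabilityMeasure μ]
    (hsupp : ∀ᵐ ζ ∂μ, ζ ∈ X)
    (hexp : ∀ h : Fin N → ℝ, Integrable (fun ζ => Real.exp (h ⬝ᵥ ζ)) μ)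
    (hmom : ∀ i : Fin N, Integrable (fun ζ => ζ i) μ)
    (Sdot : Matrix (Fin N) (Fin N) ℝ) (hS : Sdot.PosSemidef)
    (α : ℝ) (hα : 0 < α)
    (tilt : (Fin N → ℝ) → Measure (Fin N → ℝ))
    (htilt : ∀ h, tilt h = μ.tilted fun ζ => h ⬝ᵥ ζ)
    (hcov : ∀ h : Fin N → ℝ, h ∈ X → ∀ v : Fin N → ℝ,
      v ⬝ᵥ (Sdot * (Matrix.of fun i j =>
          (∫ ζ, ζ i * ζ j ∂tilt h) - (∫ ζ, ζ i ∂tilt h) * (∫ ζ, ζ j ∂tilt h)) *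
        Sdot).mulVec v
        ≤ α * (v ⬝ᵥ Sdot.mulVec v)) :
    ∀ F : (Fin N → ℝ) → ℝ, Measurable F → (∀ ζ, 0 ≤ F ζ) →
      Integrable F μ → (∫ ζ, F ζ ∂μ) = 1 →
      Integrable (fun ζ => F ζ * Real.log (F ζ)) μ →
      (∀ i : Fin N, Integrable (fun ζ => F ζ * ζ i) μ) →
      (1/2) * (((fun i => ∫ ζ, F ζ * ζ i ∂μ) - fun i => ∫ ζ, ζ i ∂μ) ⬝ᵥ
          Sdot.mulVec ((fun i => ∫ ζ, F ζ * ζ i ∂μ) - fun i => ∫ ζ, ζ i ∂μ))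
        ≤ α * entropy μ F := by
  intro F hFm hF0 hF hF1 hFl hFc
  set w : Fin N → ℝ := (fun i => ∫ ζ, F ζ * ζ i ∂μ) - fun i => ∫ ζ, ζ i ∂μ with hw
  set u : Fin N → ℝ := Sdot.mulVec w with hu
  set q := w ⬝ᵥ u with hq
  have hsym : Sdotᵀ = Sdot := by simpa using hS.isHermitian.eq
  have hY : ProbabilityTheory.integrableExpSet (fun ζ : Fin N → ℝ => u ⬝ᵥ ζ) μ = Set.univ := by
    ext t
    simp only [ProbabilityTheory.integrableExpSet, Set.mem_ofPred_eq, Set.mem_univ, iff_true]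
    simpa [smul_dotProduct] using hexp (t • u)
  have hvar : ∀ t : ℝ, ProbabilityTheory.variance (fun ζ : Fin N → ℝ => u ⬝ᵥ ζ)
      (μ.tilted (fun ζ => t * (u ⬝ᵥ ζ))) ≤ α * q := by
    intro t
    obtain ⟨p, hp, hpX⟩ := exists_proj X (t • u)
    have e : μ.tilted (fun ζ => t * (u ⬝ᵥ ζ)) = μ.tilted (fun ζ => p ⬝ᵥ ζ) := by
      refine tilted_congr ?_
      filter_upwards [hsupp] with ζ hζ
      rw [hpX ζ hζ, smul_dotProduct, smul_eq_mul]
    rw [e]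
    have hprob : IsProbabilityMeasure (μ.tilted (fun ζ => p ⬝ᵥ ζ)) :=
      isProbabilityMeasure_tilted (hexp p)
    rw [variance_dot _ (memLp_coord μ hexp p)]
    have := hcov p hp w
    rw [htilt, ← Matrix.mulVec_mulVec, ← Matrix.mulVec_mulVec, Matrix.dotProduct_mulVec w Sdot,
      ← Matrix.mulVec_transpose, hsym] at this
    exact this
  have hb := cgf_bound μ _ hY (α * q) hvar α⁻¹ (inv_pos.2 hα)
  have hsum : (fun ζ => F ζ * (α⁻¹ * (u ⬝ᵥ ζ))) =
      fun ζ => ∑ i, (α⁻¹ * u i) * (F ζ * ζ i) := by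
    ext ζ
    simp only [dotProduct, Finset.mul_sum]
    exact Finset.sum_congr rfl fun i _ => by ring
  have hFY : Integrable (fun ζ => F ζ * (α⁻¹ * (u ⬝ᵥ ζ))) μ := by
    rw [hsum]
    exact integrable_finsetSum _ fun i _ => (hFc i).const_mul _
  have hE : Integrable (fun ζ => Real.exp (α⁻¹ * (u ⬝ᵥ ζ))) μ := by
    simpa [smul_dotProduct] using hexp (α⁻¹ • u)
  have hent := entropy_ge μ F (fun ζ => α⁻¹ * (u ⬝ᵥ ζ)) hF0 hF hF1 hFl hFY hE
  have hcgf : Real.log (∫ ζ, Real.exp (α⁻¹ * (u ⬝ᵥ ζ)) ∂μ) =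
      ProbabilityTheory.cgf (fun ζ : Fin N → ℝ => u ⬝ᵥ ζ) μ α⁻¹ := rfl
  have e1 : ∫ ζ, F ζ * (α⁻¹ * (u ⬝ᵥ ζ)) ∂μ = α⁻¹ * ∑ i, u i * ∫ ζ, F ζ * ζ i ∂μ := by
    rw [hsum, integral_finsetSum _ fun i _ => (hFc i).const_mul _, Finset.mul_sum]
    exact Finset.sum_congr rfl fun i _ => by rw [integral_const_mul]; ring
  have e2 : ∫ ζ, u ⬝ᵥ ζ ∂μ = ∑ i, u i * ∫ ζ, ζ i ∂μ := by
    simp only [dotProduct]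
    rw [integral_finsetSum _ fun i _ => (hmom i).const_mul _]
    exact Finset.sum_congr rfl fun i _ => by rw [integral_const_mul]
  have e3 : q = (∑ i, u i * ∫ ζ, F ζ * ζ i ∂μ) - ∑ i, u i * ∫ ζ, ζ i ∂μ := by
    rw [hq, dotProduct_comm, ← Finset.sum_sub_distrib]
    simp only [dotProduct, hw, Pi.sub_apply, mul_sub]
  rw [hcgf, e1] at hent
  rw [e2] at hb
  have hfin : α⁻¹ * q - α⁻¹ ^ 2 / 2 * (α * q) ≤ entropy μ F := by
    rw [e3] at hb ⊢
    linarith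
  have h4 : α * (α⁻¹ * q - α⁻¹ ^ 2 / 2 * (α * q)) = 1 / 2 * q := by
    field_simp
    ring
  rw [← h4]
  exact mul_le_mul_of_nonneg_left hfin hα.le

end
end

section
/- (Single-spin log-Sobolev inequality for the standard Dirichlet form.) Let p ∈ (0,1), q = 1 − p, and let μ be the probability measure on {−1,+1} with μ(+1) = p and μ(−1) = q. Then for every function F : {−1,+1} → [0,∞), Ent_μ(F) ≤ c(p) · (√F(+1) − √F(−1))², where c(p) = pq(log p − log q)/(p − q) for p ≠ q and c(1/2) = 1/2. Since c(p) ≤ 1/2 for all p ∈ (0,1), in particular Ent_μ(F) ≤ (1/2)(√F(+1) − √F(−1))², i.e. the log-Sobolev constant with respect to the standard Dirichlet form D(F) = (1/2)(F(+1) − F(−1))² is at least 2. -/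
open MeasureTheory Real

noncomputable section

/-- Convex / concave / convex function with double zeros in the convex parts is nonnegative. -/
lemma ssl_generic (g g1 g2 : ℝ → ℝ) (A B z1 z2 u v : ℝ)
    (hA : A < z1) (h1 : z1 ≤ u) (huv : u ≤ v) (h2 : v ≤ z2) (hB : z2 < B)
    (hg : ContinuousOn g (Set.Icc A B))
    (hd : ∀ s ∈ Set.Ioo A B, HasDerivAt g (g1 s) s)
    (hd1 : ∀ s ∈ Set.Ioo A B, HasDerivAt g1 (g2 s) s)
    (hl : ∀ s ∈ Set.Ioo A B, s < u → 0 ≤ g2 s)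
    (hr : ∀ s ∈ Set.Ioo A B, v < s → 0 ≤ g2 s)
    (hm : ∀ s ∈ Set.Ioo A B, u < s → s < v → g2 s ≤ 0)
    (e1 : g z1 = 0) (e2 : g z2 = 0) (f1 : g1 z1 = 0) (f2 : g1 z2 = 0) :
    ∀ s ∈ Set.Icc A B, 0 ≤ g s := by
  have cont1 : ContinuousOn g1 (Set.Ioo A B) := fun s hs =>
    (hd1 s hs).continuousAt.continuousWithinAt
  have M1 : MonotoneOn g1 (Set.Ioc A u) := by
    apply monotoneOn_of_hasDerivWithinAt_nonneg (f' := g2) (convex_Ioc A u)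
    · exact cont1.mono (fun s hs => ⟨hs.1, by linarith [hs.2]⟩)
    · intro s hs
      rw [interior_Ioc] at hs
      exact (hd1 s ⟨hs.1, by linarith [hs.2]⟩).hasDerivWithinAt
    · intro s hs
      rw [interior_Ioc] at hs
      exact hl s ⟨hs.1, by linarith [hs.2]⟩ hs.2
  have M2 : MonotoneOn g1 (Set.Ico v B) := by
    apply monotoneOn_of_hasDerivWithinAt_nonneg (f' := g2) (convex_Ico v B)
    · exact cont1.mono (fun s hs => ⟨by linarith [hs.1], hs.2⟩)
    · intro s hs
      rw [interior_Ico] at hs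
      exact (hd1 s ⟨by linarith [hs.1], hs.2⟩).hasDerivWithinAt
    · intro s hs
      rw [interior_Ico] at hs
      exact hr s ⟨by linarith [hs.1], hs.2⟩ hs.1
  have N1 : AntitoneOn g (Set.Icc A z1) := by
    apply antitoneOn_of_hasDerivWithinAt_nonpos (f' := g1) (convex_Icc A z1)
    · exact hg.mono (Set.Icc_subset_Icc le_rfl (by linarith))
    · intro s hs
      rw [interior_Icc] at hs
      exact (hd s ⟨hs.1, by linarith [hs.2]⟩).hasDerivWithinAt
    · intro s hs
      rw [interior_Icc] at hs
      rw [← f1]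
      exact M1 ⟨hs.1, by linarith [hs.2]⟩ ⟨hA, h1⟩ hs.2.le
  have N2 : MonotoneOn g (Set.Icc z1 u) := by
    apply monotoneOn_of_hasDerivWithinAt_nonneg (f' := g1) (convex_Icc z1 u)
    · exact hg.mono (Set.Icc_subset_Icc (by linarith) (by linarith))
    · intro s hs
      rw [interior_Icc] at hs
      exact (hd s ⟨by linarith [hs.1], by linarith [hs.2]⟩).hasDerivWithinAt
    · intro s hs
      rw [interior_Icc] at hs
      rw [← f1]
      exact M1 ⟨hA, h1⟩ ⟨by linarith [hs.1], hs.2.le⟩ hs.1.le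
  have N3 : AntitoneOn g (Set.Icc v z2) := by
    apply antitoneOn_of_hasDerivWithinAt_nonpos (f' := g1) (convex_Icc v z2)
    · exact hg.mono (Set.Icc_subset_Icc (by linarith) (by linarith))
    · intro s hs
      rw [interior_Icc] at hs
      exact (hd s ⟨by linarith [hs.1], by linarith [hs.2]⟩).hasDerivWithinAt
    · intro s hs
      rw [interior_Icc] at hs
      rw [← f2]
      exact M2 ⟨hs.1.le, by linarith [hs.2]⟩ ⟨h2, hB⟩ hs.2.le
  have N4 : MonotoneOn g (Set.Icc z2 B) := by
    apply monotoneOn_of_hasDerivWithinAt_nonneg (f' := g1) (convex_Icc z2 B)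
    · exact hg.mono (Set.Icc_subset_Icc (by linarith) le_rfl)
    · intro s hs
      rw [interior_Icc] at hs
      exact (hd s ⟨by linarith [hs.1], hs.2⟩).hasDerivWithinAt
    · intro s hs
      rw [interior_Icc] at hs
      rw [← f2]
      exact M2 ⟨h2, hB⟩ ⟨by linarith [hs.1], hs.2⟩ hs.1.le
  have gu : 0 ≤ g u := by rw [← e1]; exact N2 ⟨le_rfl, h1⟩ ⟨h1, le_rfl⟩ h1
  have gv : 0 ≤ g v := by rw [← e2]; exact N3 ⟨le_rfl, h2⟩ ⟨h2, le_rfl⟩ h2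
  have C : ConcaveOn ℝ (Set.Icc u v) g := by
    have anti : AntitoneOn g1 (Set.Icc u v) := by
      apply antitoneOn_of_hasDerivWithinAt_nonpos (f' := g2) (convex_Icc u v)
      · exact cont1.mono (fun s hs => ⟨by linarith [hs.1], by linarith [hs.2]⟩)
      · intro s hs
        rw [interior_Icc] at hs
        exact (hd1 s ⟨by linarith [hs.1], by linarith [hs.2]⟩).hasDerivWithinAt
      · intro s hs
        rw [interior_Icc] at hs
        exact hm s ⟨by linarith [hs.1], by linarith [hs.2]⟩ hs.1 hs.2
    apply AntitoneOn.concaveOn_of_deriv (convex_Icc u v)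
    · exact hg.mono (Set.Icc_subset_Icc (by linarith) (by linarith))
    · intro s hs
      rw [interior_Icc] at hs
      exact (hd s ⟨by linarith [hs.1], by linarith [hs.2]⟩).differentiableAt.differentiableWithinAt
    · intro s hs t ht hst
      rw [interior_Icc] at hs ht
      rw [(hd s ⟨by linarith [hs.1], by linarith [hs.2]⟩).deriv,
        (hd t ⟨by linarith [ht.1], by linarith [ht.2]⟩).deriv]
      exact anti ⟨hs.1.le, hs.2.le⟩ ⟨ht.1.le, ht.2.le⟩ hst
  intro s hs
  rcases le_total s z1 with h | h
  · rw [← e1]; exact N1 ⟨hs.1, h⟩ ⟨hA.le, le_rfl⟩ h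
  rcases le_total s u with h' | h'
  · rw [← e1]; exact N2 ⟨le_rfl, h1⟩ ⟨h, h'⟩ h
  rcases le_total z2 s with k | k
  · rw [← e2]; exact N4 ⟨le_rfl, hB.le⟩ ⟨k, hs.2⟩ k
  rcases le_total v s with k' | k'
  · rw [← e2]; exact N3 ⟨k', k⟩ ⟨h2, le_rfl⟩ k
  have hseg : s ∈ segment ℝ u v := by rw [segment_eq_Icc huv]; exact ⟨h', k'⟩
  have := C.ge_on_segment ⟨le_rfl, huv⟩ ⟨huv, le_rfl⟩ hseg
  exact le_trans (le_min gu gv) this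

lemma ssl_log1 (p : ℝ) (hp : 0 < p) (hp1 : p < 1) :
    0 ≤ (p - (1 - p)) * (log p - log (1 - p) - 2 * (p - (1 - p))) := by
  have M : MonotoneOn (fun p : ℝ => log p - log (1 - p) - 2 * (p - (1 - p))) (Set.Ioo 0 1) := by
    have H : ∀ s ∈ Set.Ioo (0:ℝ) 1, HasDerivAt
        (fun p : ℝ => log p - log (1 - p) - 2 * (p - (1 - p))) (1 / s + 1 / (1 - s) - 4) s := by
      intro s hs
      have a : s ≠ 0 := hs.1.ne'
      have b : 1 - s ≠ 0 := by linarith [hs.2]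
      have q := (hasDerivAt_id' s).const_sub 1
      refine ((((hasDerivAt_id' s).log a).sub (q.log b)).sub
        (((hasDerivAt_id' s).sub q).const_mul 2)).congr_deriv ?_
      ring
    apply monotoneOn_of_hasDerivWithinAt_nonneg (convex_Ioo 0 1)
    · exact fun s hs => (H s hs).continuousAt.continuousWithinAt
    · intro s hs
      rw [interior_Ioo] at hs
      exact (H s hs).hasDerivWithinAt
    · intro s hs
      rw [interior_Ioo] at hs
      have a : 0 < s := hs.1
      have b : 0 < 1 - s := by linarith [hs.2]
      have : 1 / s + 1 / (1 - s) - 4 = (2 * s - 1) ^ 2 / (s * (1 - s)) := by field_simp; ring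
      rw [this]; positivity
  have h0 : log (1/2 : ℝ) - log (1 - 1/2) - 2 * (1/2 - (1 - 1/2)) = 0 := by norm_num
  rcases le_total p (1/2) with h | h
  · have := M ⟨hp, hp1⟩ ⟨by norm_num, by norm_num⟩ h
    simp only [h0] at this
    exact mul_nonneg_of_nonpos_of_nonpos (by linarith) this
  · have := M ⟨by norm_num, by norm_num⟩ ⟨hp, hp1⟩ h
    simp only [h0] at this
    exact mul_nonneg (by linarith) this

lemma ssl_log2 (p : ℝ) (hp : 0 < p) (hp1 : p < 1) :
    0 ≤ (p - (1 - p)) * (1 / 2 * ((1 - p)⁻¹ - p⁻¹) - (log p - log (1 - p))) := by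
  have M : MonotoneOn (fun p : ℝ => 1 / 2 * ((1 - p)⁻¹ - p⁻¹) - (log p - log (1 - p)))
      (Set.Ioo 0 1) := by
    have H : ∀ s ∈ Set.Ioo (0:ℝ) 1, HasDerivAt
        (fun p : ℝ => 1 / 2 * ((1 - p)⁻¹ - p⁻¹) - (log p - log (1 - p)))
          (1 / 2 * (1 / (1 - s) - 1 / s) ^ 2) s := by
      intro s hs
      have a : s ≠ 0 := hs.1.ne'
      have b : 1 - s ≠ 0 := by linarith [hs.2]
      have q := (hasDerivAt_id' s).const_sub 1
      refine ((((q.fun_inv b).sub ((hasDerivAt_id' s).fun_inv a)).const_mul (1/2)).sub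
        (((hasDerivAt_id' s).log a).sub (q.log b))).congr_deriv ?_
      field_simp
      ring
    apply monotoneOn_of_hasDerivWithinAt_nonneg (convex_Ioo 0 1)
    · exact fun s hs => (H s hs).continuousAt.continuousWithinAt
    · intro s hs
      rw [interior_Ioo] at hs
      exact (H s hs).hasDerivWithinAt
    · intro s hs
      positivity
  have h0 : 1 / 2 * ((1 - 1/2 : ℝ)⁻¹ - (1/2 : ℝ)⁻¹) - (log (1/2 : ℝ) - log (1 - 1/2)) = 0 := by
    norm_num
  rcases le_total p (1/2) with h | h
  · have := M ⟨hp, hp1⟩ ⟨by norm_num, by norm_num⟩ h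
    simp only [h0] at this
    exact mul_nonneg_of_nonpos_of_nonpos (by linarith) this
  · have := M ⟨by norm_num, by norm_num⟩ ⟨hp, hp1⟩ h
    simp only [h0] at this
    exact mul_nonneg (by linarith) this

/-- Normalised inequality. -/
lemma ssl_norm (p q c : ℝ) (hp : 0 < p) (hq : 0 < q) (hpq : p + q = 1)
    (hc : c * (p - q) = p * q * (log p - log q)) (hc2 : 2 * (p * q) ≤ c) :
    ∀ s ∈ Set.Icc (-(1 / q)) (1 / p),
      0 ≤ c * (2 + (q - p) * s - 2 * √((1 + q * s) * (1 - p * s)))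
        - p * ((1 + q * s) * log (1 + q * s)) - q * ((1 - p * s) * log (1 - p * s)) := by
  have hpq0 : 0 < p * q := by positivity
  have hq' : q = 1 - p := by linarith
  set m : ℝ := (q - p) / (p * q) / 2 with hm
  have hmm : q - p = 2 * (p * q) * m := by rw [hm]; field_simp
  set K : ℝ := (c / (2 * (p * q))) ^ 2 with hK
  have hcK : 1 ≤ c / (2 * (p * q)) := by rw [le_div_iff₀ (by positivity)]; linarith
  have hK1 : 1 ≤ K := by rw [hK]; nlinarith
  set R : ℝ := m ^ 2 - (K - 1) / (p * q) with hR
  have hw : ∀ s, (1 + q * s) * (1 - p * s) = K + p * q * (R - (s - m) ^ 2) := by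
    intro s
    have : p * q * R = p * q * m ^ 2 - (K - 1) := by rw [hR]; field_simp
    have e : (1 + q * s) * (1 - p * s) = 1 + (q - p) * s - p * q * s ^ 2 := by ring
    rw [e, hmm]; linear_combination (-1) * this
  have hrm : √R ≤ |m| := by
    rw [← sqrt_sq_eq_abs]
    apply sqrt_le_sqrt
    have : 0 ≤ (K - 1) / (p * q) := div_nonneg (by linarith) hpq0.le
    linarith
  have hr0 := sqrt_nonneg R
  have pos : ∀ s ∈ Set.Ioo (-(1 / q)) (1 / p), 0 < 1 + q * s ∧ 0 < 1 - p * s := by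
    intro s hs
    have a := (mul_lt_mul_of_pos_left hs.1 hq)
    have b := (mul_lt_mul_of_pos_left hs.2 hp)
    have a' : q * -(1 / q) = -1 := by field_simp
    have b' : p * (1 / p) = 1 := by field_simp
    constructor <;> linarith
  let g : ℝ → ℝ := fun s => c * (2 + (q - p) * s - 2 * √((1 + q * s) * (1 - p * s)))
        - p * ((1 + q * s) * log (1 + q * s)) - q * ((1 - p * s) * log (1 - p * s))
  let g1 : ℝ → ℝ := fun s => c * ((q - p) - ((q - p) - 2 * (p * q) * s)
        / √((1 + q * s) * (1 - p * s))) - p * q * (log (1 + q * s) - log (1 - p * s))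
  let g2 : ℝ → ℝ := fun s => (c / 2 - p * q * √((1 + q * s) * (1 - p * s)))
        / (√((1 + q * s) * (1 - p * s))) ^ 3
  have X : ∀ s, HasDerivAt (fun s : ℝ => 1 + q * s) q s := fun s => by
    simpa using ((hasDerivAt_id' s).const_mul q).const_add 1
  have Y : ∀ s, HasDerivAt (fun s : ℝ => 1 - p * s) (-p) s := fun s => by
    simpa using ((hasDerivAt_id' s).const_mul p).const_sub 1
  have W : ∀ s, HasDerivAt (fun s : ℝ => (1 + q * s) * (1 - p * s))
      ((q - p) - 2 * (p * q) * s) s := fun s => by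
    refine ((X s).mul (Y s)).congr_deriv ?_
    ring
  have hd : ∀ s ∈ Set.Ioo (-(1 / q)) (1 / p), HasDerivAt g (g1 s) s := by
    intro s hs
    obtain ⟨hx, hy⟩ := pos s hs
    have hw0 : (1 + q * s) * (1 - p * s) ≠ 0 := by positivity
    have hsw : √((1 + q * s) * (1 - p * s)) ≠ 0 := by positivity
    have D := ((((((hasDerivAt_id' s).const_mul (q - p)).const_add 2).sub
      (((W s).sqrt hw0).const_mul 2)).const_mul c).sub
      (((X s).mul ((X s).log hx.ne')).const_mul p)).sub
      (((Y s).mul ((Y s).log hy.ne')).const_mul q)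
    refine D.congr_deriv ?_
    simp only [g1]
    have h1 : (1 + q * s) * (q / (1 + q * s)) = q := by field_simp
    have h2 : (1 - p * s) * (-p / (1 - p * s)) = -p := by field_simp
    rw [h1, h2]
    have h3 : 2 * ((q - p - 2 * (p * q) * s) / (2 * √((1 + q * s) * (1 - p * s))))
      = (q - p - 2 * (p * q) * s) / √((1 + q * s) * (1 - p * s)) := by field_simp
    rw [h3]; ring
  have hd1 : ∀ s ∈ Set.Ioo (-(1 / q)) (1 / p), HasDerivAt g1 (g2 s) s := by
    intro s hs
    obtain ⟨hx, hy⟩ := pos s hs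
    have hw0 : (1 + q * s) * (1 - p * s) ≠ 0 := by positivity
    have hsw : 0 < √((1 + q * s) * (1 - p * s)) := by positivity
    have L : HasDerivAt (fun s : ℝ => (q - p) - 2 * (p * q) * s) (-(2 * (p * q))) s := by
      simpa using ((hasDerivAt_id' s).const_mul (2 * (p * q))).const_sub (q - p)
    have D := (((L.div ((W s).sqrt hw0) hsw.ne').const_sub (q - p)).const_mul c).sub
      ((((X s).log hx.ne').sub ((Y s).log hy.ne')).const_mul (p * q))
    refine D.congr_deriv ?_
    simp only [g2]
    have hsq : √((1 + q * s) * (1 - p * s)) ^ 2 = (1 + q * s) * (1 - p * s) :=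
      sq_sqrt (by positivity)
    have h1 : q / (1 + q * s) - -p / (1 - p * s) = 1 / √((1 + q * s) * (1 - p * s)) ^ 2 := by
      rw [hsq, div_sub_div _ _ hx.ne' hy.ne']
      congr 1
      rw [hq']; ring
    rw [h1]
    generalize √((1 + q * s) * (1 - p * s)) = t at *
    field_simp
    rw [hsq, hq']; ring
  have gcont : ContinuousOn g (Set.Icc (-(1 / q)) (1 / p)) := by
    have e := continuous_mul_log
    have e1 : Continuous fun s : ℝ => (1 + q * s) * log (1 + q * s) :=
      e.comp (by fun_prop : Continuous fun s : ℝ => 1 + q * s)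
    have e2 : Continuous fun s : ℝ => (1 - p * s) * log (1 - p * s) :=
      e.comp (by fun_prop : Continuous fun s : ℝ => 1 - p * s)
    apply Continuous.continuousOn
    simp only [g]
    fun_prop
  have sg_pos : ∀ s ∈ Set.Ioo (-(1 / q)) (1 / p), R ≤ (s - m) ^ 2 → 0 ≤ g2 s := by
    intro s hs h
    have : √((1 + q * s) * (1 - p * s)) ≤ c / (2 * (p * q)) := by
      apply sqrt_le_iff.2 ⟨by linarith, ?_⟩
      rw [hw s]
      have := mul_nonneg hpq0.le (sub_nonneg.2 h)
      linarith
    rw [le_div_iff₀ (by positivity)] at this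
    apply div_nonneg _ (by positivity)
    linarith
  have sg_neg : ∀ s ∈ Set.Ioo (-(1 / q)) (1 / p), (s - m) ^ 2 ≤ R → g2 s ≤ 0 := by
    intro s hs h
    have : c / (2 * (p * q)) ≤ √((1 + q * s) * (1 - p * s)) := by
      apply le_sqrt_of_sq_le
      rw [hw s]
      have := mul_nonneg hpq0.le (sub_nonneg.2 h)
      linarith
    rw [div_le_iff₀ (by positivity)] at this
    apply div_nonpos_of_nonpos_of_nonneg _ (by positivity)
    linarith
  have z0 : g 0 = 0 ∧ g1 0 = 0 := by simp [g, g1]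
  have hx2 : 1 + q * (2 * m) = q / p := by
    rw [hm]; field_simp; rw [hq']; ring
  have hy2 : 1 - p * (2 * m) = p / q := by
    rw [hm]; field_simp; rw [hq']; ring
  have hxy : q / p * (p / q) = 1 := by field_simp
  have hlx : log (q / p) = log q - log p := log_div hq.ne' hp.ne'
  have hly : log (p / q) = log p - log q := log_div hp.ne' hq.ne'
  have hqp : p * (q / p) = q := by field_simp
  have hqp2 : q * (p / q) = p := by field_simp
  have hcm : c * (2 * m) = -(log p - log q) := by
    have : p * q * (c * (2 * m)) = p * q * (-(log p - log q)) := by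
      linear_combination (-1) * c * hmm - hc
    exact mul_left_cancel₀ hpq0.ne' this
  have z2 : g (2 * m) = 0 ∧ g1 (2 * m) = 0 := by
    simp only [g, g1, hx2, hy2, hxy, hlx, hly, sqrt_one]
    constructor
    · linear_combination (q - p) * hcm - (log q - log p) * hqp - (log p - log q) * hqp2
    · linear_combination (2 * c) * hmm + 2 * p * q * hcm - 2 * c * hmm - 2 * c * hmm + 2 * c * hmm
  have b0 : -(1 / q) < 0 ∧ 0 < 1 / p := ⟨by simp; positivity, by positivity⟩
  have b2 : -(1 / q) < 2 * m ∧ 2 * m < 1 / p := by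
    have e : 2 * m = 1 / p - 1 / q := by rw [hm]; field_simp
    rw [e]
    have : 0 < 1 / p := b0.2
    have : 0 < 1 / q := by positivity
    constructor <;> linarith
  have sqp : ∀ s, √R < |s - m| → R ≤ (s - m) ^ 2 := fun s h => by
    rw [← sq_abs]; exact ((sqrt_lt' (lt_of_le_of_lt hr0 h)).1 h).le
  have sl : ∀ s ∈ Set.Ioo (-(1 / q)) (1 / p), s < m - √R → 0 ≤ g2 s := fun s hs h =>
    sg_pos s hs (sqp s (lt_of_lt_of_le (by linarith) (neg_le_abs _)))
  have sr : ∀ s ∈ Set.Ioo (-(1 / q)) (1 / p), m + √R < s → 0 ≤ g2 s := fun s hs h =>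
    sg_pos s hs (sqp s (lt_of_lt_of_le (by linarith) (le_abs_self _)))
  have smid : ∀ s ∈ Set.Ioo (-(1 / q)) (1 / p), m - √R < s → s < m + √R → g2 s ≤ 0 :=
    fun s hs h h' => sg_neg s hs (by
      have : |s - m| < √R := abs_lt.2 ⟨by linarith, by linarith⟩
      rw [← sq_abs]
      exact ((lt_sqrt (abs_nonneg _)).1 this).le)
  rcases le_total 0 m with h | h
  · rw [abs_of_nonneg h] at hrm
    exact ssl_generic g g1 g2 _ _ 0 (2 * m) (m - √R) (m + √R) b0.1 (by linarith) (by linarith)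
      (by linarith) b2.2 gcont hd hd1 sl sr smid z0.1 z2.1 z0.2 z2.2
  · rw [abs_of_nonpos h] at hrm
    exact ssl_generic g g1 g2 _ _ (2 * m) 0 (m - √R) (m + √R) b2.1 (by linarith) (by linarith)
      (by linarith) b0.2 gcont hd hd1 sl sr smid z2.1 z0.1 z2.2 z0.2

/-- General two-point inequality. -/
lemma ssl_two (p q c : ℝ) (hp : 0 < p) (hq : 0 < q) (hpq : p + q = 1)
    (hc : c * (p - q) = p * q * (log p - log q)) (hc2 : 2 * (p * q) ≤ c)
    (a b : ℝ) (ha : 0 ≤ a) (hb : 0 ≤ b) :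
    p * (a * log a) + q * (b * log b) - (p * a + q * b) * log (p * a + q * b)
      ≤ c * (√a - √b) ^ 2 := by
  have hm0 : 0 ≤ p * a + q * b := by positivity
  have hc0 : 0 ≤ c := le_trans (by positivity) hc2
  rcases hm0.eq_or_lt with h | h
  · have h1 : p * a = 0 := by linarith [mul_nonneg hp.le ha, mul_nonneg hq.le hb]
    have h2 : q * b = 0 := by linarith
    have h1' : a = 0 := by simpa [hp.ne'] using h1
    have h2' : b = 0 := by simpa [hq.ne'] using h2
    subst h1' h2'
    simp
  · obtain ⟨M, hM⟩ : ∃ M, M = p * a + q * b := ⟨_, rfl⟩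
    rw [← hM] at h ⊢
    obtain ⟨x, rfl⟩ : ∃ x, a = M * x := ⟨a / M, by field_simp⟩
    obtain ⟨y, rfl⟩ : ∃ y, b = M * y := ⟨b / M, by field_simp⟩
    have hx : 0 ≤ x := nonneg_of_mul_nonneg_right ha h
    have hy : 0 ≤ y := nonneg_of_mul_nonneg_right hb h
    have hxy : p * x + q * y = 1 := by
      apply mul_left_cancel₀ h.ne'
      linarith
    have ex : 1 + q * (x - y) = x := by linear_combination (-1) * hxy + x * hpq
    have ey : 1 - p * (x - y) = y := by linear_combination (-1) * hxy + y * hpq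
    have key := ssl_norm p q c hp hq hpq hc hc2 (x - y) (by
      constructor
      · rw [← neg_div, div_le_iff₀ hq]; linarith
      · rw [le_div_iff₀ hp]; linarith)
    rw [ex, ey] at key
    have e1 : 2 + (q - p) * (x - y) = x + y := by linarith
    rw [e1] at key
    have lx : M * x * log (M * x) = M * (x * log x) + M * x * log M := by
      rcases hx.eq_or_lt with h0 | h0
      · simp [← h0]
      · rw [log_mul h.ne' h0.ne']; ring
    have ly : M * y * log (M * y) = M * (y * log y) + M * y * log M := by
      rcases hy.eq_or_lt with h0 | h0
      · simp [← h0]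
      · rw [log_mul h.ne' h0.ne']; ring
    have hs : (√(M * x) - √(M * y)) ^ 2 = M * (x + y - 2 * √(x * y)) := by
      rw [sqrt_mul h.le, sqrt_mul h.le, sqrt_mul hx]
      calc _ = √M ^ 2 * (√x ^ 2 + √y ^ 2 - 2 * (√x * √y)) := by ring
        _ = _ := by rw [sq_sqrt h.le, sq_sqrt hx, sq_sqrt hy]
    rw [lx, ly, hs]
    have := mul_nonneg h.le key
    have e : p * (M * (x * log x) + M * x * log M) + q * (M * (y * log y) + M * y * log M)
        - M * log M = M * (p * (x * log x) + q * (y * log y)) := by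
      linear_combination M * log M * hxy
    rw [e]
    linarith

lemma ssl_int (p : ℝ) (hp : 0 < p) (hp1 : p < 1) (G : Bool → ℝ) :
    ∫ x, G x ∂(ENNReal.ofReal p • Measure.dirac true
      + ENNReal.ofReal (1 - p) • Measure.dirac false) = p * G true + (1 - p) * G false := by
  rw [integral_add_measure]
  · rw [integral_smul_measure, integral_smul_measure, integral_dirac, integral_dirac,
      ENNReal.toReal_ofReal hp.le, ENNReal.toReal_ofReal (by linarith)]
    simp
  · exact (integrable_dirac (by simp)).smul_measure ENNReal.ofReal_ne_top
  · exact (integrable_dirac (by simp)).smul_measure ENNReal.ofReal_ne_top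

/-- Single-spin log-Sobolev inequality for the standard Dirichlet form: for the measure
`μ` on `{−1,+1}` (encoded as `Bool`, with `true ↦ +1`) with `μ(+1) = p`,
`Ent_μ(F) ≤ c(p) (√F(+1) − √F(−1))²` where `c(p) = pq(log p − log q)/(p − q)` (and
`c(1/2) = 1/2`); moreover `c(p) ≤ 1/2`, so the log-Sobolev constant with respect to the
standard Dirichlet form `D(F) = ½(F(+1) − F(−1))²` is at least `2`. -/
theorem single_spin_lsi_standard (p : ℝ) (hp : 0 < p) (hp1 : p < 1)
    (μ : Measure Bool)
    (hμ : μ = ENNReal.ofReal p • Measure.dirac true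
      + ENNReal.ofReal (1 - p) • Measure.dirac false)
    (c : ℝ)
    (hc : c = if p = 1/2 then 1/2
      else p * (1 - p) * (Real.log p - Real.log (1 - p)) / (p - (1 - p))) :
    (∀ F : Bool → ℝ, (∀ b, 0 ≤ F b) →
      entropy μ F ≤ c * (Real.sqrt (F true) - Real.sqrt (F false)) ^ 2)
    ∧ c ≤ 1/2
    ∧ (∀ F : Bool → ℝ, (∀ b, 0 ≤ F b) →
      entropy μ F ≤ (1/2) * (Real.sqrt (F true) - Real.sqrt (F false)) ^ 2) := by
  have hq : 0 < 1 - p := by linarith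
  have hpq0 : 0 < p * (1 - p) := by positivity
  have hcE : c * (p - (1 - p)) = p * (1 - p) * (Real.log p - Real.log (1 - p)) := by
    rw [hc]
    split_ifs with h
    · subst h; norm_num
    · have : p - (1 - p) ≠ 0 := fun h' => h (by linarith)
      field_simp
  have hlow : 2 * (p * (1 - p)) ≤ c := by
    by_cases h : p = 1 / 2
    · rw [hc, if_pos h, h]; norm_num
    · have hne : p - (1 - p) ≠ 0 := fun h' => h (by linarith)
      have h2 : 0 < (p - (1 - p)) ^ 2 := by positivity
      have := mul_nonneg hpq0.le (ssl_log1 p hp hp1)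
      have e : p * (1 - p) * ((p - (1 - p)) * (log p - log (1 - p) - 2 * (p - (1 - p))))
          = (c - 2 * (p * (1 - p))) * (p - (1 - p)) ^ 2 := by
        linear_combination (-(p - (1 - p))) * hcE
      rw [e] at this
      linarith [nonneg_of_mul_nonneg_left this h2]
  have hup : c ≤ 1 / 2 := by
    by_cases h : p = 1 / 2
    · rw [hc, if_pos h]
    · have hne : p - (1 - p) ≠ 0 := fun h' => h (by linarith)
      have h2 : 0 < (p - (1 - p)) ^ 2 := by positivity
      have := mul_nonneg hpq0.le (ssl_log2 p hp hp1)
      have e0 : p * (1 - p) * ((1 - p)⁻¹ - p⁻¹) = p - (1 - p) := by field_simp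
      have e : p * (1 - p) * ((p - (1 - p)) * (1 / 2 * ((1 - p)⁻¹ - p⁻¹)
          - (log p - log (1 - p)))) = (1 / 2 - c) * (p - (1 - p)) ^ 2 := by
        linear_combination (p - (1 - p)) * hcE + 1 / 2 * (p - (1 - p)) * e0
      rw [e] at this
      linarith [nonneg_of_mul_nonneg_left this h2]
  have main : ∀ F : Bool → ℝ, (∀ b, 0 ≤ F b) →
      entropy μ F ≤ c * (Real.sqrt (F true) - Real.sqrt (F false)) ^ 2 := by
    intro F hF
    unfold entropy
    rw [hμ, ssl_int p hp hp1, ssl_int p hp hp1]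
    exact ssl_two p (1 - p) c hp hq (by ring) hcE hlow _ _ (hF true) (hF false)
  exact ⟨main, hup, fun F hF => (main F hF).trans
    (mul_le_mul_of_nonneg_right hup (sq_nonneg _))⟩

end
end

section
/- (Single-spin modified log-Sobolev inequality for the heat-bath Dirichlet form.) Let p ∈ (0,1), q = 1 − p, and let μ be the probability measure on {−1,+1} with μ(+1) = p and μ(−1) = q. Then for every function F : {−1,+1} → (0,∞), Ent_μ(F) ≤ pq · (log F(+1) − log F(−1)) · (F(+1) − F(−1)). Equivalently, the modified log-Sobolev constant with respect to the heat-bath Dirichlet form D^{HB}(F, log F) = pq (F(+1) − F(−1))(log F(+1) − log F(−1)) is at least 1/2 (with the normalisation Ent_μ(F) ≤ (1/(2γ)) D^{HB}(F, log F)). -/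
open MeasureTheory Real

noncomputable section

/-- Single-spin modified log-Sobolev inequality for the heat-bath Dirichlet form: for the
measure `μ` on `{−1,+1}` (encoded as `Bool`, with `true ↦ +1`) with `μ(+1) = p`,
`Ent_μ(F) ≤ pq (log F(+1) − log F(−1)) (F(+1) − F(−1))`, i.e. the modified log-Sobolev
constant with respect to the heat-bath Dirichlet form
`D^{HB}(F, log F) = pq (F(+1) − F(−1))(log F(+1) − log F(−1))` is at least `1/2`. -/
theorem single_spin_mlsi_heat_bath (p : ℝ) (hp : 0 < p) (hp1 : p < 1)
    (μ : Measure Bool)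
    (hμ : μ = ENNReal.ofReal p • Measure.dirac true
      + ENNReal.ofReal (1 - p) • Measure.dirac false) :
    ∀ F : Bool → ℝ, (∀ b, 0 < F b) →
      entropy μ F ≤ p * (1 - p) * (Real.log (F true) - Real.log (F false))
        * (F true - F false) := by
  intro F hF
  have hq : 0 < 1 - p := by linarith
  have key : ∀ g : Bool → ℝ, ∫ x, g x ∂μ = p * g true + (1 - p) * g false := by
    intro g
    have h1 : ∀ b : Bool, Integrable g (Measure.dirac b) := fun b => Integrable.of_finite
    rw [hμ, integral_add_measure ((h1 _).smul_measure ENNReal.ofReal_ne_top)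
      ((h1 _).smul_measure ENNReal.ofReal_ne_top), integral_smul_measure, integral_smul_measure,
      integral_dirac, integral_dirac, ENNReal.toReal_ofReal hp.le, ENNReal.toReal_ofReal hq.le,
      smul_eq_mul, smul_eq_mul]
  unfold entropy
  rw [key, key]
  have ha := hF true
  have hb := hF false
  have hc := strictConcaveOn_log_Ioi.concaveOn.2 (Set.mem_Ioi.2 ha) (Set.mem_Ioi.2 hb)
    hp.le hq.le (by ring)
  simp only [smul_eq_mul] at hc
  have hm : 0 ≤ p * F true + (1 - p) * F false := by positivity
  have := mul_le_mul_of_nonneg_left hc hm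
  linear_combination this

end
end

section
/- (Log-Sobolev inequality for ferromagnetic Ising models up to the critical point.) Let Λ be a finite set and A a symmetric positive definite Λ×Λ matrix with spectrum contained in (0,1] and with ferromagnetic off-diagonal entries, i.e. A_{xy} ≤ 0 for x ≠ y. For t > 0 and g ∈ ℝ^Λ let μ_{t,g} be the Ising measure on {−1,+1}^Λ with μ_{t,g}(σ) ∝ exp(−(t/2)(σ, Aσ) + (g,σ)), and let χ_t denote the largest eigenvalue of the two-point matrix (E_{μ_{t,0}}[σ_x σ_y])_{x,y∈Λ}. Then for every β > 0 and every h ∈ ℝ^Λ, the measure μ_{β,h} satisfies the log-Sobolev inequality with respect to the standard Dirichlet form D(F) = (1/2) Σ_{x∈Λ} E_{μ_{β,h}}[(F(σ^x) − F(σ))²] with constant γ_{β,h} satisfying 1/γ_{β,h} ≤ 1/2 + ∫₀^β exp(2 ∫₀^t χ_s ds) dt; that is, Ent_{μ_{β,h}}(F) ≤ (1 + 2 ∫₀^β exp(2 ∫₀^t χ_s ds) dt) · D(√F) for every F : {−1,+1}^Λ → [0,∞). -/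
open Real Matrix

noncomputable section

/-- The `±1`-valued spin configuration associated with `σ : Λ → Bool` (`true ↦ +1`). -/
def spin {Λ : Type*} (σ : Λ → Bool) : Λ → ℝ := fun x => if σ x then 1 else -1

/-- Unnormalised Ising weight at inverse temperature `t` with external field `g`. -/
def isingWeight {Λ : Type*} [Fintype Λ] (A : Matrix Λ Λ ℝ) (t : ℝ) (g : Λ → ℝ)
    (σ : Λ → Bool) : ℝ :=
  Real.exp (-(t / 2) * (spin σ ⬝ᵥ A.mulVec (spin σ)) + g ⬝ᵥ spin σ)

/-- The Ising probability measure `μ(σ) ∝ exp(−(t/2)(σ, Aσ) + (g,σ))`. -/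
def isingProb {Λ : Type*} [Fintype Λ] [DecidableEq Λ] (A : Matrix Λ Λ ℝ) (t : ℝ)
    (g : Λ → ℝ) (σ : Λ → Bool) : ℝ :=
  isingWeight A t g σ / ∑ σ' : Λ → Bool, isingWeight A t g σ'

/-- Entropy of `F` under a probability weight `μ` on a finite configuration space. -/
def fent {Λ : Type*} [Fintype Λ] [DecidableEq Λ] (μ F : (Λ → Bool) → ℝ) : ℝ :=
  (∑ σ : Λ → Bool, μ σ * (F σ * Real.log (F σ)))
    - (∑ σ : Λ → Bool, μ σ * F σ) * Real.log (∑ σ : Λ → Bool, μ σ * F σ)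

/-- The configuration `σ` with the spin at `x` flipped. -/
def spinFlip {Λ : Type*} [DecidableEq Λ] (x : Λ) (σ : Λ → Bool) : Λ → Bool :=
  Function.update σ x (!σ x)

/-- The standard Dirichlet form `D_μ(F) = ½ Σ_x E_μ[(F(σ^x) − F(σ))²]`. -/
def dirichlet {Λ : Type*} [Fintype Λ] [DecidableEq Λ] (μ F : (Λ → Bool) → ℝ) : ℝ :=
  (1/2) * ∑ x : Λ, ∑ σ : Λ → Bool, μ σ * (F (spinFlip x σ) - F σ) ^ 2

set_option linter.unusedSectionVars false

/-! Part 1 -/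



def Ham {Λ : Type*} [Fintype Λ] (J : Λ → Λ → ℝ) (h : Λ → ℝ) (σ : Λ → Bool) : ℝ :=
  (1/2) * ∑ x, ∑ y, J x y * (spin σ x * spin σ y) + ∑ x, h x * spin σ x

def Zp {Λ : Type*} [Fintype Λ] [DecidableEq Λ] (J : Λ → Λ → ℝ) (h : Λ → ℝ) : ℝ :=
  ∑ σ : Λ → Bool, Real.exp (Ham J h σ)

def LZ {Λ : Type*} [Fintype Λ] [DecidableEq Λ] (J : Λ → Λ → ℝ) (h : Λ → ℝ) : ℝ :=
  Real.log (Zp J h)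

lemma bool_lat1 (a b : Bool) : ((if a then (1:ℝ) else -1) + if b then (1:ℝ) else -1) =
    (if a ⊓ b then (1:ℝ) else -1) + if a ⊔ b then (1:ℝ) else -1 := by
  cases a <;> cases b <;> norm_num

lemma bool_lat2 (a b a' b' : Bool) :
    (((if a then (1:ℝ) else -1) * if a' then (1:ℝ) else -1) +
      (if b then (1:ℝ) else -1) * if b' then (1:ℝ) else -1) ≤
    ((if a ⊓ b then (1:ℝ) else -1) * if a' ⊓ b' then (1:ℝ) else -1) +
      (if a ⊔ b then (1:ℝ) else -1) * if a' ⊔ b' then (1:ℝ) else -1 := by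
  cases a <;> cases b <;> cases a' <;> cases b' <;> norm_num

section G
variable {Λ : Type*} [Fintype Λ] [DecidableEq Λ]

lemma Zp_pos (J : Λ → Λ → ℝ) (h : Λ → ℝ) : 0 < Zp J h :=
  Finset.sum_pos (fun _ _ => Real.exp_pos _) Finset.univ_nonempty

lemma Ham_add (J : Λ → Λ → ℝ) (h k : Λ → ℝ) (σ : Λ → Bool) :
    Ham J (h + k) σ = Ham J h σ + ∑ x, k x * spin σ x := by
  simp only [Ham, Pi.add_apply, add_mul, Finset.sum_add_distrib]; ring

lemma spin_not (σ : Λ → Bool) (x : Λ) : spin (fun y => !σ y) x = - spin σ x := by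
  unfold spin; cases h : σ x <;> simp [h]

lemma spin_sq (σ : Λ → Bool) (x : Λ) : spin σ x * spin σ x = 1 := by
  unfold spin; cases σ x <;> simp

lemma spin_mono (x : Λ) : Monotone (fun σ : Λ → Bool => spin σ x) := by
  intro a b hab
  have := hab x
  simp only [spin]
  revert this
  cases a x <;> cases b x <;> simp

def notEquiv (Λ : Type*) : (Λ → Bool) ≃ (Λ → Bool) where
  toFun σ := fun x => !σ x
  invFun σ := fun x => !σ x
  left_inv σ := by ext; simp
  right_inv σ := by ext; simp

lemma LZ_neg (J : Λ → Λ → ℝ) (h : Λ → ℝ) : LZ J (-h) = LZ J h := by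
  unfold LZ Zp
  congr 1
  refine Fintype.sum_equiv (notEquiv Λ) _ _ fun σ => ?_
  simp only [Ham, notEquiv, Equiv.coe_fn_mk, spin_not, Pi.neg_apply]
  congr 2
  · simp
  · simp

lemma Ham_super (J : Λ → Λ → ℝ) (hJ : ∀ x y, x ≠ y → 0 ≤ J x y) (h : Λ → ℝ)
    (a b : Λ → Bool) : Ham J h a + Ham J h b ≤ Ham J h (a ⊓ b) + Ham J h (a ⊔ b) := by
  have h1 : ∀ x, spin a x + spin b x = spin (a ⊓ b) x + spin (a ⊔ b) x := by
    intro x; exact bool_lat1 _ _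
  have h2 : ∀ x y, J x y * (spin a x * spin a y) + J x y * (spin b x * spin b y) ≤
      J x y * (spin (a ⊓ b) x * spin (a ⊓ b) y) + J x y * (spin (a ⊔ b) x * spin (a ⊔ b) y) := by
    intro x y
    by_cases hxy : x = y
    · subst hxy; simp [spin_sq]
    · rw [← mul_add, ← mul_add]
      apply mul_le_mul_of_nonneg_left _ (hJ x y hxy)
      exact bool_lat2 _ _ _ _
  have h3 : ∑ x, h x * spin a x + ∑ x, h x * spin b x =
      ∑ x, h x * spin (a ⊓ b) x + ∑ x, h x * spin (a ⊔ b) x := by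
    simp only [← Finset.sum_add_distrib, ← mul_add, h1]
  have h4 := Finset.sum_le_sum (s := Finset.univ) (fun x _ =>
    Finset.sum_le_sum (s := Finset.univ) (fun y _ => h2 x y))
  simp only [Finset.sum_add_distrib] at h4
  unfold Ham
  linarith

lemma Ham_lattice (J : Λ → Λ → ℝ) (hJ : ∀ x y, x ≠ y → 0 ≤ J x y) (h : Λ → ℝ)
    (a b : Λ → Bool) : Real.exp (Ham J h a) * Real.exp (Ham J h b) ≤
      Real.exp (Ham J h (a ⊓ b)) * Real.exp (Ham J h (a ⊔ b)) := by
  rw [← Real.exp_add, ← Real.exp_add]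
  exact Real.exp_le_exp.2 (Ham_super J hJ h a b)

lemma lin_mono (d : Λ → ℝ) (hd : 0 ≤ d) : Monotone (fun σ : Λ → Bool => Real.exp (∑ x, d x * spin σ x)) := by
  intro a b hab
  apply Real.exp_le_exp.2
  exact Finset.sum_le_sum fun x _ => mul_le_mul_of_nonneg_left (spin_mono x hab) (hd x)

lemma LZ_super (J : Λ → Λ → ℝ) (hJ : ∀ x y, x ≠ y → 0 ≤ J x y) (h d k : Λ → ℝ)
    (hd : 0 ≤ d) (hk : 0 ≤ k) : LZ J (h + d) + LZ J (h + k) ≤ LZ J h + LZ J (h + d + k) := by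
  unfold LZ
  rw [← Real.log_mul (Zp_pos _ _).ne' (Zp_pos _ _).ne', ← Real.log_mul (Zp_pos _ _).ne' (Zp_pos _ _).ne']
  apply Real.log_le_log (mul_pos (Zp_pos _ _) (Zp_pos _ _))
  have := fkg (fun σ : Λ → Bool => Real.exp (∑ x, d x * spin σ x))
    (fun σ : Λ → Bool => Real.exp (∑ x, k x * spin σ x)) (fun σ => Real.exp (Ham J h σ))
    (fun _ => (Real.exp_pos _).le) (fun _ => (Real.exp_pos _).le) (fun _ => (Real.exp_pos _).le)
    (lin_mono d hd) (lin_mono k hk) (Ham_lattice J hJ h)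
  simpa only [Zp, Ham_add, Real.exp_add, mul_assoc] using this

lemma cov_nonneg' (J : Λ → Λ → ℝ) (hJ : ∀ x y, x ≠ y → 0 ≤ J x y) (h : Λ → ℝ) (x y : Λ) :
    (∑ σ, Real.exp (Ham J h σ) * spin σ x) * (∑ σ, Real.exp (Ham J h σ) * spin σ y) ≤
      Zp J h * ∑ σ, Real.exp (Ham J h σ) * (spin σ x * spin σ y) := by
  have hs : ∀ (σ : Λ → Bool) z, 0 ≤ spin σ z + 1 := by
    intro σ z; unfold spin; cases σ z <;> norm_num
  have := fkg (fun σ : Λ → Bool => spin σ x + 1) (fun σ : Λ → Bool => spin σ y + 1)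
    (fun σ => Real.exp (Ham J h σ))
    (fun _ => (Real.exp_pos _).le) (fun σ => hs σ x) (fun σ => hs σ y)
    (fun a b hab => by simpa using spin_mono x hab) (fun a b hab => by simpa using spin_mono y hab)
    (Ham_lattice J hJ h)
  have e : ∀ σ : Λ → Bool, (spin σ x + 1) * (spin σ y + 1) = spin σ x * spin σ y + spin σ x + spin σ y + 1 := by
    intro σ; ring
  simp only [e, mul_add, Finset.sum_add_distrib, mul_one] at this
  simp only [Zp]
  nlinarith [this]

end G

/-! Part 2 -/


lemma hdcg {f g : ℝ → ℝ} {a b x : ℝ} (h : HasDerivAt f a x) (hf : ∀ y, g y = f y)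
    (hab : b = a) : HasDerivAt g b x := by
  have : g = f := funext hf
  rw [this, hab]; exact h

lemma my_hasDerivAt_tanh (x : ℝ) : HasDerivAt Real.tanh (1 - Real.tanh x ^ 2) x := by
  have h := (Real.hasDerivAt_sinh x).div (Real.hasDerivAt_cosh x) (Real.cosh_pos x).ne'
  refine hdcg h (fun y => Real.tanh_eq_sinh_div_cosh y) ?_
  have := (Real.cosh_pos x).ne'
  rw [Real.tanh_eq_sinh_div_cosh]
  field_simp

lemma my_tanh_lt {x y : ℝ} (h : x < y) : Real.tanh x < Real.tanh y := by
  rw [Real.tanh_eq_sinh_div_cosh, Real.tanh_eq_sinh_div_cosh,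
    div_lt_div_iff₀ (Real.cosh_pos _) (Real.cosh_pos _)]
  have := Real.sinh_sub y x
  have h2 : 0 < Real.sinh (y - x) := Real.sinh_pos_iff.2 (by linarith)
  linarith

lemma my_tanh_inj {x y : ℝ} (h : Real.tanh x = Real.tanh y) : x = y := by
  rcases lt_trichotomy x y with h1 | h1 | h1
  · exact absurd h (my_tanh_lt h1).ne
  · exact h1
  · exact absurd h (my_tanh_lt h1).ne'

def lc (x : ℝ) : ℝ := Real.log (Real.cosh x)

lemma lc_neg (x : ℝ) : lc (-x) = lc x := by simp [lc]

lemma hasDerivAt_lc (x : ℝ) : HasDerivAt lc (Real.tanh x) x := by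
  have := (Real.hasDerivAt_cosh x).log (Real.cosh_pos x).ne'
  rw [Real.tanh_eq_sinh_div_cosh]; exact this

lemma continuous_lc : Continuous lc :=
  continuous_iff_continuousAt.2 fun x => (hasDerivAt_lc x).continuousAt

lemma lc_sub_le {x y : ℝ} (h : x ≤ y) : lc y - lc x ≤ y - x := by
  unfold lc
  rw [← Real.log_div (Real.cosh_pos _).ne' (Real.cosh_pos _).ne',
    Real.log_le_iff_le_exp (div_pos (Real.cosh_pos _) (Real.cosh_pos _)),
    div_le_iff₀ (Real.cosh_pos _), Real.cosh_eq, Real.cosh_eq]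
  have e1 : Real.exp (y - x) * Real.exp x = Real.exp y := by rw [← Real.exp_add]; ring_nf
  have e2 : Real.exp (-y) ≤ Real.exp (y - x) * Real.exp (-x) := by
    rw [← Real.exp_add]; exact Real.exp_le_exp.2 (by linarith)
  nlinarith

lemma lc_asymp (η : ℝ) (hη : 0 < η) : ∃ X : ℝ, ∀ x, X ≤ x → |lc x - x + Real.log 2| < η := by
  have key : ∀ x, lc x - x + Real.log 2 = Real.log (1 + Real.exp (-2 * x)) := by
    intro x
    have : Real.cosh x = Real.exp x * (1 + Real.exp (-2 * x)) / 2 := by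
      rw [Real.cosh_eq, mul_add, ← Real.exp_add]; ring_nf
    unfold lc
    rw [this, Real.log_div (by positivity) (by norm_num), Real.log_mul (by positivity) (by positivity),
      Real.log_exp]
    ring
  have h1 : Filter.Tendsto (fun x : ℝ => Real.log (1 + Real.exp (-2 * x))) Filter.atTop (nhds 0) := by
    have h2 : Filter.Tendsto (fun x : ℝ => Real.exp (-2 * x)) Filter.atTop (nhds 0) := by
      apply Real.tendsto_exp_atBot.comp
      exact Filter.tendsto_id.const_mul_atTop_of_neg (by norm_num)
    have h3 : Filter.Tendsto (fun x : ℝ => 1 + Real.exp (-2 * x)) Filter.atTop (nhds 1) := by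
      simpa using h2.const_add 1
    have := h3.log (by norm_num)
    simpa using this
  have h2 := (Metric.tendsto_nhds.1 h1) η hη
  obtain ⟨X, hX⟩ := Filter.eventually_atTop.1 h2
  refine ⟨X, fun x hx => ?_⟩
  rw [key]
  simpa [Real.dist_eq] using hX x hx

lemma deriv2_nonpos {f f' : ℝ → ℝ} {d x0 : ℝ} (h1 : ∀ x, HasDerivAt f (f' x) x)
    (h2 : HasDerivAt f' d x0) (hmax : IsLocalMax f x0) : d ≤ 0 := by
  by_contra hd
  push Not at hd
  have e : deriv f = f' := by ext x; exact (h1 x).deriv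
  have hmin : IsLocalMin f x0 := by
    apply isLocalMin_of_deriv_deriv_pos
    · rw [e, h2.deriv]; exact hd
    · rw [e]; exact hmax.hasDerivAt_eq_zero (h1 x0)
    · exact (h1 x0).continuousAt
  have h3 : f =ᶠ[nhds x0] fun _ => f x0 := by
    filter_upwards [hmin, hmax] with y a b
    exact le_antisymm b a
  have h4 : deriv f =ᶠ[nhds x0] deriv (fun _ => f x0) := h3.deriv
  rw [e] at h4
  have h5 := h4.deriv_eq
  rw [h2.deriv] at h5
  simp at h5
  linarith

lemma tanh_diff (a b : ℝ) :
    (Real.tanh (b + a) - Real.tanh (b - a)) * (Real.cosh a ^ 2 + Real.sinh b ^ 2) =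
      2 * Real.sinh a * Real.cosh a := by
  have h1 : Real.cosh (b + a) * Real.cosh (b - a) = Real.cosh a ^ 2 + Real.sinh b ^ 2 := by
    rw [Real.cosh_add, Real.cosh_sub]
    have := Real.cosh_sq a
    have := Real.cosh_sq b
    nlinarith
  have h2 : Real.sinh (b + a) * Real.cosh (b - a) - Real.sinh (b - a) * Real.cosh (b + a) =
      2 * Real.sinh a * Real.cosh a := by
    have := Real.sinh_sub (b + a) (b - a)
    rw [show b + a - (b - a) = 2 * a by ring, Real.sinh_two_mul] at this
    linarith
  rw [← h1, ← h2, Real.tanh_eq_sinh_div_cosh, Real.tanh_eq_sinh_div_cosh]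
  have := (Real.cosh_pos (b + a)).ne'
  have := (Real.cosh_pos (b - a)).ne'
  field_simp

/-- If the half-difference of `tanh` is at least `tanh κ` with `κ>0`, `a ≤ κ`, equality. -/
lemma tanh_rigid {a b κ p : ℝ} (hκ : 0 < κ) (ha : a ≤ κ)
    (hp : 2 * p = Real.tanh (b + a) - Real.tanh (b - a)) (h : Real.tanh κ ≤ p) :
    a = κ ∧ b = 0 := by
  have hd := tanh_diff a b
  rw [← hp] at hd
  have hca := Real.cosh_pos a
  have htk : 0 < Real.tanh κ := by have := my_tanh_lt hκ; simpa using this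
  have hp0 : 0 < p := lt_of_lt_of_le htk h
  have hsa : 0 < Real.sinh a := by
    by_contra hs
    push Not at hs
    have : 0 < 2 * p * (Real.cosh a ^ 2 + Real.sinh b ^ 2) := by positivity
    nlinarith
  have hpa : p * Real.cosh a ≤ Real.sinh a := by
    have : p * Real.cosh a * Real.cosh a ≤ Real.sinh a * Real.cosh a := by
      nlinarith [sq_nonneg (Real.sinh b)]
    exact le_of_mul_le_mul_right this hca
  have hpa' : p ≤ Real.tanh a := by
    rw [Real.tanh_eq_sinh_div_cosh, le_div_iff₀ hca]; exact hpa
  have hak : a = κ := by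
    by_contra hne
    have := my_tanh_lt (lt_of_le_of_ne ha hne)
    linarith
  refine ⟨hak, ?_⟩
  subst hak
  have hpe : p = Real.tanh a := le_antisymm hpa' h
  have h3 : p * Real.cosh a = Real.sinh a := by
    rw [hpe, Real.tanh_eq_sinh_div_cosh]; field_simp
  have h4 : p * Real.sinh b ^ 2 = 0 := by nlinarith
  have h5 : Real.sinh b = 0 := by
    rcases mul_eq_zero.1 h4 with h | h
    · linarith
    · exact pow_eq_zero_iff (by norm_num) |>.1 h
  exact Real.sinh_eq_zero.1 h5

lemma E4_alg {t1 t2 t3 t4 τ τ' : ℝ} (E1 : t1 + t2 - t3 - t4 = 0)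
    (E2 : t1 - t2 - t3 + t4 - (2 * τ - 2 * τ') = 0)
    (E3 : (1 - t1 ^ 2) + (1 - t2 ^ 2) - (1 - t3 ^ 2) - (1 - t4 ^ 2)
      - (2 * (1 - τ ^ 2) - 2 * (1 - τ' ^ 2)) ≤ 0) (hτ : τ' < τ) : τ ≤ (t1 - t2) / 2 := by
  have e1 : (t1 - t2) - (t3 - t4) = 2 * (τ - τ') := by linarith
  have e2 : (t1 - t2) ^ 2 - (t3 - t4) ^ 2 ≥ 4 * (τ ^ 2 - τ' ^ 2) := by
    have : (t1 + t2) ^ 2 = (t3 + t4) ^ 2 := by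
      have : t1 + t2 = t3 + t4 := by linarith
      rw [this]
    nlinarith
  have e3 : (τ - τ') * (2 * (τ + τ')) ≤ (τ - τ') * ((t1 - t2) + (t3 - t4)) := by nlinarith
  have e4 := le_of_mul_le_mul_left e3 (by linarith)
  linarith

def kphi (c m1 m2 m3 m4 h K : ℝ) : ℝ :=
  c + lc (h + K + m1) + lc (h - K + m2) - lc (h + K + m3) - lc (h - K + m4)

lemma kphi_far (c m1 m2 m3 m4 B : ℝ) (hB : ∀ h, kphi c m1 m2 m3 m4 h 0 ≤ B) (ε R : ℝ) (hε : 0 < ε) :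
    ∃ H : ℝ, ∀ h, H ≤ h → ∀ K, 0 ≤ K → K ≤ R → kphi c m1 m2 m3 m4 h K < B + ε := by
  obtain ⟨X, hX⟩ := lc_asymp (ε / 8) (by linarith)
  refine ⟨X + R + |m1| + |m2| + |m3| + |m4|, fun h hh K hK hKR => ?_⟩
  have := hB h
  unfold kphi at this ⊢
  have a1 := abs_nonneg m1; have a2 := abs_nonneg m2; have a3 := abs_nonneg m3; have a4 := abs_nonneg m4
  have b1 := neg_abs_le m1; have b2 := neg_abs_le m2; have b3 := neg_abs_le m3; have b4 := neg_abs_le m4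
  have c1 := abs_lt.1 (hX (h + K + m1) (by linarith))
  have c2 := abs_lt.1 (hX (h - K + m2) (by linarith))
  have c3 := abs_lt.1 (hX (h + K + m3) (by linarith))
  have c4 := abs_lt.1 (hX (h - K + m4) (by linarith))
  have d1 := abs_lt.1 (hX (h + 0 + m1) (by linarith))
  have d2 := abs_lt.1 (hX (h - 0 + m2) (by linarith))
  have d3 := abs_lt.1 (hX (h + 0 + m3) (by linarith))
  have d4 := abs_lt.1 (hX (h - 0 + m4) (by linarith))
  linarith [c1.1, c1.2, c2.1, c2.2, c3.1, c3.2, c4.1, c4.2, d1.1, d1.2, d2.1, d2.2, d3.1, d3.2, d4.1, d4.2]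

lemma kphi_symm (c m1 m2 m3 m4 h K : ℝ) :
    kphi c (-m2) (-m1) (-m4) (-m3) (-h) K = kphi c m1 m2 m3 m4 h K := by
  unfold kphi
  rw [← lc_neg (h + K + m1), ← lc_neg (h - K + m2), ← lc_neg (h + K + m3), ← lc_neg (h - K + m4)]
  ring_nf

set_option maxHeartbeats 800000 in
lemma K_lemma (c c0 m1 m2 m3 m4 μ μ' : ℝ) (h31 : m3 ≤ m1) (h24 : m2 ≤ m4) (hμ : μ' ≤ μ)
    (hμ0 : 0 ≤ μ) (h12 : m1 - m2 ≤ 2 * μ)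
    (h0 : ∀ h, kphi c m1 m2 m3 m4 h 0 ≤ c0 + 2 * lc μ - 2 * lc μ')
    (hinf : c + m1 - m3 - m2 + m4 ≤ c0 + 2 * μ - 2 * μ') (h K : ℝ) (hK : 0 ≤ K) :
    kphi c m1 m2 m3 m4 h K ≤ c0 + 2 * lc (K + μ) - 2 * lc (K + μ') := by
  have hub : ∀ h K, kphi c m1 m2 m3 m4 h K ≤ c0 + 2 * μ - 2 * μ' := by
    intro h K
    have e1 := lc_sub_le (show h + K + m3 ≤ h + K + m1 by linarith)
    have e2 := lc_sub_le (show h - K + m2 ≤ h - K + m4 by linarith)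
    have e3 := lc_sub_le (show -(h - K + m4) ≤ -(h - K + m2) by linarith)
    rw [lc_neg, lc_neg] at e3
    unfold kphi; linarith
  rcases hμ.eq_or_lt with rfl | hlt
  · have := hub h K; linarith
  by_contra hcon
  push Not at hcon
  obtain ⟨Φ, hΦ⟩ : ∃ Φ : ℝ → ℝ → ℝ, Φ = fun h K => kphi c m1 m2 m3 m4 h K -
    (c0 + 2 * lc (K + μ) - 2 * lc (K + μ')) := ⟨_, rfl⟩
  obtain ⟨ε, hε⟩ : ∃ ε, ε = Φ h K := ⟨_, rfl⟩
  have hεpos : 0 < ε := by simp only [hε, hΦ]; linarith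
  -- monotonicity of φ0
  have hder0 : ∀ K, HasDerivAt (fun K => c0 + 2 * lc (K + μ) - 2 * lc (K + μ'))
      (2 * Real.tanh (K + μ) - 2 * Real.tanh (K + μ')) K := by
    intro K
    have a := ((hasDerivAt_lc (K + μ)).comp_add_const K μ).const_mul 2
    have b := ((hasDerivAt_lc (K + μ')).comp_add_const K μ').const_mul 2
    exact (a.const_add c0).sub b
  have hmono : Monotone (fun K => c0 + 2 * lc (K + μ) - 2 * lc (K + μ')) := by
    apply monotone_of_deriv_nonneg
    · intro K; exact (hder0 K).differentiableAt
    · intro K; rw [(hder0 K).deriv]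
      have := my_tanh_lt (show K + μ' < K + μ by linarith); linarith
  -- R
  obtain ⟨X, hX⟩ := lc_asymp (ε / 8) (by linarith)
  obtain ⟨R, hR⟩ : ∃ R, R = max (K + 1) (X + |μ| + |μ'|) := ⟨_, rfl⟩
  have hR1 : K + 1 ≤ R := hR ▸ le_max_left _ _
  have hR2 : X + |μ| + |μ'| ≤ R := hR ▸ le_max_right _ _
  have hRfar : ∀ h, Φ h R < ε := by
    intro h'
    have b1 := neg_abs_le μ; have b2 := neg_abs_le μ'
    have a1 := abs_nonneg μ; have a2 := abs_nonneg μ'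
    have c1 := abs_lt.1 (hX (R + μ) (by linarith))
    have c2 := abs_lt.1 (hX (R + μ') (by linarith))
    have := hub h' R
    simp only [hΦ]
    linarith [c1.1, c1.2, c2.1, c2.2]
  obtain ⟨H1, hH1⟩ := kphi_far c m1 m2 m3 m4 _ h0 ε R hεpos
  obtain ⟨H2, hH2⟩ := kphi_far c (-m2) (-m1) (-m4) (-m3) (c0 + 2 * lc μ - 2 * lc μ')
    (by intro h'; have := kphi_symm c m1 m2 m3 m4 (-h') 0; rw [neg_neg] at this; rw [this]; exact h0 _) ε R hεpos
  obtain ⟨H, hH⟩ : ∃ H, H = max (max H1 H2) (|h| + 1) := ⟨_, rfl⟩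
  have hHa : H1 ≤ H := hH ▸ (le_max_left _ _).trans (le_max_left _ _)
  have hHb : H2 ≤ H := hH ▸ (le_max_right _ _).trans (le_max_left _ _)
  have hHc : |h| + 1 ≤ H := hH ▸ le_max_right _ _
  have hHfar : ∀ h' K', H ≤ |h'| → 0 ≤ K' → K' ≤ R → Φ h' K' < ε := by
    intro h' K' hh hK0 hKR
    have hm := hmono hK0
    simp only [zero_add] at hm
    have : kphi c m1 m2 m3 m4 h' K' < c0 + 2 * lc μ - 2 * lc μ' + ε := by
      rcases abs_cases h' with ⟨e, _⟩ | ⟨e, _⟩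
      · exact hH1 h' (by linarith) K' hK0 hKR
      · rw [← kphi_symm]; exact hH2 (-h') (by linarith) K' hK0 hKR
    simp only [hΦ]; linarith
  have hcont : Continuous (fun p : ℝ × ℝ => Φ p.1 p.2) := by
    have := continuous_lc
    simp only [hΦ, kphi]
    fun_prop
  obtain ⟨⟨a, k⟩, hmem, hmax⟩ := (isCompact_Icc (a := -H) (b := H) |>.prod (isCompact_Icc (a := (0:ℝ)) (b := R))).exists_isMaxOn
    ⟨(h, K), by
      have := neg_abs_le h; have := le_abs_self h
      exact ⟨⟨by simp only; linarith, by simp only; linarith⟩, ⟨hK, by simp only; linarith⟩⟩⟩ hcont.continuousOn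
  rw [isMaxOn_iff] at hmax
  have hge : ε ≤ Φ a k := by
    have := hmax (h, K) (show (h, K) ∈ Set.Icc (-H) H ×ˢ Set.Icc 0 R by
      have := neg_abs_le h; have := le_abs_self h
      exact ⟨⟨by simp only; linarith, by simp only; linarith⟩, ⟨hK, by simp only; linarith⟩⟩)
    rw [hε]; exact this
  obtain ⟨⟨ha1, ha2⟩, ⟨hk1, hk2⟩⟩ := hmem
  simp only at ha1 ha2 hk1 hk2
  have hk0 : 0 < k := by
    rcases hk1.eq_or_lt with e | e
    · exfalso
      rw [← e] at hge
      have := h0 a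
      simp only [hΦ, zero_add] at hge
      linarith
    · exact e
  have hkR : k < R := by
    rcases hk2.eq_or_lt with e | e
    · rw [e] at hge; have := hRfar a; linarith
    · exact e
  have haH : |a| < H := by
    by_contra hh
    push Not at hh
    have := hHfar a k hh hk1 hk2
    linarith
  have haH' := abs_lt.1 haH
  have hlocA : IsLocalMax (fun h => Φ h k) a := by
    filter_upwards [Ioo_mem_nhds haH'.1 haH'.2] with y hy
    exact hmax (y, k) (show (y, k) ∈ Set.Icc (-H) H ×ˢ Set.Icc 0 R from ⟨⟨hy.1.le, hy.2.le⟩, ⟨hk1, hk2⟩⟩)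
  have hlocK : IsLocalMax (fun K => Φ a K) k := by
    filter_upwards [Ioo_mem_nhds hk0 hkR] with y hy
    exact hmax (a, y) (show (a, y) ∈ Set.Icc (-H) H ×ˢ Set.Icc 0 R from ⟨⟨ha1, ha2⟩, ⟨hy.1.le, hy.2.le⟩⟩)
  have hdA : HasDerivAt (fun h => Φ h k) (Real.tanh (a + k + m1) + Real.tanh (a - k + m2)
      - Real.tanh (a + k + m3) - Real.tanh (a - k + m4)) a := by
    have aux : ∀ d, HasDerivAt (fun h => lc (h + d)) (Real.tanh (a + d)) a :=
      fun d => (hasDerivAt_lc (a + d)).comp_add_const a d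
    have := ((((aux (k + m1)).const_add c).add (aux (-k + m2))).sub (aux (k + m3))).sub (aux (-k + m4))
    have := this.sub_const (c0 + 2 * lc (k + μ) - 2 * lc (k + μ'))
    refine hdcg this (fun h => ?_) ?_
    · simp only [hΦ, kphi, Pi.add_apply, Pi.sub_apply]; ring_nf
    · ring_nf
  have hdK : ∀ k, HasDerivAt (fun K => Φ a K) (Real.tanh (a + k + m1) - Real.tanh (a - k + m2)
      - Real.tanh (a + k + m3) + Real.tanh (a - k + m4) - (2 * Real.tanh (k + μ) - 2 * Real.tanh (k + μ'))) k := by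
    intro k
    have aux : ∀ d, HasDerivAt (fun K => lc (a + K + d)) (Real.tanh (a + k + d)) k := by
      intro d
      have := (hasDerivAt_lc (a + k + d)).comp k (((hasDerivAt_id k).const_add a).add_const d)
      exact hdcg this (fun _ => rfl) (by ring)
    have aux' : ∀ d, HasDerivAt (fun K => lc (a - K + d)) (-Real.tanh (a - k + d)) k := by
      intro d
      have := (hasDerivAt_lc (a - k + d)).comp k (((hasDerivAt_id k).const_sub a).add_const d)
      exact hdcg this (fun _ => rfl) (by ring)
    have := ((((aux m1).const_add c).add (aux' m2)).sub (aux m3)).sub (aux' m4)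
    have := this.sub (hder0 k)
    refine hdcg this (fun h => ?_) ?_
    · rw [hΦ]; rfl
    · ring_nf
  have hdK2 : HasDerivAt (fun k => Real.tanh (a + k + m1) - Real.tanh (a - k + m2)
      - Real.tanh (a + k + m3) + Real.tanh (a - k + m4) - (2 * Real.tanh (k + μ) - 2 * Real.tanh (k + μ')))
      ((1 - Real.tanh (a + k + m1) ^ 2) + (1 - Real.tanh (a - k + m2) ^ 2)
      - (1 - Real.tanh (a + k + m3) ^ 2) - (1 - Real.tanh (a - k + m4) ^ 2)
      - (2 * (1 - Real.tanh (k + μ) ^ 2) - 2 * (1 - Real.tanh (k + μ') ^ 2))) k := by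
    have aux : ∀ d, HasDerivAt (fun K => Real.tanh (a + K + d)) (1 - Real.tanh (a + k + d) ^ 2) k := by
      intro d
      have := (my_hasDerivAt_tanh (a + k + d)).comp k (((hasDerivAt_id k).const_add a).add_const d)
      exact hdcg this (fun _ => rfl) (by ring)
    have aux' : ∀ d, HasDerivAt (fun K => Real.tanh (a - K + d)) (-(1 - Real.tanh (a - k + d) ^ 2)) k := by
      intro d
      have := (my_hasDerivAt_tanh (a - k + d)).comp k (((hasDerivAt_id k).const_sub a).add_const d)
      refine hdcg this (fun _ => rfl) ?_
      ring
    have a0 := ((my_hasDerivAt_tanh (k + μ)).comp_add_const k μ).const_mul 2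
    have b0 := ((my_hasDerivAt_tanh (k + μ')).comp_add_const k μ').const_mul 2
    have := ((((aux m1).sub (aux' m2)).sub (aux m3)).add (aux' m4)).sub (a0.sub b0)
    refine hdcg this (fun _ => rfl) ?_
    ring
  have E1 := hlocA.hasDerivAt_eq_zero hdA
  have E2 := hlocK.hasDerivAt_eq_zero (hdK k)
  have E3 := deriv2_nonpos hdK hdK2 hlocK
  have hτ := my_tanh_lt (show k + μ' < k + μ by linarith)
  set t1 := Real.tanh (a + k + m1) with ht1
  set t2 := Real.tanh (a - k + m2) with ht2
  set t3 := Real.tanh (a + k + m3) with ht3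
  set t4 := Real.tanh (a - k + m4) with ht4
  set τ := Real.tanh (k + μ) with hτd
  set τ' := Real.tanh (k + μ') with hτd'
  have E4 : τ ≤ (t1 - t2) / 2 := E4_alg E1 E2 E3 hτ
  obtain ⟨r1, r2⟩ := tanh_rigid (a := (2 * k + m1 - m2) / 2) (b := (2 * a + m1 + m2) / 2)
    (κ := k + μ) (p := (t1 - t2) / 2) (by linarith) (by linarith)
    (by rw [ht1, ht2]; ring_nf) E4
  have f1 : a + m1 = μ := by linarith
  have f2 : a + m2 = -μ := by linarith
  have g1 : t1 = τ := by rw [ht1, hτd]; congr 1; linarith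
  have g2 : t2 = -τ := by rw [ht2, hτd, ← Real.tanh_neg]; congr 1; linarith
  have g3 : t3 = τ' := by linarith
  have g4 : t4 = -τ' := by linarith
  have f3 : a + m3 = μ' := by
    have := my_tanh_inj (ht3.symm.trans (g3.trans hτd')); linarith
  have f4 : a + m4 = -μ' := by
    have : Real.tanh (a - k + m4) = Real.tanh (-(k + μ')) := by
      rw [Real.tanh_neg, ← ht4, ← hτd', g4]
    have := my_tanh_inj this; linarith
  have z0 := h0 a
  have z1 : kphi c m1 m2 m3 m4 a 0 = c + 2 * lc μ - 2 * lc μ' := by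
    unfold kphi
    rw [show a + 0 + m1 = μ by linarith, show a - 0 + m2 = -μ by linarith,
      show a + 0 + m3 = μ' by linarith, show a - 0 + m4 = -μ' by linarith, lc_neg, lc_neg]
    ring
  have z2 : kphi c m1 m2 m3 m4 a k = c + 2 * lc (k + μ) - 2 * lc (k + μ') := by
    unfold kphi
    rw [show a + k + m1 = k + μ by linarith, show a - k + m2 = -(k + μ) by linarith,
      show a + k + m3 = k + μ' by linarith, show a - k + m4 = -(k + μ') by linarith, lc_neg, lc_neg]
    ring
  rw [z1] at z0
  simp only [hΦ] at hge
  rw [z2] at hge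
  linarith


/-! Part 3 -/


section S
variable {Λ : Type*} [Fintype Λ] [DecidableEq Λ]

def rs (z : Λ) (h : Λ → ℝ) : {x // x ≠ z} → ℝ := fun x => h x
def rJ (z : Λ) (J : Λ → Λ → ℝ) : {x // x ≠ z} → {x // x ≠ z} → ℝ := fun x y => J x y

def rk (z : Λ) (J : Λ → Λ → ℝ) : {x // x ≠ z} → ℝ := fun x => J z x

lemma Ham_split (J : Λ → Λ → ℝ) (hs : ∀ x y, J x y = J y x) (h : Λ → ℝ) (z : Λ) (σ : Λ → Bool) :
    Ham J h σ = J z z / 2 + h z * spin σ z +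
      Ham (rJ z J) (rs z h + spin σ z • rk z J) (fun x => σ x) := by
  have hsp : ∀ x : {x // x ≠ z}, spin (fun x : {x // x ≠ z} => σ x) x = spin σ x := fun x => rfl
  rw [Ham_add]
  unfold Ham
  have e1 : ∀ x, ∑ y, J x y * (spin σ x * spin σ y) = J x z * (spin σ x * spin σ z) +
      ∑ y : {y // y ≠ z}, J x y * (spin σ x * spin σ y) := fun x =>
    Fintype.sum_eq_add_sum_subtype_ne (fun y => J x y * (spin σ x * spin σ y)) z
  rw [Fintype.sum_eq_add_sum_subtype_ne (fun x => ∑ y, J x y * (spin σ x * spin σ y)) z,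
    Fintype.sum_eq_add_sum_subtype_ne (fun x => h x * spin σ x) z]
  simp only [e1, hsp, Finset.sum_add_distrib, rJ, rs, rk, spin_sq, Pi.smul_apply, smul_eq_mul]
  have e2 : ∑ y : {y // y ≠ z}, J z y * (spin σ z * spin σ y) = ∑ y : {y // y ≠ z}, spin σ z * J z y * spin σ y :=
    Finset.sum_congr rfl fun y _ => by ring
  have e3 : ∑ y : {y // y ≠ z}, J y z * (spin σ y * spin σ z) = ∑ y : {y // y ≠ z}, spin σ z * J z y * spin σ y :=
    Finset.sum_congr rfl fun y _ => by rw [hs y z]; ring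
  rw [e2, e3]; ring

lemma Zp_split (J : Λ → Λ → ℝ) (hs : ∀ x y, J x y = J y x) (h : Λ → ℝ) (z : Λ) :
    Zp J h = Real.exp (J z z / 2) * (Real.exp (h z) * Zp (rJ z J) (rs z h + rk z J)
      + Real.exp (-h z) * Zp (rJ z J) (rs z h - rk z J)) := by
  unfold Zp
  rw [← Equiv.sum_comp (Equiv.funSplitAt z Bool).symm, Fintype.sum_prod_type, Fintype.sum_bool,
    mul_add, Finset.mul_sum, Finset.mul_sum, Finset.mul_sum, Finset.mul_sum]
  have hz : ∀ b σ', ((Equiv.funSplitAt z Bool).symm (b, σ')) z = b := by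
    intro b σ'; simp [Equiv.funSplitAt, Equiv.piSplitAt]
  have hx : ∀ b σ', (fun x : {x // x ≠ z} => ((Equiv.funSplitAt z Bool).symm (b, σ')) x) = σ' := by
    intro b σ'; ext x; simp [Equiv.funSplitAt, Equiv.piSplitAt, x.2]
  congr 1
  · refine Finset.sum_congr rfl fun σ' _ => ?_
    rw [Ham_split J hs h z, hx, ← Real.exp_add, ← Real.exp_add]
    have : spin ((Equiv.funSplitAt z Bool).symm (true, σ')) z = 1 := by simp [spin, hz]
    rw [this]
    rw [one_smul]
    congr 1
    ring
  · refine Finset.sum_congr rfl fun σ' _ => ?_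
    rw [Ham_split J hs h z, hx, ← Real.exp_add, ← Real.exp_add]
    have : spin ((Equiv.funSplitAt z Bool).symm (false, σ')) z = -1 := by simp [spin, hz]
    rw [this]
    rw [neg_one_smul, ← sub_eq_add_neg]
    ring_nf

def PP (z : Λ) (J : Λ → Λ → ℝ) (w : {x // x ≠ z} → ℝ) : ℝ :=
  (LZ (rJ z J) (w + rk z J) + LZ (rJ z J) (w - rk z J)) / 2
def MM (z : Λ) (J : Λ → Λ → ℝ) (w : {x // x ≠ z} → ℝ) : ℝ :=
  (LZ (rJ z J) (w + rk z J) - LZ (rJ z J) (w - rk z J)) / 2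

lemma LZ_split (J : Λ → Λ → ℝ) (hs : ∀ x y, J x y = J y x) (h : Λ → ℝ) (z : Λ) :
    LZ J h = (J z z / 2 + Real.log 2) + PP z J (rs z h) + lc (h z + MM z J (rs z h)) := by
  unfold LZ
  rw [Zp_split J hs h z]
  have hp := Zp_pos (rJ z J) (rs z h + rk z J)
  have hm := Zp_pos (rJ z J) (rs z h - rk z J)
  have e1 : Real.exp (h z) * Zp (rJ z J) (rs z h + rk z J)
      + Real.exp (-h z) * Zp (rJ z J) (rs z h - rk z J) =
      2 * Real.exp (PP z J (rs z h)) * Real.cosh (h z + MM z J (rs z h)) := by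
    rw [Real.cosh_eq, mul_div_assoc', mul_assoc, mul_div_assoc, ← mul_div_assoc 2]
    rw [mul_div_cancel_left₀ _ (by norm_num : (2:ℝ) ≠ 0), mul_add, ← Real.exp_add, ← Real.exp_add,
      ← Real.exp_log hp, ← Real.exp_log hm, ← Real.exp_add, ← Real.exp_add]
    congr 2
    · unfold PP MM LZ; ring
    · unfold PP MM LZ; ring
  rw [e1, Real.log_mul (by positivity) (by have := Real.cosh_pos (h z + MM z J (rs z h)); positivity),
    Real.log_mul (by positivity) (Real.cosh_pos _).ne', Real.log_mul (by norm_num) (by positivity),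
    Real.log_exp, Real.log_exp]
  unfold lc; ring

lemma MM_mono (z : Λ) (J : Λ → Λ → ℝ) (hJ : ∀ x y, x ≠ y → 0 ≤ J x y) (a b : {x // x ≠ z} → ℝ)
    (hab : a ≤ b) : MM z J a ≤ MM z J b := by
  obtain ⟨k, hk⟩ : ∃ k, k = rk z J := ⟨_, rfl⟩
  have hk0 : 0 ≤ k := fun x => by rw [hk]; exact hJ z x x.2.symm
  have := LZ_super (rJ z J) (fun x y hxy => hJ x y (fun h => hxy (Subtype.ext h))) (a - k) (b - a) (k + k)
    (sub_nonneg.2 hab) (add_nonneg hk0 hk0)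
  rw [show a - k + (b - a) = b - k by abel, show a - k + (k + k) = a + k by abel,
    show b - k + (k + k) = b + k by abel] at this
  unfold MM
  rw [← hk]
  linarith

lemma MM_zero (z : Λ) (J : Λ → Λ → ℝ) : MM z J 0 = 0 := by
  unfold MM
  rw [zero_sub, zero_add, LZ_neg]; simp

def SS (J : Λ → Λ → ℝ) (g u v : Λ → ℝ) : Prop :=
  LZ J (g + u + v) + LZ J (g - u - v) - LZ J (g + u - v) - LZ J (g - u + v) ≤
    2 * LZ J (u + v) - 2 * LZ J (u - v)

end S

lemma SS_step {Λ : Type*} [Fintype Λ] [DecidableEq Λ] (J : Λ → Λ → ℝ) (hs : ∀ x y, J x y = J y x)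
    (hJ : ∀ x y, x ≠ y → 0 ≤ J x y) (z : Λ)
    (IH1 : ∀ g u v : {x // x ≠ z} → ℝ, 0 ≤ u → 0 ≤ v → SS (rJ z J) g u v)
    (g u v : Λ → ℝ) (hu : 0 ≤ u) (hv : 0 ≤ v)
    (IH2 : ∀ g, SS J g (Function.update u z 0) v) : SS J g u v := by
  obtain ⟨k, hk⟩ : ∃ k, k = rk z J := ⟨_, rfl⟩
  have hk0 : 0 ≤ k := fun x => by rw [hk]; exact hJ z x x.2.symm
  obtain ⟨G, hG⟩ : ∃ G, G = rs z g := ⟨_, rfl⟩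
  obtain ⟨U, hU⟩ : ∃ U, U = rs z u := ⟨_, rfl⟩
  obtain ⟨V, hV⟩ : ∃ V, V = rs z v := ⟨_, rfl⟩
  have hU0 : 0 ≤ U := fun x => by rw [hU]; exact hu x
  have hV0 : 0 ≤ V := fun x => by rw [hV]; exact hv x
  have eG : ∀ h, rs z (Function.update g z h) = G := by
    intro h; ext x; simp [rs, hG, x.2]
  have eU : rs z (Function.update u z 0) = U := by
    ext x; simp [rs, hU, x.2]
  have ra : ∀ a b : Λ → ℝ, rs z (a + b) = rs z a + rs z b := fun a b => rfl
  have rsub : ∀ a b : Λ → ℝ, rs z (a - b) = rs z a - rs z b := fun a b => rfl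
  have hv0 : 0 ≤ v z := hv z
  have key := K_lemma
    (PP z J (G + U + V) + PP z J (G - U - V) - PP z J (G + U - V) - PP z J (G - U + V))
    (2 * PP z J (U + V) - 2 * PP z J (U - V))
    (v z + MM z J (G + U + V)) (-v z + MM z J (G - U - V)) (-v z + MM z J (G + U - V))
    (v z + MM z J (G - U + V)) (v z + MM z J (U + V)) (-v z + MM z J (U - V))
    (by
      have := MM_mono z J hJ (G + U - V) (G + U + V) (fun x => by
        have := hV0 x; simp only [Pi.add_apply, Pi.sub_apply, Pi.zero_apply] at *; linarith)
      linarith)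
    (by
      have := MM_mono z J hJ (G - U - V) (G - U + V) (fun x => by
        have := hV0 x; simp only [Pi.add_apply, Pi.sub_apply, Pi.zero_apply] at *; linarith)
      linarith)
    (by
      have := MM_mono z J hJ (U - V) (U + V) (fun x => by
        have := hV0 x; simp only [Pi.add_apply, Pi.sub_apply, Pi.zero_apply] at *; linarith)
      linarith)
    (by
      have := MM_mono z J hJ 0 (U + V) (add_nonneg hU0 hV0)
      rw [MM_zero] at this
      linarith)
    (by
      have := IH1 G k (U + V) hk0 (add_nonneg hU0 hV0)
      unfold SS at this
      have e := LZ_neg (rJ z J) (k - (U + V))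
      rw [show -(k - (U + V)) = U + V - k by abel] at e
      rw [← e] at this
      unfold MM
      rw [← hk]
      rw [show G + k + (U + V) = G + U + V + k by abel, show G - k - (U + V) = G - U - V - k by abel,
        show G + k - (U + V) = G - U - V + k by abel, show G - k + (U + V) = G + U + V - k by abel,
        show k + (U + V) = U + V + k by abel] at this
      linarith)
    (by
      intro h
      have := IH2 (Function.update g z h)
      unfold SS at this
      simp only [LZ_split J hs _ z, ra, rsub, eG, eU, ← hV, Pi.add_apply, Pi.sub_apply,
        Function.update_self] at this
      unfold kphi
      ring_nf at this ⊢
      linarith)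
    (by
      have := IH1 G (U + k) V (add_nonneg hU0 hk0) hV0
      unfold SS at this
      unfold MM PP
      rw [← hk]
      rw [show G + (U + k) + V = G + U + V + k by abel, show G - (U + k) - V = G - U - V - k by abel,
        show G + (U + k) - V = G + U - V + k by abel, show G - (U + k) + V = G - U + V - k by abel,
        show U + k + V = U + V + k by abel, show U + k - V = U - V + k by abel] at this
      linarith)
    (g z) (u z) (hu z)
  unfold SS
  simp only [LZ_split J hs _ z, ra, rsub, ← hG, ← hU, ← hV, Pi.add_apply, Pi.sub_apply]
  unfold kphi at key
  ring_nf at key ⊢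
  linarith

lemma SS_all.{u} (n : ℕ) : ∀ (Λ : Type u) [Fintype Λ] [DecidableEq Λ], Fintype.card Λ = n →
    ∀ (J : Λ → Λ → ℝ), (∀ x y, J x y = J y x) → (∀ x y, x ≠ y → 0 ≤ J x y) →
    ∀ g u v : Λ → ℝ, 0 ≤ u → 0 ≤ v → SS J g u v := by
  induction n with
  | zero =>
    intro Λ _ _ hc J hs hJ g u v hu hv
    have : IsEmpty Λ := Fintype.card_eq_zero_iff.1 hc
    have e : ∀ a b : Λ → ℝ, a = b := fun a b => Subsingleton.elim _ _
    unfold SS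
    rw [e (g + u + v) 0, e (g - u - v) 0, e (g + u - v) 0, e (g - u + v) 0, e (u + v) 0, e (u - v) 0]
    linarith
  | succ n IH =>
    intro Λ _ _ hc J hs hJ g u v hu hv
    have inner : ∀ s : Finset Λ, ∀ u : Λ → ℝ, 0 ≤ u → (∀ x, x ∉ s → u x = 0) → ∀ g, SS J g u v := by
      intro s
      induction s using Finset.induction_on with
      | empty =>
        intro u hu h0 g
        have : u = 0 := by ext x; exact h0 x (by simp)
        subst this
        unfold SS
        simp only [add_zero, sub_zero, zero_add, zero_sub, LZ_neg]
        linarith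
      | insert z s hz ih =>
        intro u hu h0 g
        refine SS_step J hs hJ z ?_ g u v hu hv ?_
        · intro g' u' v' hu' hv'
          refine IH {x // x ≠ z} ?_ (rJ z J) (fun x y => hs _ _) (fun x y hxy => hJ x y (fun h => hxy (Subtype.ext h))) g' u' v' hu' hv'
          have := Fintype.card_subtype_compl (fun x => x = z)
          simp only [Fintype.card_subtype_eq, hc] at this
          simpa using this
        · apply ih
          · intro x
            by_cases hx : x = z
            · subst hx; simp
            · simp [hx, hu x]; exact hu x
          · intro x hx
            by_cases hxz : x = z
            · subst hxz; simp
            · rw [Function.update_of_ne hxz]; exact h0 x (by simp [hx, hxz])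
    exact inner Finset.univ u hu (by simp) g


/-! Part 4 -/


section E
variable {Ω : Type*} [Fintype Ω]

/-- Gibbs expectation with exponent `E`. -/
def gE (E f : Ω → ℝ) : ℝ := (∑ ω, Real.exp (E ω) * f ω) / ∑ ω, Real.exp (E ω)

lemma gZ_pos [Nonempty Ω] (E : Ω → ℝ) : 0 < ∑ ω, Real.exp (E ω) :=
  Finset.sum_pos (fun _ _ => Real.exp_pos _) Finset.univ_nonempty

lemma gE_add (E f g : Ω → ℝ) : gE E (fun ω => f ω + g ω) = gE E f + gE E g := by
  simp only [gE, mul_add, Finset.sum_add_distrib, add_div]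

lemma gE_sub (E f g : Ω → ℝ) : gE E (fun ω => f ω - g ω) = gE E f - gE E g := by
  simp only [gE, mul_sub, Finset.sum_sub_distrib, sub_div]

lemma gE_mul (E f : Ω → ℝ) (c : ℝ) : gE E (fun ω => c * f ω) = c * gE E f := by
  simp only [gE, mul_left_comm _ c, ← Finset.mul_sum, mul_div_assoc]

lemma gE_sum {ι : Type*} (s : Finset ι) (E : Ω → ℝ) (f : ι → Ω → ℝ) :
    gE E (fun ω => ∑ i ∈ s, f i ω) = ∑ i ∈ s, gE E (f i) := by
  simp only [gE, Finset.mul_sum, ← Finset.sum_div]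
  rw [Finset.sum_comm]

lemma gE_const [Nonempty Ω] (E : Ω → ℝ) (c : ℝ) : gE E (fun _ => c) = c := by
  simp only [gE, ← Finset.sum_mul]
  rw [mul_comm, mul_div_assoc, div_self (gZ_pos E).ne', mul_one]

lemma gE_mono [Nonempty Ω] (E : Ω → ℝ) {f g : Ω → ℝ} (h : ∀ ω, f ω ≤ g ω) : gE E f ≤ gE E g := by
  unfold gE
  apply div_le_div_of_nonneg_right _ (gZ_pos E).le
  exact Finset.sum_le_sum fun ω _ => mul_le_mul_of_nonneg_left (h ω) (Real.exp_pos _).le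

lemma gE_nonneg [Nonempty Ω] (E : Ω → ℝ) {f : Ω → ℝ} (h : ∀ ω, 0 ≤ f ω) : 0 ≤ gE E f := by
  have := gE_mono E (f := fun _ => 0) (g := f) h
  rwa [gE_const] at this

lemma gE_pos [Nonempty Ω] (E : Ω → ℝ) {f : Ω → ℝ} (h : ∀ ω, 0 < f ω) : 0 < gE E f := by
  unfold gE
  exact div_pos (Finset.sum_pos (fun ω _ => mul_pos (Real.exp_pos _) (h ω)) Finset.univ_nonempty) (gZ_pos E)

lemma hasDerivAt_gN {e : ℝ → Ω → ℝ} {b : Ω → ℝ} {s : ℝ} (h : ∀ ω, HasDerivAt (fun s => e s ω) (b ω) s)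
    (f : Ω → ℝ) : HasDerivAt (fun s => ∑ ω, Real.exp (e s ω) * f ω) (∑ ω, Real.exp (e s ω) * (f ω * b ω)) s := by
  have := HasDerivAt.sum (u := Finset.univ) (fun ω _ => ((h ω).exp).mul_const (f ω))
  refine hdcg this (fun y => by simp) ?_
  exact Finset.sum_congr rfl fun ω _ => by ring

lemma hasDerivAt_gZ {e : ℝ → Ω → ℝ} {b : Ω → ℝ} {s : ℝ} (h : ∀ ω, HasDerivAt (fun s => e s ω) (b ω) s) :
    HasDerivAt (fun s => ∑ ω, Real.exp (e s ω)) (∑ ω, Real.exp (e s ω) * b ω) s := by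
  have := hasDerivAt_gN h (fun _ => 1)
  simpa using this

lemma hasDerivAt_gE [Nonempty Ω] {e : ℝ → Ω → ℝ} {b : Ω → ℝ} {s : ℝ}
    (h : ∀ ω, HasDerivAt (fun s => e s ω) (b ω) s) (f : Ω → ℝ) :
    HasDerivAt (fun s => gE (e s) f) (gE (e s) (fun ω => f ω * b ω) - gE (e s) f * gE (e s) b) s := by
  have hz := (gZ_pos (e s)).ne'
  refine hdcg ((hasDerivAt_gN h f).div (hasDerivAt_gZ h) hz) (fun y => rfl) ?_
  simp only [gE]
  field_simp

lemma hasDerivAt_logZ [Nonempty Ω] {e : ℝ → Ω → ℝ} {b : Ω → ℝ} {s : ℝ}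
    (h : ∀ ω, HasDerivAt (fun s => e s ω) (b ω) s) :
    HasDerivAt (fun s => Real.log (∑ ω, Real.exp (e s ω))) (gE (e s) b) s :=
  (hasDerivAt_gZ h).log (gZ_pos (e s)).ne'

end E

section V
variable {Λ : Type*} [Fintype Λ] [DecidableEq Λ]

def ls (v : Λ → ℝ) (σ : Λ → Bool) : ℝ := ∑ x, v x * spin σ x

def gVar (E : (Λ → Bool) → ℝ) (v : Λ → ℝ) : ℝ := gE E (fun σ => ls v σ * ls v σ) - gE E (ls v) * gE E (ls v)

lemma Ham_line (J : Λ → Λ → ℝ) (g v : Λ → ℝ) (s : ℝ) (σ : Λ → Bool) :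
    Ham J (g + s • v) σ = Ham J g σ + s * ls v σ := by
  rw [Ham_add, ls, Finset.mul_sum]
  simp [mul_assoc]

lemma Ham_line_deriv (J : Λ → Λ → ℝ) (g v : Λ → ℝ) (s : ℝ) (σ : Λ → Bool) :
    HasDerivAt (fun s => Ham J (g + s • v) σ) (ls v σ) s := by
  refine hdcg (((hasDerivAt_id s).mul_const (ls v σ)).const_add (Ham J g σ)) (fun y => Ham_line J g v y σ) (by simp)

lemma LZ_line_deriv (J : Λ → Λ → ℝ) (g v : Λ → ℝ) (s : ℝ) :
    HasDerivAt (fun s => LZ J (g + s • v)) (gE (Ham J (g + s • v)) (ls v)) s :=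
  hasDerivAt_logZ (fun σ => Ham_line_deriv J g v s σ)

lemma LZ_line_deriv2 (J : Λ → Λ → ℝ) (g v : Λ → ℝ) (s : ℝ) :
    HasDerivAt (fun s => gE (Ham J (g + s • v)) (ls v)) (gVar (Ham J (g + s • v)) v) s :=
  hasDerivAt_gE (fun σ => Ham_line_deriv J g v s σ) (ls v)

lemma gVar_le_zero (J : Λ → Λ → ℝ) (hs : ∀ x y, J x y = J y x) (hJ : ∀ x y, x ≠ y → 0 ≤ J x y)
    (g v : Λ → ℝ) (hv : 0 ≤ v) : gVar (Ham J g) v ≤ gVar (Ham J 0) v := by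
  have hpos : ∀ s : ℝ, 0 ≤ s → LZ J (g + s • v) + LZ J (g + (-s) • v) - 2 * LZ J g ≤
      2 * LZ J (0 + s • v) - 2 * LZ J 0 := by
    intro s hs0
    have h2 : 0 ≤ (s / 2) • v := smul_nonneg (by linarith) hv
    have := SS_all _ Λ rfl J hs hJ g ((s / 2) • v) ((s / 2) • v) h2 h2
    unfold SS at this
    rw [add_assoc, ← add_smul, add_halves, sub_sub g, ← add_smul, add_halves, add_sub_cancel_right,
      sub_add_cancel, sub_self] at this
    rw [zero_add, neg_smul, ← sub_eq_add_neg]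
    linarith
  have hall : ∀ s : ℝ, LZ J (g + s • v) + LZ J (g + (-s) • v) - 2 * LZ J g ≤
      2 * LZ J (0 + s • v) - 2 * LZ J 0 := by
    intro s
    rcases le_total 0 s with h | h
    · exact hpos s h
    · have := hpos (-s) (by linarith)
      rw [neg_neg] at this
      rw [zero_add, neg_smul, LZ_neg] at this
      rw [zero_add, neg_smul]
      linarith
  have d1 : ∀ s : ℝ, HasDerivAt (fun s : ℝ => LZ J (g + s • v) + LZ J (g + (-s) • v) - 2 * LZ J (0 + s • v))
      (gE (Ham J (g + s • v)) (ls v) - gE (Ham J (g + (-s) • v)) (ls v) - 2 * gE (Ham J (0 + s • v)) (ls v)) s := by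
    intro s
    have a := LZ_line_deriv J g v s
    have b := (LZ_line_deriv J g v (-s)).comp s (hasDerivAt_neg s)
    have c := (LZ_line_deriv J 0 v s).const_mul 2
    exact hdcg ((a.add b).sub c) (fun _ => rfl) (by ring)
  have d2 : HasDerivAt (fun s : ℝ => (gE (Ham J (g + s • v)) (ls v) - gE (Ham J (g + (-s) • v)) (ls v) - 2 * gE (Ham J (0 + s • v)) (ls v)))
      (2 * gVar (Ham J g) v - 2 * gVar (Ham J 0) v) 0 := by
    have a := LZ_line_deriv2 J g v 0
    have b := (LZ_line_deriv2 J g v (-0)).comp 0 (hasDerivAt_neg 0)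
    have c := (LZ_line_deriv2 J 0 v 0).const_mul 2
    refine hdcg ((a.sub b).sub c) (fun _ => rfl) ?_
    simp only [neg_zero, zero_smul, add_zero]
    ring
  have := deriv2_nonpos d1 d2 (Filter.Eventually.of_forall fun s => by
    have := hall s
    simp only [neg_zero, zero_smul, add_zero]
    linarith)
  linarith

lemma gVar_expand (E : (Λ → Bool) → ℝ) (v : Λ → ℝ) :
    gVar E v = ∑ x, ∑ y, v x * v y * (gE E (fun σ => spin σ x * spin σ y) -
      gE E (fun σ => spin σ x) * gE E (fun σ => spin σ y)) := by
  have e1 : gE E (ls v) = ∑ x, v x * gE E (fun σ => spin σ x) := by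
    unfold ls
    rw [gE_sum]
    exact Finset.sum_congr rfl fun x _ => gE_mul _ _ _
  have e2 : gE E (fun σ => ls v σ * ls v σ) = ∑ x, ∑ y, v x * v y * gE E (fun σ => spin σ x * spin σ y) := by
    have : (fun σ => ls v σ * ls v σ) = fun σ => ∑ x, ∑ y, v x * v y * (spin σ x * spin σ y) := by
      ext σ
      unfold ls
      rw [Finset.sum_mul_sum]
      exact Finset.sum_congr rfl fun x _ => Finset.sum_congr rfl fun y _ => by ring
    rw [this, gE_sum]
    refine Finset.sum_congr rfl fun x _ => ?_
    rw [gE_sum]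
    exact Finset.sum_congr rfl fun y _ => gE_mul _ _ _
  unfold gVar
  rw [e1, e2, Finset.sum_mul_sum, ← Finset.sum_sub_distrib]
  refine Finset.sum_congr rfl fun x _ => ?_
  rw [← Finset.sum_sub_distrib]
  exact Finset.sum_congr rfl fun y _ => by ring

lemma gcov_nonneg (J : Λ → Λ → ℝ) (hJ : ∀ x y, x ≠ y → 0 ≤ J x y) (g : Λ → ℝ) (x y : Λ) :
    0 ≤ gE (Ham J g) (fun σ => spin σ x * spin σ y) -
      gE (Ham J g) (fun σ => spin σ x) * gE (Ham J g) (fun σ => spin σ y) := by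
  have h := cov_nonneg' J hJ g x y
  have hz := Zp_pos J g
  unfold gE
  change 0 ≤ _ / Zp J g - _ / Zp J g * (_ / Zp J g)
  rw [div_mul_div_comm, sub_nonneg, div_le_div_iff₀ (by positivity) hz]
  nlinarith

lemma gVar_bound (J : Λ → Λ → ℝ) (hs : ∀ x y, J x y = J y x) (hJ : ∀ x y, x ≠ y → 0 ≤ J x y)
    (g v : Λ → ℝ) : gVar (Ham J g) v ≤ gE (Ham J 0) (fun σ => ls (fun x => |v x|) σ * ls (fun x => |v x|) σ) := by
  have h1 : gVar (Ham J g) v ≤ gVar (Ham J g) (fun x => |v x|) := by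
    rw [gVar_expand, gVar_expand]
    refine Finset.sum_le_sum fun x _ => Finset.sum_le_sum fun y _ => ?_
    apply mul_le_mul_of_nonneg_right _ (gcov_nonneg J hJ g x y)
    rw [← abs_mul]; exact le_abs_self _
  have h2 := gVar_le_zero J hs hJ g (fun x => |v x|) (fun x => abs_nonneg _)
  have h3 : gVar (Ham J 0) (fun x => |v x|) ≤ gE (Ham J 0) (fun σ => ls (fun x => |v x|) σ * ls (fun x => |v x|) σ) := by
    unfold gVar; nlinarith [mul_self_nonneg (gE (Ham J 0) (ls (fun x => |v x|)))]
  linarith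

end V

/-! Part 5 -/


def tpg (x : ℝ) : ℝ := 2 * Real.log (1 + x) - Real.log (1 + x ^ 2 / 3) - 1 - (5 * x ^ 2 / 3 - 1) / (1 + x) ^ 2

lemma tpg_deriv (x : ℝ) (hx : -1 < x) :
    HasDerivAt tpg (-(16 / 3) * x ^ 3 / ((1 + x) ^ 3 * (3 + x ^ 2))) x := by
  have h1 : (1 + x) ≠ 0 := by linarith
  have h2 : (1 + x ^ 2 / 3) ≠ 0 := by positivity
  have h3 : (3 + x ^ 2) ≠ 0 := by positivity
  have a := (((hasDerivAt_id x).const_add 1).log h1).const_mul 2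
  have b := ((((hasDerivAt_id x).pow 2).div_const 3).const_add 1).log h2
  have c := (((((hasDerivAt_id x).pow 2).const_mul 5).div_const 3).sub_const 1).div
    (((hasDerivAt_id x).const_add 1).pow 2) (pow_ne_zero 2 h1)
  refine hdcg (((a.sub b).sub_const 1).sub c) (fun y => by simp [tpg]) ?_
  simp only [id, Pi.pow_apply]
  have h4 : (1 + x ^ 2 / 3) = (3 + x ^ 2) / 3 := by ring
  rw [h4]
  field_simp
  ring

lemma tpg_nonpos (x : ℝ) (hx : -1 < x) : tpg x ≤ 0 := by
  have h0 : tpg 0 = 0 := by simp [tpg]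
  rcases le_total 0 x with h | h
  · have : AntitoneOn tpg (Set.Ici 0) := by
      apply antitoneOn_of_deriv_nonpos (convex_Ici 0)
      · intro y hy; exact (tpg_deriv y (by have : (0:ℝ) ≤ y := hy; linarith)).continuousAt.continuousWithinAt
      · intro y hy; rw [interior_Ici] at hy
        exact (tpg_deriv y (by have : (0:ℝ) < y := hy; linarith)).differentiableAt.differentiableWithinAt
      · intro y hy; rw [interior_Ici] at hy
        have hy' : (0:ℝ) < y := hy
        rw [(tpg_deriv y (by linarith)).deriv]
        apply div_nonpos_of_nonpos_of_nonneg
        · have : 0 < y ^ 3 := by positivity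
          linarith
        · positivity
    have := this (Set.mem_Ici.2 le_rfl) (Set.mem_Ici.2 h) h
    linarith
  · have : MonotoneOn tpg (Set.Ioc (-1) 0) := by
      apply monotoneOn_of_deriv_nonneg (convex_Ioc _ _)
      · intro y hy; exact (tpg_deriv y hy.1).continuousAt.continuousWithinAt
      · intro y hy; rw [interior_Ioc] at hy
        exact (tpg_deriv y hy.1).differentiableAt.differentiableWithinAt
      · intro y hy; rw [interior_Ioc] at hy
        rw [(tpg_deriv y hy.1).deriv]
        have h1 : 0 < 1 + y := by linarith [hy.1]
        apply div_nonneg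
        · have : y ^ 3 ≤ 0 := by
            have : 0 ≤ (-y) ^ 3 := pow_nonneg (by linarith [hy.2]) 3
            nlinarith
          linarith
        · positivity
    have := this ⟨hx, h⟩ ⟨by norm_num, le_rfl⟩ h
    linarith

lemma one_point {a b : ℝ} (ha : 0 < a) (hb : 0 < b) :
    a ^ 2 * Real.log (a ^ 2) - a ^ 2 * Real.log ((a ^ 2 + b ^ 2 + a * b) / 3) - a ^ 2
      + (a ^ 2 + b ^ 2 + a * b) / 3 ≤ (a - b) ^ 2 / 2 := by
  have hab : 0 < a + b := by linarith
  have hx : -1 < (a - b) / (a + b) := by rw [lt_div_iff₀ hab]; linarith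
  have h := tpg_nonpos _ hx
  have e1 : 1 + (a - b) / (a + b) = 2 * a / (a + b) := by field_simp; ring
  have e2 : 1 + ((a - b) / (a + b)) ^ 2 / 3 = ((a ^ 2 + b ^ 2 + a * b) / 3) * (4 / (a + b) ^ 2) := by
    field_simp; ring
  unfold tpg at h
  rw [e1, e2] at h
  have e3 : Real.log (2 * a / (a + b)) = Real.log a + (Real.log 2 - Real.log (a + b)) := by
    rw [Real.log_div (by positivity) hab.ne', Real.log_mul (by norm_num) ha.ne']; ring
  have e4 : Real.log ((a ^ 2 + b ^ 2 + a * b) / 3 * (4 / (a + b) ^ 2)) =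
      Real.log ((a ^ 2 + b ^ 2 + a * b) / 3) + 2 * (Real.log 2 - Real.log (a + b)) := by
    rw [Real.log_mul (by positivity) (by positivity), Real.log_div (show (4:ℝ) ≠ 0 by norm_num)
      (show (a + b) ^ 2 ≠ 0 by positivity), Real.log_pow (a + b) 2, show (4:ℝ) = 2 ^ 2 by norm_num,
      Real.log_pow 2 2]
    push_cast; ring
  rw [e3, e4] at h
  rw [Real.log_pow]
  push_cast
  have h' : 2 * Real.log a - Real.log ((a ^ 2 + b ^ 2 + a * b) / 3) ≤
    1 + (5 * ((a - b) / (a + b)) ^ 2 / 3 - 1) / (2 * a / (a + b)) ^ 2 := by linarith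
  have h2 := mul_le_mul_of_nonneg_left h' (sq_nonneg a)
  have e5 : a ^ 2 * (1 + (5 * ((a - b) / (a + b)) ^ 2 / 3 - 1) / (2 * a / (a + b)) ^ 2) =
      a ^ 2 + (5 * (a - b) ^ 2 / 3 - (a + b) ^ 2) / 4 := by
    field_simp
    ring
  rw [e5] at h2
  nlinarith

lemma xlogx_tangent {x c : ℝ} (hx : 0 < x) (hc : 0 < c) :
    x * Real.log c + x - c ≤ x * Real.log x := by
  have := Real.log_le_sub_one_of_pos (div_pos hc hx)
  rw [Real.log_div hc.ne' hx.ne'] at this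
  have h2 := mul_le_mul_of_nonneg_left this hx.le
  have : x * (c / x - 1) = c - x := by field_simp
  nlinarith

lemma two_point {p q A B : ℝ} (hp : 0 ≤ p) (hq : 0 ≤ q) (hpq : p + q = 1) (hA : 0 < A) (hB : 0 < B) :
    p * (A * Real.log A) + q * (B * Real.log B) - (p * A + q * B) * Real.log (p * A + q * B) ≤
      (Real.sqrt B - Real.sqrt A) ^ 2 / 2 := by
  set a := Real.sqrt A with ha
  set b := Real.sqrt B with hb
  have ha0 : 0 < a := Real.sqrt_pos.2 hA
  have hb0 : 0 < b := Real.sqrt_pos.2 hB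
  have hAa : A = a ^ 2 := (Real.sq_sqrt hA.le).symm
  have hBb : B = b ^ 2 := (Real.sq_sqrt hB.le).symm
  have h1 := one_point ha0 hb0
  have h2 := one_point hb0 ha0
  rw [show (b ^ 2 + a ^ 2 + b * a) = a ^ 2 + b ^ 2 + a * b by ring, ← hAa, ← hBb] at h2
  rw [← hAa, ← hBb] at h1
  have hm : 0 < p * A + q * B := by
    rcases hp.eq_or_lt with h | h
    · rw [← h] at hpq ⊢; simp at hpq; rw [hpq]; linarith
    · have := mul_pos h hA; have := mul_nonneg hq hB.le; linarith
  have h3 := xlogx_tangent hm (show 0 < (A + B + a * b) / 3 by positivity)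
  have h4 := mul_le_mul_of_nonneg_left h1 hp
  have h5 := mul_le_mul_of_nonneg_left h2 hq
  have e : p * ((a - b) ^ 2 / 2) + q * ((b - a) ^ 2 / 2) = (b - a) ^ 2 / 2 := by
    have : q = 1 - p := by linarith
    rw [this]; ring
  have e2 : p * ((A + B + a * b) / 3) + q * ((A + B + a * b) / 3) = (A + B + a * b) / 3 := by
    rw [← add_mul, hpq, one_mul]
  nlinarith

lemma sqrt_mink {p q a b c d : ℝ} (hp : 0 ≤ p) (hq : 0 ≤ q) (ha : 0 ≤ a) (hb : 0 ≤ b) (hc : 0 ≤ c) (hd : 0 ≤ d) :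
    (Real.sqrt (p * a + q * b) - Real.sqrt (p * c + q * d)) ^ 2 ≤
      p * (Real.sqrt a - Real.sqrt c) ^ 2 + q * (Real.sqrt b - Real.sqrt d) ^ 2 := by
  have sa := Real.sq_sqrt ha
  have sb := Real.sq_sqrt hb
  have sc := Real.sq_sqrt hc
  have sd := Real.sq_sqrt hd
  have h1 := Real.sq_sqrt (show 0 ≤ p * a + q * b by positivity)
  have h2 := Real.sq_sqrt (show 0 ≤ p * c + q * d by positivity)
  have key : p * (Real.sqrt a * Real.sqrt c) + q * (Real.sqrt b * Real.sqrt d) ≤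
      Real.sqrt (p * a + q * b) * Real.sqrt (p * c + q * d) := by
    rw [← Real.sqrt_mul (show 0 ≤ p * a + q * b by positivity)]
    apply Real.le_sqrt_of_sq_le
    have : 0 ≤ p * q * (Real.sqrt a * Real.sqrt d - Real.sqrt b * Real.sqrt c) ^ 2 := by positivity
    have e1 : a = Real.sqrt a ^ 2 := sa.symm
    have e2 : b = Real.sqrt b ^ 2 := sb.symm
    have e3 : c = Real.sqrt c ^ 2 := sc.symm
    have e4 : d = Real.sqrt d ^ 2 := sd.symm
    generalize Real.sqrt a = α at *
    generalize Real.sqrt b = β at *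
    generalize Real.sqrt c = γ at *
    generalize Real.sqrt d = δ at *
    subst e1 e2 e3 e4
    nlinarith
  nlinarith


/-! Part 6 -/


section D
variable {Λ : Type*} [Fintype Λ] [DecidableEq Λ]

lemma sflip_sflip (x : Λ) (σ : Λ → Bool) : spinFlip x (spinFlip x σ) = σ := by
  unfold spinFlip; simp

lemma flip_comm (x z : Λ) (σ : Λ → Bool) : spinFlip x (spinFlip z σ) = spinFlip z (spinFlip x σ) := by
  by_cases h : x = z
  · rw [h]
  · unfold spinFlip
    rw [Function.update_of_ne h, Function.update_of_ne (Ne.symm h), Function.update_comm (Ne.symm h)]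

lemma sum_flip (x : Λ) (f : (Λ → Bool) → ℝ) : ∑ σ, f (spinFlip x σ) = ∑ σ, f σ :=
  Equiv.sum_comp (Function.Involutive.toPerm (spinFlip x) (sflip_sflip x)) f

lemma spin_flip_same (x : Λ) (σ : Λ → Bool) : spin (spinFlip x σ) x = - spin σ x := by
  unfold spin spinFlip
  cases h : σ x <;> simp [h]

lemma spin_flip_ne {x y : Λ} (h : y ≠ x) (σ : Λ → Bool) : spin (spinFlip x σ) y = spin σ y := by
  unfold spin spinFlip
  rw [Function.update_of_ne h]

lemma ls_flip (g : Λ → ℝ) (x : Λ) (σ : Λ → Bool) : ls g (spinFlip x σ) = ls g σ - 2 * (g x * spin σ x) := by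
  unfold ls
  rw [← Finset.add_sum_erase _ _ (Finset.mem_univ x), ← Finset.add_sum_erase _ (fun y => g y * spin σ y) (Finset.mem_univ x),
    spin_flip_same, Finset.sum_congr rfl (fun y hy => by rw [spin_flip_ne (Finset.ne_of_mem_erase hy)])]
  ring

def pw (g : Λ → ℝ) (x : Λ) (σ : Λ → Bool) : ℝ := (1 + spin σ x * Real.tanh (g x)) / 2

lemma spin_cases (σ : Λ → Bool) (x : Λ) : spin σ x = 1 ∨ spin σ x = -1 := by
  unfold spin; cases σ x <;> simp

lemma pw_pos (g : Λ → ℝ) (x : Λ) (σ : Λ → Bool) : 0 < pw g x σ := by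
  have h1 := Real.tanh_lt_one (g x)
  have h2 := Real.neg_one_lt_tanh (g x)
  unfold pw
  rcases spin_cases σ x with h | h <;> rw [h] <;> linarith

lemma pw_add (g : Λ → ℝ) (x : Λ) (σ : Λ → Bool) : pw g x σ + pw g x (spinFlip x σ) = 1 := by
  unfold pw; rw [spin_flip_same]; ring

lemma pw_ne (g : Λ → ℝ) {x z : Λ} (h : z ≠ x) (σ : Λ → Bool) : pw g x (spinFlip z σ) = pw g x σ := by
  unfold pw; rw [spin_flip_ne (Ne.symm h)]

lemma pw_bal (g : Λ → ℝ) (x : Λ) (σ : Λ → Bool) :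
    Real.exp (ls g σ) * pw g x (spinFlip x σ) = Real.exp (ls g (spinFlip x σ)) * pw g x σ := by
  rw [ls_flip]
  unfold pw
  rw [spin_flip_same, Real.tanh_eq_sinh_div_cosh, sub_eq_add_neg, Real.exp_add, mul_assoc]
  congr 1
  have hc := (Real.cosh_pos (g x)).ne'
  have e1 : 1 + Real.sinh (g x) / Real.cosh (g x) = Real.exp (g x) / Real.cosh (g x) := by
    rw [← Real.cosh_add_sinh]; field_simp
  have e2 : 1 - Real.sinh (g x) / Real.cosh (g x) = Real.exp (-g x) / Real.cosh (g x) := by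
    rw [← Real.cosh_sub_sinh]; field_simp
  rcases spin_cases σ x with h | h <;> rw [h]
  · rw [neg_mul, one_mul, ← sub_eq_add_neg, e1, e2, mul_one, show -(2 * g x) = -g x + -g x by ring, Real.exp_add,
      Real.exp_neg]
    field_simp
  · rw [neg_neg, one_mul, neg_mul, one_mul, ← sub_eq_add_neg, e1, e2, show -(2 * (g x * -1)) = g x + g x by ring, Real.exp_add,
      Real.exp_neg]
    field_simp

lemma E_bal (g : Λ → ℝ) (x : Λ) (G : (Λ → Bool) → ℝ) :
    gE (ls g) (fun σ => pw g x (spinFlip x σ) * G (spinFlip x σ)) =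
    gE (ls g) (fun σ => pw g x (spinFlip x σ) * G σ) := by
  unfold gE
  congr 1
  rw [← sum_flip x (fun σ => Real.exp (ls g σ) * (pw g x (spinFlip x σ) * G σ))]
  refine Finset.sum_congr rfl fun σ _ => ?_
  rw [sflip_sflip, ← mul_assoc, ← mul_assoc, pw_bal]

def Tx (g : Λ → ℝ) (x : Λ) (F : (Λ → Bool) → ℝ) (σ : Λ → Bool) : ℝ :=
  pw g x σ * F σ + pw g x (spinFlip x σ) * F (spinFlip x σ)

lemma E_Tx (g : Λ → ℝ) (x : Λ) (F : (Λ → Bool) → ℝ) : gE (ls g) (Tx g x F) = gE (ls g) F := by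
  unfold Tx
  rw [gE_add, E_bal, ← gE_add]
  congr 1; ext σ
  rw [← add_mul, pw_add, one_mul]

lemma Tx_pos (g : Λ → ℝ) (x : Λ) {F : (Λ → Bool) → ℝ} (hF : ∀ σ, 0 < F σ) (σ) : 0 < Tx g x F σ :=
  add_pos (mul_pos (pw_pos _ _ _) (hF _)) (mul_pos (pw_pos _ _ _) (hF _))

lemma Tx_flip (g : Λ → ℝ) (x : Λ) (F : (Λ → Bool) → ℝ) (σ) : Tx g x F (spinFlip x σ) = Tx g x F σ := by
  unfold Tx; rw [sflip_sflip]; ring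

lemma Tx_flip_ne (g : Λ → ℝ) {x z : Λ} (h : z ≠ x) (F : (Λ → Bool) → ℝ) (σ) :
    Tx g x F (spinFlip z σ) = pw g x σ * F (spinFlip z σ) + pw g x (spinFlip x σ) * F (spinFlip z (spinFlip x σ)) := by
  unfold Tx; rw [pw_ne g h, flip_comm x z, pw_ne g h]

def Hh (g : Λ → ℝ) (F : (Λ → Bool) → ℝ) : ℝ := gE (ls g) (fun σ => F σ * Real.log (F σ))
def Dx (g : Λ → ℝ) (x : Λ) (F : (Λ → Bool) → ℝ) : ℝ :=
  gE (ls g) (fun σ => (1/2) * (Real.sqrt (F (spinFlip x σ)) - Real.sqrt (F σ)) ^ 2)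

lemma Dx_nonneg (g : Λ → ℝ) (x : Λ) (F : (Λ → Bool) → ℝ) : 0 ≤ Dx g x F :=
  gE_nonneg _ fun σ => by positivity

lemma Hh_step (g : Λ → ℝ) (x : Λ) {F : (Λ → Bool) → ℝ} (hF : ∀ σ, 0 < F σ) :
    Hh g F ≤ Hh g (Tx g x F) + Dx g x F := by
  unfold Hh Dx
  rw [← E_Tx g x (fun σ => F σ * Real.log (F σ)), ← gE_add]
  apply gE_mono
  intro σ
  have := two_point (pw_pos g x σ).le (pw_pos g x (spinFlip x σ)).le (pw_add g x σ) (hF σ) (hF (spinFlip x σ))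
  unfold Tx
  linarith

lemma Dx_Tx (g : Λ → ℝ) (x z : Λ) {F : (Λ → Bool) → ℝ} (hF : ∀ σ, 0 < F σ) :
    Dx g z (Tx g x F) ≤ Dx g z F := by
  by_cases h : z = x
  · have : Dx g z (Tx g x F) = 0 := by
      unfold Dx
      rw [h]
      simp only [Tx_flip, sub_self]
      simp only [ne_eq, OfNat.ofNat_ne_zero, not_false_eq_true, zero_pow, mul_zero]
      exact gE_const _ 0
    rw [this]; exact Dx_nonneg _ _ _
  · unfold Dx
    rw [← E_Tx g x (fun σ => (1/2) * (Real.sqrt (F (spinFlip z σ)) - Real.sqrt (F σ)) ^ 2)]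
    apply gE_mono
    intro σ
    rw [Tx_flip_ne g h]
    have := sqrt_mink (pw_pos g x σ).le (pw_pos g x (spinFlip x σ)).le (hF (spinFlip z σ)).le
      (hF (spinFlip z (spinFlip x σ))).le (hF σ).le (hF (spinFlip x σ)).le
    simp only [Tx]
    linarith

def TL (g : Λ → ℝ) : List Λ → ((Λ → Bool) → ℝ) → ((Λ → Bool) → ℝ)
  | [], F => F
  | x :: l, F => TL g l (Tx g x F)

lemma TL_pos (g : Λ → ℝ) (l : List Λ) : ∀ {F : (Λ → Bool) → ℝ}, (∀ σ, 0 < F σ) → ∀ σ, 0 < TL g l F σ := by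
  induction l with
  | nil => intro F h; exact h
  | cons x l ih => intro F h; exact ih (Tx_pos g x h)

lemma TL_E (g : Λ → ℝ) (l : List Λ) : ∀ (F : (Λ → Bool) → ℝ), gE (ls g) (TL g l F) = gE (ls g) F := by
  induction l with
  | nil => intro F; rfl
  | cons x l ih => intro F; exact (ih _).trans (E_Tx g x F)

lemma TL_H (g : Λ → ℝ) (l : List Λ) : ∀ {F : (Λ → Bool) → ℝ}, (∀ σ, 0 < F σ) →
    Hh g F ≤ Hh g (TL g l F) + (l.map (fun x => Dx g x F)).sum := by
  induction l with
  | nil => intro F h; simp [TL]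
  | cons x l ih =>
    intro F h
    have h1 := ih (Tx_pos g x h)
    have h2 := Hh_step g x h
    have h3 : (l.map (fun z => Dx g z (Tx g x F))).sum ≤ (l.map (fun z => Dx g z F)).sum :=
      List.sum_le_sum fun z _ => Dx_Tx g x z h
    simp only [List.map_cons, List.sum_cons, TL]
    linarith

lemma Tx_inv (g : Λ → ℝ) (x z : Λ) {F : (Λ → Bool) → ℝ} (h : ∀ σ, F (spinFlip z σ) = F σ) (σ) :
    Tx g x F (spinFlip z σ) = Tx g x F σ := by
  by_cases hz : z = x
  · rw [hz, Tx_flip]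
  · rw [Tx_flip_ne g hz, h, h]; rfl

lemma TL_inv (g : Λ → ℝ) (l : List Λ) (z : Λ) : ∀ {F : (Λ → Bool) → ℝ}, (z ∈ l ∨ ∀ σ, F (spinFlip z σ) = F σ) →
    ∀ σ, TL g l F (spinFlip z σ) = TL g l F σ := by
  induction l with
  | nil => intro F h; rcases h with h | h; · simp at h
           exact h
  | cons x l ih =>
    intro F h
    simp only [TL]
    apply ih
    by_cases hz : z = x
    · right; rw [hz]; exact Tx_flip g x F
    · rcases h with h | h
      · left; simpa [hz] using h
      · right; exact Tx_inv g x z h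

lemma const_of_flip {F : (Λ → Bool) → ℝ} (h : ∀ z σ, F (spinFlip z σ) = F σ) (σ τ : Λ → Bool) : F σ = F τ := by
  have key : ∀ s : Finset Λ, F (s.piecewise τ σ) = F σ := by
    intro s
    induction s using Finset.induction_on with
    | empty => simp
    | insert a s ha ih =>
      rw [Finset.piecewise_insert]
      by_cases e : τ a = s.piecewise τ σ a
      · rw [e, Function.update_eq_self, ih]
      · have : τ a = ! s.piecewise τ σ a := by
          revert e; cases τ a <;> cases s.piecewise τ σ a <;> simp
        rw [this]; exact (h a _).trans ih
  have := key Finset.univ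
  rw [Finset.piecewise_univ] at this
  exact this.symm

/-- log-Sobolev inequality for product measures -/
lemma prod_lsi (g : Λ → ℝ) {F : (Λ → Bool) → ℝ} (hF : ∀ σ, 0 < F σ) :
    gE (ls g) (fun σ => F σ * Real.log (F σ)) - gE (ls g) F * Real.log (gE (ls g) F) ≤
      gE (ls g) (fun σ => (1/2) * ∑ x, (Real.sqrt (F (spinFlip x σ)) - Real.sqrt (F σ)) ^ 2) := by
  have h := TL_H g Finset.univ.toList hF
  have hc : ∀ σ τ, TL g Finset.univ.toList F σ = TL g Finset.univ.toList F τ :=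
    const_of_flip fun z => TL_inv g _ z (Or.inl (by simp))
  obtain ⟨c, hc⟩ : ∃ c, TL g Finset.univ.toList F = fun _ => c := ⟨_, funext fun σ => hc σ (fun _ => true)⟩
  have hE := TL_E g Finset.univ.toList F
  rw [hc, gE_const] at hE
  rw [hc] at h
  unfold Hh at h
  rw [gE_const] at h
  rw [← hE]
  rw [gE_mul, gE_sum, Finset.mul_sum]
  rw [Finset.sum_map_toList] at h
  unfold Dx at h
  simp only [gE_mul] at h
  linarith

lemma gE_cs {Ω : Type*} [Fintype Ω] [Nonempty Ω] (E f g : Ω → ℝ) :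
    (gE E (fun ω => f ω * g ω)) ^ 2 ≤ gE E (fun ω => f ω ^ 2) * gE E (fun ω => g ω ^ 2) := by
  have hz := gZ_pos E
  unfold gE
  rw [div_pow, div_mul_div_comm, ← sq]
  apply div_le_div_of_nonneg_right _ (by positivity)
  have := Finset.sum_mul_sq_le_sq_mul_sq Finset.univ (fun ω => Real.exp (E ω / 2) * f ω) (fun ω => Real.exp (E ω / 2) * g ω)
  have e : ∀ ω, Real.exp (E ω) = Real.exp (E ω / 2) * Real.exp (E ω / 2) := fun ω => by
    rw [← Real.exp_add, add_halves]
  simp only [e]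
  convert this using 2
  · exact Finset.sum_congr rfl fun ω _ => by ring
  · exact Finset.sum_congr rfl fun ω _ => by ring
  · exact Finset.sum_congr rfl fun ω _ => by ring

lemma cov_bound (g : Λ → ℝ) {F : (Λ → Bool) → ℝ} (hF : ∀ σ, 0 < F σ) (x : Λ) :
    (gE (ls g) (fun σ => F σ * spin σ x) - gE (ls g) F * gE (ls g) (fun σ => spin σ x)) ^ 2 ≤
      gE (ls g) F * gE (ls g) (fun σ => (Real.sqrt (F (spinFlip x σ)) - Real.sqrt (F σ)) ^ 2) := by
  have hk : ∀ σ, spin σ x - Real.tanh (g x) = 2 * spin σ x * pw g x (spinFlip x σ) := by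
    intro σ
    unfold pw
    rw [spin_flip_same]
    have := spin_sq σ x
    linear_combination (Real.tanh (g x)) * this
  have anti : ∀ G : (Λ → Bool) → ℝ, gE (ls g) (fun σ => G σ * (spin σ x - Real.tanh (g x))) =
      - gE (ls g) (fun σ => G (spinFlip x σ) * (spin σ x - Real.tanh (g x))) := by
    intro G
    have := E_bal g x (fun σ => 2 * spin σ x * G σ)
    rw [neg_eq_neg_one_mul, ← gE_mul]
    simp only [hk]
    calc _ = gE (ls g) (fun σ => pw g x (spinFlip x σ) * (2 * spin σ x * G σ)) := by
            congr 1; ext σ; ring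
      _ = _ := this.symm
      _ = _ := by congr 1; ext σ; rw [spin_flip_same]; ring
  have hm : gE (ls g) (fun σ => spin σ x) = Real.tanh (g x) := by
    have := anti (fun _ => 1)
    simp only [one_mul, gE_sub, gE_const] at this
    linarith
  have hc : gE (ls g) (fun σ => F σ * spin σ x) - gE (ls g) F * gE (ls g) (fun σ => spin σ x) =
      gE (ls g) (fun σ => (Real.sqrt (F (spinFlip x σ)) - Real.sqrt (F σ)) *
        (-(Real.sqrt (F (spinFlip x σ)) + Real.sqrt (F σ)) * (spin σ x * pw g x (spinFlip x σ)))) := by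
    have h1 : gE (ls g) (fun σ => F σ * (spin σ x - Real.tanh (g x))) =
      gE (ls g) (fun σ => F σ * spin σ x) - gE (ls g) F * gE (ls g) (fun σ => spin σ x) := by
      rw [hm, mul_comm (gE (ls g) F), ← gE_mul, ← gE_sub]
      congr 1; ext σ; ring
    have h2 := anti F
    rw [← h1]
    have h3 : gE (ls g) (fun σ => F σ * (spin σ x - Real.tanh (g x))) = (1/2) *
      (gE (ls g) (fun σ => F σ * (spin σ x - Real.tanh (g x))) - gE (ls g) (fun σ => F (spinFlip x σ) * (spin σ x - Real.tanh (g x)))) := by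
      linarith
    rw [h3, ← gE_sub, ← gE_mul]
    congr 1; ext σ
    rw [hk]
    have s1 := Real.sq_sqrt (hF σ).le
    have s2 := Real.sq_sqrt (hF (spinFlip x σ)).le
    linear_combination (-(spin σ x) * pw g x (spinFlip x σ)) * s1 + (spin σ x * pw g x (spinFlip x σ)) * s2
  rw [hc]
  refine (gE_cs _ _ _).trans ?_
  rw [mul_comm]
  apply mul_le_mul_of_nonneg_right _ (gE_nonneg _ fun σ => sq_nonneg _)
  calc _ ≤ gE (ls g) (fun σ => pw g x (spinFlip x σ) * F σ +
        pw g x (spinFlip x σ) * (pw g x (spinFlip x σ) / pw g x (spinFlip x (spinFlip x σ)) * F (spinFlip x σ))) := by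
        apply gE_mono
        intro σ
        rw [sflip_sflip]
        have s1 := Real.sq_sqrt (hF σ).le
        have s2 := Real.sq_sqrt (hF (spinFlip x σ)).le
        have hp := pw_pos g x σ
        have hq := pw_pos g x (spinFlip x σ)
        have hpq := pw_add g x σ
        have hs := spin_sq σ x
        rw [show (-(√(F (spinFlip x σ)) + √(F σ)) * (spin σ x * pw g x (spinFlip x σ))) ^ 2 =
          (spin σ x * spin σ x) * ((√(F (spinFlip x σ)) + √(F σ)) ^ 2 * pw g x (spinFlip x σ) ^ 2) by ring, hs, one_mul]
        generalize √(F σ) = a at *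
        generalize √(F (spinFlip x σ)) = b at *
        generalize pw g x σ = p at *
        generalize pw g x (spinFlip x σ) = q at *
        rw [← s1, ← s2]
        have : q * (q / p * b ^ 2) * p = q ^ 2 * b ^ 2 := by field_simp
        have e : (q * a ^ 2 + q * (q / p * b ^ 2) - (b + a) ^ 2 * q ^ 2) * p = q * (p * a - q * b) ^ 2 := by
          have hp1 : p = 1 - q := by linarith
          rw [sub_mul, add_mul, this, hp1]; ring
        have e2 : 0 ≤ (q * a ^ 2 + q * (q / p * b ^ 2) - (b + a) ^ 2 * q ^ 2) * p := by rw [e]; positivity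
        have := nonneg_of_mul_nonneg_left e2 hp
        linarith
    _ = gE (ls g) F := by
        rw [gE_add, E_bal g x (fun σ => pw g x σ / pw g x (spinFlip x σ) * F σ), ← gE_add]
        congr 1; ext σ
        have hq := pw_pos g x (spinFlip x σ)
        have hpq := pw_add g x σ
        field_simp
        linear_combination F σ * hpq

end D

/-! Part 7 -/


section F
variable {Λ : Type*} [Fintype Λ] [DecidableEq Λ]

/-- the coupling matrix -/
def Jt (A : Matrix Λ Λ ℝ) (t : ℝ) : Λ → Λ → ℝ := fun x y => -t * A x y

lemma Ham_Jt (A : Matrix Λ Λ ℝ) (t : ℝ) (g : Λ → ℝ) (σ : Λ → Bool) :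
    -(t / 2) * (spin σ ⬝ᵥ A.mulVec (spin σ)) + g ⬝ᵥ spin σ = Ham (Jt A t) g σ := by
  unfold Ham Jt
  simp only [dotProduct, mulVec, Finset.mul_sum]
  congr 1
  refine Finset.sum_congr rfl fun x _ => Finset.sum_congr rfl fun y _ => by ring

lemma isingProb_sum (A : Matrix Λ Λ ℝ) (t : ℝ) (g : Λ → ℝ) (f : (Λ → Bool) → ℝ) :
    ∑ σ, isingProb A t g σ * f σ = gE (Ham (Jt A t) g) f := by
  unfold isingProb gE isingWeight
  simp only [Ham_Jt]
  rw [Finset.sum_div]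
  exact Finset.sum_congr rfl fun σ _ => by ring

def qM (A : Matrix Λ Λ ℝ) (t : ℝ) (v : Λ → ℝ) : ℝ := gE (Ham (Jt A t) 0) (fun σ => ls v σ * ls v σ)

lemma qM_eq (A : Matrix Λ Λ ℝ) (t : ℝ) (v : Λ → ℝ) :
    v ⬝ᵥ (Matrix.of fun x y =>
        ∑ σ : Λ → Bool, isingProb A t 0 σ * (spin σ x * spin σ y)).mulVec v = qM A t v := by
  have : (fun σ => ls v σ * ls v σ) = fun σ => ∑ x, ∑ y, v x * v y * (spin σ x * spin σ y) := by
    ext σ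
    unfold ls
    rw [Finset.sum_mul_sum]
    exact Finset.sum_congr rfl fun x _ => Finset.sum_congr rfl fun y _ => by ring
  unfold qM
  rw [this, gE_sum]
  simp only [dotProduct, mulVec, Matrix.of_apply, isingProb_sum, Finset.mul_sum]
  refine Finset.sum_congr rfl fun x _ => ?_
  rw [gE_sum]
  refine Finset.sum_congr rfl fun y _ => ?_
  rw [gE_mul]; ring

lemma ls_sq_le (v : Λ → ℝ) (σ : Λ → Bool) : ls v σ * ls v σ ≤ (v ⬝ᵥ v) * (Fintype.card Λ) := by
  have := Finset.sum_mul_sq_le_sq_mul_sq Finset.univ v (spin σ)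
  simp only [sq, spin_sq] at this
  simpa [ls, dotProduct] using this

lemma qM_bdd (A : Matrix Λ Λ ℝ) (t : ℝ) :
    BddAbove (Set.range fun v : {v : Λ → ℝ // v ⬝ᵥ v = 1} => qM A t v) := by
  refine ⟨Fintype.card Λ, ?_⟩
  rintro _ ⟨v, rfl⟩
  have := gE_mono (Ham (Jt A t) 0) (fun σ => ls_sq_le (v : Λ → ℝ) σ)
  rw [gE_const, v.2, one_mul] at this
  exact this

lemma qM_smul (A : Matrix Λ Λ ℝ) (t c : ℝ) (v : Λ → ℝ) : qM A t (c • v) = c ^ 2 * qM A t v := by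
  unfold qM
  rw [← gE_mul]
  congr 1; ext σ
  have : ls (c • v) σ = c * ls v σ := by
    unfold ls; rw [Finset.mul_sum]; exact Finset.sum_congr rfl fun x _ => by simp [mul_assoc]
  rw [this]; ring

lemma qM_le (A : Matrix Λ Λ ℝ) (χ : ℝ → ℝ)
    (hχ : ∀ t, χ t = ⨆ v : {v : Λ → ℝ // v ⬝ᵥ v = 1}, qM A t v) (t : ℝ) (v : Λ → ℝ) :
    qM A t v ≤ χ t * (v ⬝ᵥ v) := by
  by_cases h : v ⬝ᵥ v = 0
  · have : v = 0 := dotProduct_self_eq_zero.1 h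
    rw [h, this]
    simp [qM, ls]
    exact (gE_const _ 0).le
  · have hpos : 0 < v ⬝ᵥ v := lt_of_le_of_ne (Finset.sum_nonneg fun x _ => mul_self_nonneg _) (Ne.symm h)
    have hs := Real.sq_sqrt hpos.le
    have hs0 := Real.sqrt_pos.2 hpos
    have hu : ((Real.sqrt (v ⬝ᵥ v))⁻¹ • v) ⬝ᵥ ((Real.sqrt (v ⬝ᵥ v))⁻¹ • v) = 1 := by
      rw [smul_dotProduct, dotProduct_smul, smul_eq_mul, smul_eq_mul]
      nth_rewrite 3 [← hs]
      field_simp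
    have := le_ciSup (qM_bdd A t) ⟨_, hu⟩
    rw [← hχ] at this
    simp only [qM_smul] at this
    rw [inv_pow, hs, inv_mul_eq_div, div_le_iff₀ hpos] at this
    exact this

lemma qM_nonneg (A : Matrix Λ Λ ℝ) (t : ℝ) (v : Λ → ℝ) : 0 ≤ qM A t v :=
  gE_nonneg _ fun σ => mul_self_nonneg _

lemma chi_nonneg [Nonempty Λ] (A : Matrix Λ Λ ℝ) (χ : ℝ → ℝ)
    (hχ : ∀ t, χ t = ⨆ v : {v : Λ → ℝ // v ⬝ᵥ v = 1}, qM A t v) (t : ℝ) : 0 ≤ χ t := by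
  have x : Λ := Classical.arbitrary Λ
  have := (qM_nonneg A t (Pi.single x 1)).trans (qM_le A χ hχ t (Pi.single x 1))
  simpa using this

lemma chi_cont [Nonempty Λ] (A : Matrix Λ Λ ℝ) (χ : ℝ → ℝ)
    (hχ : ∀ t, χ t = ⨆ v : {v : Λ → ℝ // v ⬝ᵥ v = 1}, qM A t v) : Continuous χ := by
  let p : ℝ → (Λ → Bool) → ℝ := fun t σ => Real.exp (Ham (Jt A t) 0 σ) / ∑ τ, Real.exp (Ham (Jt A t) 0 τ)
  have hH : ∀ σ, Continuous (fun t => Ham (Jt A t) 0 σ) := by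
    intro σ; unfold Ham Jt; fun_prop
  have hp : ∀ σ, Continuous (fun t => p t σ) := by
    intro σ
    refine Continuous.div (hH σ).rexp (continuous_finset_sum _ fun τ _ => (hH τ).rexp) fun t => (gZ_pos _).ne'
  have hq : ∀ t v, qM A t v = ∑ σ, p t σ * (ls v σ * ls v σ) := by
    intro t v
    unfold qM gE
    rw [Finset.sum_div]
    exact Finset.sum_congr rfl fun σ _ => by simp only [p]; ring
  let D : ℝ → ℝ → ℝ := fun t s => ∑ σ, |p t σ - p s σ| * Fintype.card Λ
  have hne : Nonempty {v : Λ → ℝ // v ⬝ᵥ v = 1} := ⟨⟨Pi.single (Classical.arbitrary Λ) 1, by simp⟩⟩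
  have key : ∀ t s, χ t ≤ χ s + D t s := by
    intro t s
    rw [hχ t]
    apply ciSup_le
    intro v
    have h1 := qM_le A χ hχ s v
    rw [v.2, mul_one] at h1
    have h2 : qM A t v - qM A s v ≤ D t s := by
      rw [hq, hq, ← Finset.sum_sub_distrib]
      refine Finset.sum_le_sum fun σ _ => ?_
      rw [← sub_mul]
      have h3 := ls_sq_le (v : Λ → ℝ) σ
      rw [v.2, one_mul] at h3
      have h4 := mul_self_nonneg (ls (v : Λ → ℝ) σ)
      calc _ ≤ |p t σ - p s σ| * (ls (v : Λ → ℝ) σ * ls (v : Λ → ℝ) σ) :=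
            mul_le_mul_of_nonneg_right (le_abs_self _) h4
        _ ≤ _ := mul_le_mul_of_nonneg_left h3 (abs_nonneg _)
    linarith
  rw [continuous_iff_continuousAt]
  intro s
  have hD : Filter.Tendsto (fun t => D t s) (nhds s) (nhds 0) := by
    have : Continuous (fun t => D t s) :=
      continuous_finset_sum _ fun σ _ => (((hp σ).sub continuous_const).abs).mul continuous_const
    have := this.tendsto s
    simpa [D] using this
  have hDs : ∀ t, D s t = D t s := fun t => Finset.sum_congr rfl fun σ _ => by rw [abs_sub_comm]
  have a1 : Filter.Tendsto (fun t => χ s - D t s) (nhds s) (nhds (χ s)) := by simpa using hD.const_sub (χ s)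
  have a2 : Filter.Tendsto (fun t => χ s + D t s) (nhds s) (nhds (χ s)) := by simpa using hD.const_add (χ s)
  exact tendsto_of_tendsto_of_tendsto_of_le_of_le a1 a2 (fun t => by
    have := key s t; rw [hDs] at this; simp only; linarith) (fun t => key t s)

lemma gVar_chi (A : Matrix Λ Λ ℝ) (hA : ∀ x y, A x y = A y x) (hf : ∀ x y, x ≠ y → A x y ≤ 0) (χ : ℝ → ℝ)
    (hχ : ∀ t, χ t = ⨆ v : {v : Λ → ℝ // v ⬝ᵥ v = 1}, qM A t v) (t : ℝ) (ht : 0 ≤ t) (g v : Λ → ℝ) :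
    gVar (Ham (Jt A t) g) v ≤ χ t * (v ⬝ᵥ v) := by
  have h1 := gVar_bound (Jt A t) (fun x y => by unfold Jt; rw [hA]) (fun x y h => by
    unfold Jt; nlinarith [hf x y h]) g v
  have h2 := qM_le A χ hχ t (fun x => |v x|)
  have e : (fun x => |v x|) ⬝ᵥ (fun x => |v x|) = v ⬝ᵥ v :=
    Finset.sum_congr rfl fun x _ => abs_mul_abs_self _
  rw [e] at h2
  exact h1.trans h2

end F

/-! Part 8 -/


section B
variable {ι : Type*} [Fintype ι] [DecidableEq ι]

/-- parabolic regularity data -/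
structure PD (m : ℝ → (ι → ℝ) → ι → ℝ) (f : ℝ → (ι → ℝ) → ℝ) (f1 : ℝ → (ι → ℝ) → ι → ℝ)
    (r : ℝ → (ι → ℝ) → ℝ) : Prop where
  cont : Continuous (fun p : ℝ × (ι → ℝ) => f p.1 p.2)
  ex : ∃ (ft : ℝ → (ι → ℝ) → ℝ) (f2 : ℝ → (ι → ℝ) → ι → ℝ),
    (∀ t φ, HasDerivAt (fun s => f s φ) (ft t φ) t) ∧
    (∀ t φ j, HasDerivAt (fun s => f t (Function.update φ j s)) (f1 t φ j) (φ j)) ∧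
    (∀ t φ j, HasDerivAt (fun s => f1 t (Function.update φ j s) j) (f2 t φ j) (φ j)) ∧
    ∀ t φ, ft t φ - (1/2) * ∑ j, f2 t φ j - ∑ j, m t φ j * f1 t φ j = r t φ

lemma sum_sq_update (φ : ι → ℝ) (j : ι) (s : ℝ) :
    ∑ i, (Function.update φ j s i) ^ 2 = s ^ 2 + (∑ i, φ i ^ 2 - φ j ^ 2) := by
  rw [← Finset.add_sum_erase _ _ (Finset.mem_univ j), ← Finset.add_sum_erase _ (fun i => φ i ^ 2) (Finset.mem_univ j),
    Function.update_self, Finset.sum_congr rfl (fun y hy => by rw [Function.update_of_ne (Finset.ne_of_mem_erase hy)])]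
  ring

lemma left_deriv_nonneg {f : ℝ → ℝ} {a t : ℝ} (hf : HasDerivAt f a t) (ht : 0 < t)
    (h : ∀ s, 0 ≤ s → s ≤ t → f s ≤ f t) : 0 ≤ a := by
  have h1 := hasDerivAt_iff_tendsto_slope.1 hf
  have h2 : Filter.Tendsto (slope f t) (nhdsWithin t (Set.Iio t)) (nhds a) :=
    h1.mono_left (nhdsWithin_mono _ fun y (hy : y < t) => ne_of_lt hy)
  apply ge_of_tendsto h2
  have : Set.Ioo 0 t ∈ nhdsWithin t (Set.Iio t) := Ioo_mem_nhdsLT ht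
  filter_upwards [this] with s hs
  rw [slope_def_field]
  apply div_nonneg_of_nonpos
  · linarith [h s hs.1.le hs.2.le]
  · linarith [hs.2]

lemma max_principle {m : ℝ → (ι → ℝ) → ι → ℝ} {K : ℝ → (ι → ℝ) → ℝ} {K1 : ℝ → (ι → ℝ) → ι → ℝ}
    {r : ℝ → (ι → ℝ) → ℝ} (hP : PD m K K1 r) (T M C : ℝ)
    (hr : ∀ t φ, 0 ≤ t → r t φ ≤ 0) (hM : ∀ t φ, 0 ≤ t → t ≤ T → K t φ ≤ M)
    (hm : ∀ t φ j, |m t φ j| ≤ C) (h0 : ∀ φ, K 0 φ ≤ 0) :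
    ∀ t φ, 0 ≤ t → t ≤ T → K t φ ≤ 0 := by
  obtain ⟨ft, f2, hft, hf1, hf2, hreq⟩ := hP.ex
  intro t1 φ1 ht1 ht1T
  by_contra hcon
  push Not at hcon
  set δ := K t1 φ1 with hδ
  set n : ℝ := (Fintype.card ι : ℝ) with hn
  set lam : ℝ := n + n * C ^ 2 + 2 with hlam
  have hlam2 : 2 ≤ lam := by have : 0 ≤ n + n * C ^ 2 := by positivity
                             linarith
  obtain ⟨ε, hε, hεδ⟩ : ∃ ε, 0 < ε ∧ ε * (Real.exp (lam * T) * (1 + ∑ i, φ1 i ^ 2)) < δ := by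
    have hp : 0 < Real.exp (lam * T) * (1 + ∑ i, φ1 i ^ 2) := by positivity
    refine ⟨δ / (2 * (Real.exp (lam * T) * (1 + ∑ i, φ1 i ^ 2))), by positivity, ?_⟩
    rw [div_mul_eq_mul_div, div_lt_iff₀ (by positivity)]
    nlinarith [mul_pos hcon hp]
  let G : ℝ → (ι → ℝ) → ℝ := fun t φ => K t φ - ε * (Real.exp (lam * t) * (1 + ∑ i, φ i ^ 2))
  have hG1 : 0 < G t1 φ1 := by
    have : ε * (Real.exp (lam * t1) * (1 + ∑ i, φ1 i ^ 2)) ≤ ε * (Real.exp (lam * T) * (1 + ∑ i, φ1 i ^ 2)) := by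
      gcongr
    simp only [G]; linarith
  have hGc : Continuous (fun p : ℝ × (ι → ℝ) => G p.1 p.2) := by
    refine hP.cont.sub ?_
    fun_prop
  set R : ℝ := |M| / ε + ∑ i, φ1 i ^ 2 with hR
  let S : Set (ι → ℝ) := {φ | ∑ i, φ i ^ 2 ≤ R}
  have hSc : IsCompact S := by
    have hcl : IsClosed S := isClosed_le (by fun_prop) continuous_const
    apply IsCompact.of_isClosed_subset (isCompact_univ_pi (fun _ : ι => isCompact_Icc (a := -(R+1)) (b := R+1))) hcl
    intro φ hφ i _
    have h1 : φ i ^ 2 ≤ ∑ i, φ i ^ 2 := Finset.single_le_sum (f := fun i => φ i ^ 2) (fun i _ => sq_nonneg _) (Finset.mem_univ i)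
    have h2 : ∑ i, φ i ^ 2 ≤ R := hφ
    constructor <;> nlinarith
  have hφ1 : φ1 ∈ S := by
    change ∑ i, φ1 i ^ 2 ≤ R
    have : 0 ≤ |M| / ε := by positivity
    linarith
  obtain ⟨⟨t0, φ0⟩, ⟨ht0, hφ0⟩, hmax⟩ := ((isCompact_Icc (a := (0:ℝ)) (b := T)).prod hSc).exists_isMaxOn
    ⟨(t1, φ1), ⟨ht1, ht1T⟩, hφ1⟩ hGc.continuousOn
  have hmax1 : G t1 φ1 ≤ G t0 φ0 := hmax (a := (t1, φ1)) ⟨⟨ht1, ht1T⟩, hφ1⟩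
  have hG0 : 0 < G t0 φ0 := hG1.trans_le hmax1
  have hglob : ∀ t φ, 0 ≤ t → t ≤ T → G t φ ≤ G t0 φ0 := by
    intro t φ h1 h2
    by_cases h : φ ∈ S
    · exact hmax (a := (t, φ)) ⟨⟨h1, h2⟩, h⟩
    · have h3 : R < ∑ i, φ i ^ 2 := not_le.1 h
      have h4 : |M| / ε ≤ ∑ i, φ i ^ 2 := by
        have : 0 ≤ ∑ i, φ1 i ^ 2 := by positivity
        linarith
      rw [div_le_iff₀ hε] at h4
      have h5 : 1 ≤ Real.exp (lam * t) := Real.one_le_exp (by nlinarith)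
      have h6 : (∑ i, φ i ^ 2) ≤ Real.exp (lam * t) * (1 + ∑ i, φ i ^ 2) := by
        have : 0 ≤ ∑ i, φ i ^ 2 := by positivity
        nlinarith
      have h7 := mul_le_mul_of_nonneg_left h6 hε.le
      have h8 := hM t φ h1 h2
      have h9 := le_abs_self M
      have : G t φ ≤ 0 := by simp only [G]; nlinarith
      linarith
  have ht0p : 0 < t0 := by
    rcases ht0.1.eq_or_lt with h | h
    · exfalso
      have e : (0:ℝ) = t0 := h
      rw [← e] at hG0
      have := h0 φ0
      have h2 : 0 < ε * (Real.exp (lam * 0) * (1 + ∑ i, φ0 i ^ 2)) := by positivity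
      simp only [G] at hG0
      linarith
    · exact h
  have hT0 : t0 ≤ T := ht0.2
  set E : ℝ := ε * Real.exp (lam * t0) with hE
  have hEp : 0 < E := by positivity
  -- time derivative
  have hd0 : HasDerivAt (fun s => G s φ0) (ft t0 φ0 - lam * E * (1 + ∑ i, φ0 i ^ 2)) t0 := by
    have a := ((((hasDerivAt_id t0).const_mul lam).exp).mul_const (1 + ∑ i, φ0 i ^ 2)).const_mul ε
    refine hdcg ((hft t0 φ0).sub a) (fun _ => rfl) ?_
    simp only [id, hE]; ring
  have hT := left_deriv_nonneg hd0 ht0p (fun s h1 h2 => hglob s φ0 h1 (h2.trans hT0))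
  have hd1 : ∀ j x, HasDerivAt (fun s => G t0 (Function.update φ0 j s))
      (K1 t0 (Function.update φ0 j x) j - E * (2 * x)) x := by
    intro j x
    have a := hf1 t0 (Function.update φ0 j x) j
    simp only [Function.update_idem, Function.update_self] at a
    have b := (((hasDerivAt_id x).pow 2).add_const (1 + (∑ i, φ0 i ^ 2 - φ0 j ^ 2))).const_mul E
    refine hdcg (a.sub b) (fun y => ?_) ?_
    · simp only [G, sum_sq_update, hE]; simp; ring
    · simp
  have hd2 : ∀ j, HasDerivAt (fun x => K1 t0 (Function.update φ0 j x) j - E * (2 * x)) (f2 t0 φ0 j - 2 * E) (φ0 j) := by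
    intro j
    have b := ((hasDerivAt_id (φ0 j)).const_mul 2).const_mul E
    exact hdcg ((hf2 t0 φ0 j).sub b) (fun y => rfl) (by ring)
  have hlm : ∀ j, IsLocalMax (fun s => G t0 (Function.update φ0 j s)) (φ0 j) := by
    intro j
    refine Filter.Eventually.of_forall fun s => ?_
    simp only [Function.update_eq_self]
    exact hglob t0 _ ht0.1 hT0
  have hs1 : ∀ j, K1 t0 φ0 j = E * (2 * φ0 j) := by
    intro j
    have := (hlm j).hasDerivAt_eq_zero (hd1 j (φ0 j))
    rw [Function.update_eq_self] at this
    linarith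
  have hs2 : ∀ j, f2 t0 φ0 j ≤ 2 * E := by
    intro j
    have := deriv2_nonpos (hd1 j) (hd2 j) (hlm j)
    linarith
  have hrr := hreq t0 φ0
  have hr0 := hr t0 φ0 ht0.1
  have b1 : ∑ j, f2 t0 φ0 j ≤ n * (2 * E) := by
    have := Finset.sum_le_sum (fun j (_ : j ∈ Finset.univ) => hs2 j)
    simpa [hn] using this
  have b2 : ∑ j, m t0 φ0 j * K1 t0 φ0 j ≤ E * (n * C ^ 2 + ∑ i, φ0 i ^ 2) := by
    have : n * C ^ 2 + ∑ i, φ0 i ^ 2 = ∑ i : ι, (C ^ 2 + φ0 i ^ 2) := by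
      simp [Finset.sum_add_distrib, hn]
    rw [this, Finset.mul_sum]
    refine Finset.sum_le_sum fun j _ => ?_
    rw [hs1]
    have hc : m t0 φ0 j ^ 2 ≤ C ^ 2 := sq_le_sq' (abs_le.1 (hm t0 φ0 j)).1 (abs_le.1 (hm t0 φ0 j)).2
    have : m t0 φ0 j * (2 * φ0 j) ≤ C ^ 2 + φ0 j ^ 2 := by nlinarith [sq_nonneg (m t0 φ0 j - φ0 j)]
    nlinarith
  have hq : 0 ≤ ∑ i, φ0 i ^ 2 := by positivity
  have hfin : 0 < lam * E * (1 + ∑ i, φ0 i ^ 2) - n * E - E * (n * C ^ 2 + ∑ i, φ0 i ^ 2) := by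
    have : lam * E * (1 + ∑ i, φ0 i ^ 2) - n * E - E * (n * C ^ 2 + ∑ i, φ0 i ^ 2) =
      E * (2 + (lam - 1) * ∑ i, φ0 i ^ 2) := by rw [hlam]; ring
    rw [this]
    have : 0 ≤ (lam - 1) * ∑ i, φ0 i ^ 2 := mul_nonneg (by linarith) hq
    positivity
  linarith

end B

/-! Part 9 -/


section C
variable {ι : Type*} [Fintype ι] [DecidableEq ι] {m : ℝ → (ι → ℝ) → ι → ℝ}
  {f g : ℝ → (ι → ℝ) → ℝ} {f1 g1 : ℝ → (ι → ℝ) → ι → ℝ} {r q : ℝ → (ι → ℝ) → ℝ}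

lemma PD.add (hf : PD m f f1 r) (hg : PD m g g1 q) :
    PD m (fun t φ => f t φ + g t φ) (fun t φ j => f1 t φ j + g1 t φ j) (fun t φ => r t φ + q t φ) := by
  obtain ⟨ft, f2, a1, a2, a3, a4⟩ := hf.ex
  obtain ⟨gt, g2, b1, b2, b3, b4⟩ := hg.ex
  refine ⟨hf.cont.add hg.cont, fun t φ => ft t φ + gt t φ, fun t φ j => f2 t φ j + g2 t φ j,
    fun t φ => (a1 t φ).add (b1 t φ), fun t φ j => (a2 t φ j).add (b2 t φ j), fun t φ j => (a3 t φ j).add (b3 t φ j), ?_⟩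
  intro t φ
  simp only [mul_add, Finset.sum_add_distrib]
  rw [← a4, ← b4]; ring

lemma PD.time {c c' : ℝ → ℝ} (hc : ∀ t, HasDerivAt c (c' t) t) :
    PD m (fun t _ => c t) (fun _ _ _ => 0) (fun t _ => c' t) := by
  have hcc : Continuous c := continuous_iff_continuousAt.2 fun t => (hc t).continuousAt
  refine ⟨hcc.comp continuous_fst, fun t _ => c' t, fun _ _ _ => 0, fun t _ => hc t,
    fun t φ j => hasDerivAt_const _ _, fun t φ j => hasDerivAt_const _ _, ?_⟩
  intro t φ
  simp

lemma PD.mul (hf : PD m f f1 r) (hg : PD m g g1 q) :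
    PD m (fun t φ => f t φ * g t φ) (fun t φ j => f1 t φ j * g t φ + f t φ * g1 t φ j)
      (fun t φ => r t φ * g t φ + f t φ * q t φ - ∑ j, f1 t φ j * g1 t φ j) := by
  obtain ⟨ft, f2, a1, a2, a3, a4⟩ := hf.ex
  obtain ⟨gt, g2, b1, b2, b3, b4⟩ := hg.ex
  refine ⟨hf.cont.mul hg.cont, fun t φ => ft t φ * g t φ + f t φ * gt t φ,
    fun t φ j => (f2 t φ j * g t φ + f1 t φ j * g1 t φ j) + (f1 t φ j * g1 t φ j + f t φ * g2 t φ j),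
    fun t φ => (a1 t φ).mul (b1 t φ), fun t φ j => ?_, fun t φ j => ?_, ?_⟩
  · refine hdcg ((a2 t φ j).mul (b2 t φ j)) (fun _ => rfl) ?_
    rw [Function.update_eq_self]
  · refine hdcg (((a3 t φ j).mul (b2 t φ j)).add ((a2 t φ j).mul (b3 t φ j))) (fun _ => rfl) ?_
    rw [Function.update_eq_self]
  intro t φ
  rw [← a4, ← b4]
  have e1 : ∑ j, ((f2 t φ j * g t φ + f1 t φ j * g1 t φ j) + (f1 t φ j * g1 t φ j + f t φ * g2 t φ j)) =
    (∑ j, f2 t φ j) * g t φ + 2 * (∑ j, f1 t φ j * g1 t φ j) + f t φ * ∑ j, g2 t φ j := by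
    simp only [Finset.sum_add_distrib, Finset.sum_mul, Finset.mul_sum]
    simp only [two_mul, Finset.sum_add_distrib]; ring
  have e2 : ∑ j, m t φ j * (f1 t φ j * g t φ + f t φ * g1 t φ j) = (∑ j, m t φ j * f1 t φ j) * g t φ +
    f t φ * ∑ j, m t φ j * g1 t φ j := by
    rw [Finset.sum_mul, Finset.mul_sum, ← Finset.sum_add_distrib]
    exact Finset.sum_congr rfl fun j _ => by ring
  rw [e1, e2]; ring

lemma PD.comp (hf : PD m f f1 r) {ψ ψ1 ψ2 : ℝ → ℝ} (h1 : ∀ t φ, HasDerivAt ψ (ψ1 (f t φ)) (f t φ))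
    (h2 : ∀ t φ, HasDerivAt ψ1 (ψ2 (f t φ)) (f t φ)) :
    PD m (fun t φ => ψ (f t φ)) (fun t φ j => ψ1 (f t φ) * f1 t φ j)
      (fun t φ => ψ1 (f t φ) * r t φ - (1/2) * ψ2 (f t φ) * ∑ j, f1 t φ j ^ 2) := by
  obtain ⟨ft, f2, a1, a2, a3, a4⟩ := hf.ex
  refine ⟨?_, fun t φ => ψ1 (f t φ) * ft t φ,
    fun t φ j => (ψ2 (f t φ) * f1 t φ j) * f1 t φ j + ψ1 (f t φ) * f2 t φ j,
    fun t φ => ?_, fun t φ j => ?_, fun t φ j => ?_, ?_⟩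
  · rw [continuous_iff_continuousAt]
    intro p
    exact ContinuousAt.comp (f := fun p : ℝ × (ι → ℝ) => f p.1 p.2) (h1 p.1 p.2).continuousAt hf.cont.continuousAt
  · exact HasDerivAt.comp t (h1 t φ) (a1 t φ)
  · have : HasDerivAt ψ (ψ1 (f t φ)) (f t (Function.update φ j (φ j))) := by
      rw [Function.update_eq_self]; exact h1 t φ
    exact HasDerivAt.comp (φ j) this (a2 t φ j)
  · have : HasDerivAt ψ1 (ψ2 (f t φ)) (f t (Function.update φ j (φ j))) := by
      rw [Function.update_eq_self]; exact h2 t φ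
    refine hdcg ((HasDerivAt.comp (φ j) this (a2 t φ j)).mul (a3 t φ j)) (fun _ => rfl) ?_
    simp only [Function.comp, Function.update_eq_self]
  intro t φ
  rw [← a4]
  have e1 : ∑ j, ((ψ2 (f t φ) * f1 t φ j) * f1 t φ j + ψ1 (f t φ) * f2 t φ j) =
    ψ2 (f t φ) * ∑ j, f1 t φ j ^ 2 + ψ1 (f t φ) * ∑ j, f2 t φ j := by
    rw [Finset.mul_sum, Finset.mul_sum, ← Finset.sum_add_distrib]
    exact Finset.sum_congr rfl fun j _ => by ring
  have e2 : ∑ j, m t φ j * (ψ1 (f t φ) * f1 t φ j) = ψ1 (f t φ) * ∑ j, m t φ j * f1 t φ j := by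
    rw [Finset.mul_sum]
    exact Finset.sum_congr rfl fun j _ => by ring
  rw [e1, e2]; ring

lemma PD.congr {f' : ℝ → (ι → ℝ) → ℝ} {f1' : ℝ → (ι → ℝ) → ι → ℝ} {r' : ℝ → (ι → ℝ) → ℝ}
    (hf : PD m f f1 r) (h1 : ∀ t φ, f' t φ = f t φ) (h2 : ∀ t φ j, f1' t φ j = f1 t φ j)
    (h3 : ∀ t φ, r' t φ = r t φ) : PD m f' f1' r' := by
  have e1 : f' = f := by ext t φ; exact h1 t φ
  have e2 : f1' = f1 := by ext t φ j; exact h2 t φ j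
  have e3 : r' = r := by ext t φ; exact h3 t φ
  rw [e1, e2, e3]; exact hf

lemma PD.sub (hf : PD m f f1 r) (hg : PD m g g1 q) :
    PD m (fun t φ => f t φ - g t φ) (fun t φ j => f1 t φ j - g1 t φ j) (fun t φ => r t φ - q t φ) := by
  have := hf.add ((PD.time (m := m) (c := fun _ => -1) (fun t => hasDerivAt_const t (-1))).mul hg)
  refine this.congr (fun _ _ => by ring) (fun _ _ _ => by ring) (fun _ _ => by simp; ring)

lemma PD.sum {κ : Type*} (s : Finset κ) {f : κ → ℝ → (ι → ℝ) → ℝ} {f1 : κ → ℝ → (ι → ℝ) → ι → ℝ}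
    {r : κ → ℝ → (ι → ℝ) → ℝ} (h : ∀ k, PD m (f k) (f1 k) (r k)) :
    PD m (fun t φ => ∑ k ∈ s, f k t φ) (fun t φ j => ∑ k ∈ s, f1 k t φ j) (fun t φ => ∑ k ∈ s, r k t φ) := by
  classical
  induction s using Finset.induction_on with
  | empty =>
    exact (PD.time (m := m) (c := fun _ => 0) (fun t => hasDerivAt_const t 0)).congr
      (fun _ _ => by simp) (fun _ _ _ => by simp) (fun _ _ => by simp)
  | insert a s ha ih =>
    exact ((h a).add ih).congr (fun _ _ => by rw [Finset.sum_insert ha]) (fun _ _ _ => by rw [Finset.sum_insert ha])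
      (fun _ _ => by rw [Finset.sum_insert ha])

end C

section X
variable {Ω : Type*} [Fintype Ω] [Nonempty Ω] {ι : Type*} [Fintype ι] [DecidableEq ι]

def ee (e0 q : Ω → ℝ) (s : ι → Ω → ℝ) (t : ℝ) (φ : ι → ℝ) (ω : Ω) : ℝ := e0 ω + t * q ω + ∑ i, φ i * s i ω

def gCov (E f g : Ω → ℝ) : ℝ := gE E (fun ω => f ω * g ω) - gE E f * gE E g

lemma ee_update (e0 q : Ω → ℝ) (s : ι → Ω → ℝ) (t : ℝ) (φ : ι → ℝ) (j : ι) (x : ℝ) (ω : Ω) :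
    ee e0 q s t (Function.update φ j x) ω = ee e0 q s t φ ω + (x - φ j) * s j ω := by
  unfold ee
  rw [← Finset.add_sum_erase _ _ (Finset.mem_univ j), ← Finset.add_sum_erase _ (fun i => φ i * s i ω) (Finset.mem_univ j),
    Function.update_self, Finset.sum_congr rfl (fun y hy => by rw [Function.update_of_ne (Finset.ne_of_mem_erase hy)])]
  ring

lemma ee_dj (e0 q : Ω → ℝ) (s : ι → Ω → ℝ) (t : ℝ) (φ : ι → ℝ) (j : ι) (ω : Ω) (x : ℝ) :
    HasDerivAt (fun x => ee e0 q s t (Function.update φ j x) ω) (s j ω) x := by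
  refine hdcg ((((hasDerivAt_id x).sub_const (φ j)).mul_const (s j ω)).const_add (ee e0 q s t φ ω))
    (fun y => ee_update e0 q s t φ j y ω) (by simp)

lemma gE_dj (e0 q : Ω → ℝ) (s : ι → Ω → ℝ) (t : ℝ) (φ : ι → ℝ) (j : ι) (f : Ω → ℝ) :
    HasDerivAt (fun x => gE (ee e0 q s t (Function.update φ j x)) f) (gCov (ee e0 q s t φ) f (s j)) (φ j) := by
  have := hasDerivAt_gE (e := fun x => ee e0 q s t (Function.update φ j x)) (fun ω => ee_dj e0 q s t φ j ω (φ j)) f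
  refine hdcg this (fun _ => rfl) ?_
  rw [Function.update_eq_self]; rfl

lemma gE_dt (e0 q : Ω → ℝ) (s : ι → Ω → ℝ) (t : ℝ) (φ : ι → ℝ) (f : Ω → ℝ) :
    HasDerivAt (fun t => gE (ee e0 q s t φ) f) (gCov (ee e0 q s t φ) f q) t := by
  have := hasDerivAt_gE (e := fun t => ee e0 q s t φ) (b := q) (s := t) (fun ω => by
    refine hdcg ((((hasDerivAt_id t).mul_const (q ω)).const_add (e0 ω)).add_const (∑ i, φ i * s i ω)) (fun _ => rfl) (by simp)) f
  exact this

lemma PD_gE (e0 q : Ω → ℝ) (s : ι → Ω → ℝ) (c : ℝ) (hq : ∀ ω, q ω = (1/2) * ∑ i, s i ω * s i ω + c) (f : Ω → ℝ) :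
    PD (fun t φ i => gE (ee e0 q s t φ) (s i)) (fun t φ => gE (ee e0 q s t φ) f)
      (fun t φ j => gCov (ee e0 q s t φ) f (s j)) (fun _ _ => 0) := by
  have hcont : ∀ ω, Continuous (fun p : ℝ × (ι → ℝ) => ee e0 q s p.1 p.2 ω) := by
    intro ω; unfold ee; fun_prop
  refine ⟨?_, fun t φ => gCov (ee e0 q s t φ) f q, fun t φ j => gCov (ee e0 q s t φ) (fun ω => f ω * s j ω) (s j) -
    (gCov (ee e0 q s t φ) f (s j) * gE (ee e0 q s t φ) (s j) + gE (ee e0 q s t φ) f * gCov (ee e0 q s t φ) (s j) (s j)),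
    fun t φ => gE_dt e0 q s t φ f, fun t φ j => gE_dj e0 q s t φ j f, fun t φ j => ?_, ?_⟩
  · unfold gE
    exact Continuous.div (continuous_finsetSum _ fun ω _ => ((hcont ω).rexp).mul continuous_const)
      (continuous_finsetSum _ fun ω _ => (hcont ω).rexp) fun p => (gZ_pos _).ne'
  · have a := (gE_dj e0 q s t φ j f).mul (gE_dj e0 q s t φ j (s j))
    refine hdcg ((gE_dj e0 q s t φ j (fun ω => f ω * s j ω)).sub a) (fun _ => rfl) ?_
    rw [Function.update_eq_self]
  · intro t φ
    beta_reduce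
    generalize ee e0 q s t φ = E
    have h1 : gCov E f q = (1/2) * ∑ j, (gE E (fun ω => f ω * s j ω * s j ω) - gE E f * gE E (fun ω => s j ω * s j ω)) := by
      unfold gCov
      have e1 : (fun ω => f ω * q ω) = fun ω => (1/2) * (∑ j, f ω * s j ω * s j ω) + c * f ω := by
        ext ω
        rw [hq, mul_add, mul_left_comm, Finset.mul_sum, mul_comm c]
        simp only [mul_assoc]
      have e2 : q = fun ω => (1/2) * (∑ j, s j ω * s j ω) + c := funext hq
      rw [e1, e2, gE_add, gE_add, gE_mul, gE_mul, gE_mul, gE_sum, gE_sum, gE_const, Finset.sum_sub_distrib, ← Finset.mul_sum]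
      ring
    rw [h1, ← mul_sub, ← Finset.sum_sub_distrib, Finset.mul_sum, ← Finset.sum_sub_distrib]
    apply Finset.sum_eq_zero
    intro j _
    unfold gCov
    ring

lemma gE_abs (E f : Ω → ℝ) : |gE E f| ≤ ∑ ω, |f ω| := by
  have h : ∀ ω, |f ω| ≤ ∑ ω, |f ω| := fun ω => Finset.single_le_sum (f := fun ω => |f ω|) (fun _ _ => abs_nonneg _) (Finset.mem_univ ω)
  rw [abs_le]
  constructor
  · have := gE_mono E (f := fun _ => -∑ ω, |f ω|) (g := f) (fun ω => by linarith [neg_abs_le (f ω), h ω])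
    rwa [gE_const] at this
  · have := gE_mono E (f := f) (g := fun _ => ∑ ω, |f ω|) (fun ω => by linarith [le_abs_self (f ω), h ω])
    rwa [gE_const] at this

lemma gCov_abs (E f g : Ω → ℝ) : |gCov E f g| ≤ ∑ ω, |f ω * g ω| + (∑ ω, |f ω|) * ∑ ω, |g ω| := by
  unfold gCov
  refine (abs_sub _ _).trans (add_le_add (gE_abs _ _) ?_)
  rw [abs_mul]
  exact mul_le_mul (gE_abs _ _) (gE_abs _ _) (abs_nonneg _) (Finset.sum_nonneg fun _ _ => abs_nonneg _)

end X

/-! Part 10 -/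


section X
variable {Ω : Type*} [Fintype Ω] [Nonempty Ω] {ι : Type*} [Fintype ι] [DecidableEq ι]

def Gam (e0 q : Ω → ℝ) (s : ι → Ω → ℝ) (F : Ω → ℝ) (t : ℝ) (φ : ι → ℝ) : ℝ :=
  ∑ i, gCov (ee e0 q s t φ) F (s i) * gCov (ee e0 q s t φ) F (s i) * ((gE (ee e0 q s t φ) F)⁻¹ / 4)

lemma PD_Gam (e0 q : Ω → ℝ) (s : ι → Ω → ℝ) (c : ℝ) (hq : ∀ ω, q ω = (1/2) * ∑ i, s i ω * s i ω + c)
    (F : Ω → ℝ) (hF : ∀ ω, 0 < F ω) (χ : ℝ → ℝ)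
    (hvar : ∀ t φ (p : ι → ℝ), 0 ≤ t → ∑ i, ∑ j, p i * p j * gCov (ee e0 q s t φ) (s i) (s j) ≤ χ t * ∑ i, p i * p i) :
    ∃ f1 r, PD (fun t φ i => gE (ee e0 q s t φ) (s i)) (Gam e0 q s F) f1 r ∧
      ∀ t φ, 0 ≤ t → r t φ ≤ 2 * χ t * Gam e0 q s F t φ := by
  let V : ι → ℝ → (ι → ℝ) → ι → ℝ := fun i t φ j => gCov (ee e0 q s t φ) (fun ω => F ω * s i ω) (s j) -
    (gCov (ee e0 q s t φ) F (s j) * gE (ee e0 q s t φ) (s i) + gE (ee e0 q s t φ) F * gCov (ee e0 q s t φ) (s i) (s j))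
  have hU : ∀ i, PD (fun t φ i => gE (ee e0 q s t φ) (s i)) (fun t φ => gCov (ee e0 q s t φ) F (s i)) (V i)
      (fun t φ => ∑ j, gCov (ee e0 q s t φ) F (s j) * gCov (ee e0 q s t φ) (s i) (s j)) := by
    intro i
    refine ((PD_gE e0 q s c hq (fun ω => F ω * s i ω)).sub
      ((PD_gE e0 q s c hq F).mul (PD_gE e0 q s c hq (s i)))).congr (fun _ _ => rfl) (fun _ _ _ => rfl) (fun _ _ => by ring)
  have hupos : ∀ t φ, 0 < gE (ee e0 q s t φ) F := fun t φ => gE_pos _ hF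
  have hw := (PD_gE e0 q s c hq F).comp (ψ := fun x => x⁻¹ / 4) (ψ1 := fun x => -(x ^ 2)⁻¹ / 4) (ψ2 := fun x => (x ^ 3)⁻¹ / 2)
    (fun t φ => by
      have := (hupos t φ).ne'
      exact (hasDerivAt_inv this).div_const 4)
    (fun t φ => by
      have := (hupos t φ).ne'
      refine hdcg ((((hasDerivAt_id (gE (ee e0 q s t φ) F)).pow 2).inv (pow_ne_zero 2 this)).neg.div_const 4) (fun _ => rfl) ?_
      simp only [id, Pi.pow_apply]
      field_simp
      norm_num
      ring)
  have hG := PD.sum Finset.univ (fun i => ((hU i).mul (hU i)).mul hw)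
  refine ⟨_, _, hG, ?_⟩
  intro t φ ht
  have hv := hvar t φ (fun i => gCov (ee e0 q s t φ) F (s i)) ht
  have hu := hupos t φ
  simp only [Gam]
  beta_reduce
  generalize hV : (fun i j => V i t φ j) = W
  have hV' : ∀ i j, V i t φ j = W i j := fun i j => by rw [← hV]
  simp only [hV']
  generalize gE (ee e0 q s t φ) F = u at *
  generalize hp : (fun i => gCov (ee e0 q s t φ) F (s i)) = p at *
  have hp' : ∀ i, gCov (ee e0 q s t φ) F (s i) = p i := fun i => by rw [← hp]
  simp only [hp'] at *
  have hpos : 0 ≤ (∑ i, ∑ j, (W i j - p i * p j / u) ^ 2) / (4 * u) := by positivity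
  have hv2 := mul_le_mul_of_nonneg_left hv (show 0 ≤ 1 / (2 * u) by positivity)
  calc _ = 1 / (2 * u) * (∑ i, ∑ j, p i * p j * gCov (ee e0 q s t φ) (s i) (s j)) -
        (∑ i, ∑ j, (W i j - p i * p j / u) ^ 2) / (4 * u) := by
        rw [Finset.mul_sum Finset.univ (fun i => ∑ j, p i * p j * gCov (ee e0 q s t φ) (s i) (s j)) (1 / (2 * u)),
          Finset.sum_div, ← Finset.sum_sub_distrib]
        refine Finset.sum_congr rfl fun i _ => ?_
        have e1 : ∑ j, p i * p j * gCov (ee e0 q s t φ) (s i) (s j) = p i * ∑ j, p j * gCov (ee e0 q s t φ) (s i) (s j) := by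
          rw [Finset.mul_sum]; exact Finset.sum_congr rfl fun j _ => by ring
        have e2 : ∑ j, (W i j - p i * p j / u) ^ 2 = ∑ j, W i j * W i j - 2 * p i / u * (∑ j, W i j * p j) +
            p i ^ 2 / u ^ 2 * ∑ j, p j ^ 2 := by
          rw [Finset.mul_sum, Finset.mul_sum, ← Finset.sum_sub_distrib, ← Finset.sum_add_distrib]
          exact Finset.sum_congr rfl fun j _ => by ring
        have e3 : ∑ j, (W i j * p i + p i * W i j) * (-(u ^ 2)⁻¹ / 4 * p j) =
            - p i / (2 * u ^ 2) * ∑ j, W i j * p j := by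
          rw [Finset.mul_sum]
          exact Finset.sum_congr rfl fun j _ => by field_simp; ring
        rw [e1, e2, e3]
        field_simp
        ring
    _ ≤ 1 / (2 * u) * (χ t * ∑ i, p i * p i) := by linarith
    _ = _ := by
        rw [← Finset.sum_mul]
        field_simp
        ring

theorem core (e0 q : Ω → ℝ) (s : ι → Ω → ℝ) (c : ℝ) (hq : ∀ ω, q ω = (1/2) * ∑ i, s i ω * s i ω + c)
    (F : Ω → ℝ) (hF : ∀ ω, 0 < F ω) (χ : ℝ → ℝ) (hχc : Continuous χ) (hχ0 : ∀ t, 0 ≤ χ t)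
    (hvar : ∀ t φ (p : ι → ℝ), 0 ≤ t → ∑ i, ∑ j, p i * p j * gCov (ee e0 q s t φ) (s i) (s j) ≤ χ t * ∑ i, p i * p i)
    (d : Ω → ℝ) (hd : ∀ ω, 0 ≤ d ω) (h1 : ∀ φ, Gam e0 q s F 0 φ ≤ gE (ee e0 q s 0 φ) d)
    (h2 : ∀ φ, gE (ee e0 q s 0 φ) (fun ω => F ω * Real.log (F ω)) -
      gE (ee e0 q s 0 φ) F * Real.log (gE (ee e0 q s 0 φ) F) ≤ gE (ee e0 q s 0 φ) d)
    (t : ℝ) (ht : 0 ≤ t) (φ : ι → ℝ) :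
    gE (ee e0 q s t φ) (fun ω => F ω * Real.log (F ω)) -
      gE (ee e0 q s t φ) F * Real.log (gE (ee e0 q s t φ) F) ≤
      (1 + 2 * ∫ t in (0:ℝ)..t, Real.exp (2 * ∫ s in (0:ℝ)..t, χ s)) * gE (ee e0 q s t φ) d := by
  obtain ⟨f1, r, hG, hr⟩ := PD_Gam e0 q s c hq F hF χ hvar
  set X : ℝ → ℝ := fun t => 2 * ∫ s in (0:ℝ)..t, χ s with hX
  have hXd : ∀ t, HasDerivAt X (2 * χ t) t := fun t =>
    ((hχc.integral_hasStrictDerivAt 0 t).hasDerivAt).const_mul 2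
  have hXc : Continuous X := continuous_iff_continuousAt.2 fun t => (hXd t).continuousAt
  set I : ℝ → ℝ := fun t => 1 + 2 * ∫ t in (0:ℝ)..t, Real.exp (X t) with hI
  have hId : ∀ t, HasDerivAt I (2 * Real.exp (X t)) t := fun t =>
    (((hXc.rexp.integral_hasStrictDerivAt 0 t).hasDerivAt).const_mul 2).const_add 1
  have hX0 : ∀ t, 0 ≤ t → 0 ≤ X t := fun t ht => mul_nonneg (by norm_num)
    (intervalIntegral.integral_nonneg ht fun _ _ => hχ0 _)
  have hI0 : ∀ t, 0 ≤ t → 0 ≤ I t := fun t ht => by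
    have := intervalIntegral.integral_nonneg (f := fun t => Real.exp (X t)) (μ := MeasureTheory.volume) ht fun _ _ => (Real.exp_pos _).le
    simp only [hI]; linarith
  have hupos : ∀ t φ, 0 < gE (ee e0 q s t φ) F := fun t φ => gE_pos _ hF
  have hd0 : ∀ t φ, 0 ≤ gE (ee e0 q s t φ) d := fun t φ => gE_nonneg _ hd
  obtain ⟨C, hC⟩ : ∃ C, ∀ t φ j, |gE (ee e0 q s t φ) (s j)| ≤ C := by
    refine ⟨∑ j, ∑ ω, |s j ω|, fun t φ j => (gE_abs _ _).trans ?_⟩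
    exact Finset.single_le_sum (f := fun j => ∑ ω, |s j ω|) (fun _ _ => Finset.sum_nonneg fun _ _ => abs_nonneg _) (Finset.mem_univ j)
  obtain ⟨a, ha, haF⟩ : ∃ a, 0 < a ∧ ∀ ω, a ≤ F ω := by
    obtain ⟨ω0, h0⟩ := Finite.exists_min F
    exact ⟨F ω0, hF ω0, h0⟩
  have hua : ∀ t φ, a ≤ gE (ee e0 q s t φ) F := fun t φ => by
    have := gE_mono (ee e0 q s t φ) haF
    rwa [gE_const] at this
  have hGam0 : ∀ t φ, 0 ≤ Gam e0 q s F t φ := fun t φ =>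
    Finset.sum_nonneg fun i _ => mul_nonneg (mul_self_nonneg _) (by have := hupos t φ; positivity)
  obtain ⟨M1, hM1⟩ : ∃ M, ∀ t φ, Gam e0 q s F t φ ≤ M := by
    refine ⟨∑ i, (∑ ω, |F ω * s i ω| + (∑ ω, |F ω|) * ∑ ω, |s i ω|) ^ 2 * (a⁻¹ / 4), fun t φ => ?_⟩
    refine Finset.sum_le_sum fun i _ => ?_
    have b1 := gCov_abs (ee e0 q s t φ) F (s i)
    have b2 := hua t φ
    have b3 : gCov (ee e0 q s t φ) F (s i) * gCov (ee e0 q s t φ) F (s i) ≤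
      (∑ ω, |F ω * s i ω| + (∑ ω, |F ω|) * ∑ ω, |s i ω|) ^ 2 := by
      rw [← sq]; exact sq_le_sq' (abs_le.1 b1).1 (abs_le.1 b1).2
    have b4 : (gE (ee e0 q s t φ) F)⁻¹ ≤ a⁻¹ := inv_anti₀ ha b2
    have := hupos t φ
    apply mul_le_mul b3 (by linarith) (by positivity) (by positivity)
  -- first comparison
  have hex : ∀ t, HasDerivAt (fun t => Real.exp (-X t)) (-(2 * χ t) * Real.exp (-X t)) t := fun t =>
    hdcg ((hXd t).neg.exp) (fun _ => rfl) (by simp; ring)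
  have hK1 := ((PD.time hex).mul hG).sub (PD_gE e0 q s c hq d)
  have step1 : ∀ t φ, 0 ≤ t → Gam e0 q s F t φ ≤ Real.exp (X t) * gE (ee e0 q s t φ) d := by
    intro T φ hT
    have := max_principle hK1 T M1 C ?_ ?_ hC ?_ T φ hT le_rfl
    · have h3 : Real.exp (X T) * Real.exp (-X T) = 1 := by rw [← Real.exp_add, add_neg_cancel, Real.exp_zero]
      have h4 := mul_le_mul_of_nonneg_left this (Real.exp_pos (X T)).le
      rw [mul_sub, ← mul_assoc, h3] at h4
      linarith
    · intro t φ ht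
      have h3 := mul_le_mul_of_nonneg_left (hr t φ ht) (Real.exp_pos (-X t)).le
      simp only [zero_mul, Finset.sum_const_zero]
      linarith
    · intro t φ h3 h4
      have h5 : Real.exp (-X t) ≤ 1 := Real.exp_le_one_iff.2 (by linarith [hX0 t h3])
      have h6 := hM1 t φ
      have h7 := hGam0 t φ
      have h8 := hd0 t φ
      nlinarith
    · intro φ
      have : X 0 = 0 := by simp [hX]
      simp only [this, neg_zero, Real.exp_zero, one_mul]
      linarith [h1 φ]
  have hlog := (PD_gE e0 q s c hq F).comp (ψ := fun x => x * Real.log x) (ψ1 := fun x => Real.log x + 1) (ψ2 := fun x => x⁻¹)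
    (fun t φ => Real.hasDerivAt_mul_log (hupos t φ).ne')
    (fun t φ => (Real.hasDerivAt_log (hupos t φ).ne').add_const 1)
  have hK2 := ((PD_gE e0 q s c hq (fun ω => F ω * Real.log (F ω))).sub hlog).sub
    ((PD.time hId).mul (PD_gE e0 q s c hq d))
  have := max_principle hK2 t (∑ ω, |F ω * Real.log (F ω)| + 1) C ?_ ?_ hC ?_ t φ ht le_rfl
  · linarith
  · intro t φ ht
    have h3 := step1 t φ ht
    have h4 : Gam e0 q s F t φ = (1 / 4) * ((gE (ee e0 q s t φ) F)⁻¹ * ∑ j, gCov (ee e0 q s t φ) F (s j) ^ 2) := by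
      unfold Gam; rw [← Finset.sum_mul]; simp only [← sq]; ring
    simp only [zero_mul, Finset.sum_const_zero]
    linarith
  · intro t φ h3 h4
    have h5 := le_abs_self (gE (ee e0 q s t φ) (fun ω => F ω * Real.log (F ω)))
    have h6 := gE_abs (ee e0 q s t φ) (fun ω => F ω * Real.log (F ω))
    have h7 := xlogx_tangent (hupos t φ) one_pos
    rw [Real.log_one] at h7
    have h8 := mul_nonneg (hI0 t h3) (hd0 t φ)
    have h9 := hupos t φ
    linarith
  · intro φ
    have : I 0 = 1 := by simp [hI]
    simp only [this, one_mul]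
    linarith [h2 φ]

end X

/-! Part 11 -/


section Fin
variable {Λ : Type*} [Fintype Λ] [DecidableEq Λ]

lemma exists_factor (A : Matrix Λ Λ ℝ) (hAsymm : A.IsSymm)
    (hA1 : ∀ v : Λ → ℝ, v ⬝ᵥ A.mulVec v ≤ v ⬝ᵥ v) :
    ∃ (k : ℕ) (b : Fin k → Λ → ℝ), ∀ v : Λ → ℝ, ∑ i, (b i ⬝ᵥ v) * (b i ⬝ᵥ v) = v ⬝ᵥ v - v ⬝ᵥ A.mulVec v := by
  have hps : (1 - A).PosSemidef := by
    refine Matrix.PosSemidef.of_dotProduct_mulVec_nonneg ?_ fun v => ?_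
    · have : Aᴴ = A := by rw [Matrix.conjTranspose_eq_transpose_of_trivial]; exact hAsymm
      unfold Matrix.IsHermitian
      rw [Matrix.conjTranspose_sub, this, Matrix.conjTranspose_one]
    · rw [star_trivial, Matrix.sub_mulVec, Matrix.one_mulVec, dotProduct_sub]
      linarith [hA1 v]
  obtain ⟨k, b, hb⟩ := Matrix.posSemidef_iff_eq_sum_vecMulVec.1 hps
  refine ⟨k, b, fun v => ?_⟩
  have : v ⬝ᵥ v - v ⬝ᵥ A.mulVec v = v ⬝ᵥ (1 - A).mulVec v := by
    rw [Matrix.sub_mulVec, Matrix.one_mulVec, dotProduct_sub]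
  rw [this, hb, Matrix.sum_mulVec, dotProduct_sum]
  refine Finset.sum_congr rfl fun i _ => ?_
  rw [star_trivial, Matrix.vecMulVec_mulVec]
  simp [dotProduct_comm]

lemma gCov_sum_right (E F : (Λ → Bool) → ℝ) (b : Λ → ℝ) :
    gCov E F (ls b) = b ⬝ᵥ (fun x => gE E (fun σ => F σ * spin σ x) - gE E F * gE E (fun σ => spin σ x)) := by
  unfold gCov
  have e1 : (fun σ => F σ * ls b σ) = fun σ => ∑ x, b x * (F σ * spin σ x) := by
    ext σ; unfold ls; rw [Finset.mul_sum]; exact Finset.sum_congr rfl fun x _ => by ring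
  have e2 : ls b = fun σ => ∑ x, b x * spin σ x := rfl
  rw [e1, e2, gE_sum, gE_sum, Finset.mul_sum, ← Finset.sum_sub_distrib]
  refine Finset.sum_congr rfl fun x _ => ?_
  rw [gE_mul, gE_mul]; ring

lemma ls_comb {k : ℕ} (b : Fin k → Λ → ℝ) (p : Fin k → ℝ) (σ : Λ → Bool) :
    ls (fun x => ∑ i, p i * b i x) σ = ∑ i, p i * ls (b i) σ := by
  unfold ls
  simp only [Finset.sum_mul, Finset.mul_sum]
  rw [Finset.sum_comm]
  exact Finset.sum_congr rfl fun i _ => Finset.sum_congr rfl fun x _ => by ring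

lemma gCov_comb {k : ℕ} (E : (Λ → Bool) → ℝ) (b : Fin k → Λ → ℝ) (p : Fin k → ℝ) :
    ∑ i, ∑ j, p i * p j * gCov E (ls (b i)) (ls (b j)) = gVar E (fun x => ∑ i, p i * b i x) := by
  have e0 : ls (fun x => ∑ i, p i * b i x) = fun σ => ∑ i, p i * ls (b i) σ := funext fun σ => ls_comb b p σ
  have e1 : gE E (ls (fun x => ∑ i, p i * b i x)) = ∑ i, p i * gE E (ls (b i)) := by
    rw [e0, gE_sum]; exact Finset.sum_congr rfl fun i _ => gE_mul _ _ _
  have e2 : gE E (fun σ => ls (fun x => ∑ i, p i * b i x) σ * ls (fun x => ∑ i, p i * b i x) σ) =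
      ∑ i, ∑ j, p i * p j * gE E (fun σ => ls (b i) σ * ls (b j) σ) := by
    have : (fun σ => ls (fun x => ∑ i, p i * b i x) σ * ls (fun x => ∑ i, p i * b i x) σ) =
        fun σ => ∑ i, ∑ j, p i * p j * (ls (b i) σ * ls (b j) σ) := by
      ext σ
      rw [ls_comb, Finset.sum_mul_sum]
      exact Finset.sum_congr rfl fun x _ => Finset.sum_congr rfl fun y _ => by ring
    rw [this, gE_sum]
    refine Finset.sum_congr rfl fun x _ => ?_
    rw [gE_sum]
    exact Finset.sum_congr rfl fun y _ => gE_mul _ _ _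
  unfold gVar
  rw [e1, e2, Finset.sum_mul_sum, ← Finset.sum_sub_distrib]
  refine Finset.sum_congr rfl fun x _ => ?_
  rw [← Finset.sum_sub_distrib]
  exact Finset.sum_congr rfl fun y _ => by unfold gCov; ring

lemma comb_contract (A : Matrix Λ Λ ℝ) (hA0 : ∀ v : Λ → ℝ, 0 ≤ v ⬝ᵥ A.mulVec v) {k : ℕ} (b : Fin k → Λ → ℝ)
    (hb : ∀ v : Λ → ℝ, ∑ i, (b i ⬝ᵥ v) * (b i ⬝ᵥ v) = v ⬝ᵥ v - v ⬝ᵥ A.mulVec v) (p : Fin k → ℝ) :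
    (fun x => ∑ i, p i * b i x) ⬝ᵥ (fun x => ∑ i, p i * b i x) ≤ ∑ i, p i * p i := by
  generalize hw : (fun x => ∑ i, p i * b i x) = w
  have e : w ⬝ᵥ w = ∑ i, p i * (b i ⬝ᵥ w) := by
    nth_rewrite 1 [← hw]
    simp only [dotProduct, Finset.sum_mul, Finset.mul_sum]
    rw [Finset.sum_comm]
    exact Finset.sum_congr rfl fun i _ => Finset.sum_congr rfl fun x _ => by ring
  have cs := Finset.sum_mul_sq_le_sq_mul_sq Finset.univ p (fun i => b i ⬝ᵥ w)
  rw [← e] at cs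
  simp only [sq] at cs
  rw [hb] at cs
  have h0 := hA0 w
  have hp : 0 ≤ ∑ i, p i * p i := Finset.sum_nonneg fun i _ => mul_self_nonneg _
  have hwn : 0 ≤ w ⬝ᵥ w := Finset.sum_nonneg fun i _ => mul_self_nonneg _
  rcases hwn.eq_or_lt with h | h
  · rw [← h]; exact hp
  · have : w ⬝ᵥ w * (w ⬝ᵥ w) ≤ (∑ i, p i * p i) * (w ⬝ᵥ w) := cs.trans (mul_le_mul_of_nonneg_left (by linarith) hp)
    exact le_of_mul_le_mul_right this h

lemma lsi_pos [Nonempty Λ] (A : Matrix Λ Λ ℝ) (hAsymm : A.IsSymm)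
    (hA0 : ∀ v : Λ → ℝ, 0 ≤ v ⬝ᵥ A.mulVec v)
    (hA1 : ∀ v : Λ → ℝ, v ⬝ᵥ A.mulVec v ≤ v ⬝ᵥ v)
    (hferro : ∀ x y : Λ, x ≠ y → A x y ≤ 0)
    (χ : ℝ → ℝ)
    (hχ : ∀ t, χ t = ⨆ v : {v : Λ → ℝ // v ⬝ᵥ v = 1}, qM A t v)
    (β : ℝ) (hβ : 0 < β) (h : Λ → ℝ) (F : (Λ → Bool) → ℝ) (hF : ∀ σ, 0 < F σ) :
    fent (isingProb A β h) F ≤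
        (1 + 2 * ∫ t in (0:ℝ)..β, Real.exp (2 * ∫ s in (0:ℝ)..t, χ s)) *
        dirichlet (isingProb A β h) (fun σ => Real.sqrt (F σ)) := by
  obtain ⟨k, b, hb⟩ := exists_factor A hAsymm hA1
  let q : (Λ → Bool) → ℝ := fun σ => -(1/2) * (spin σ ⬝ᵥ A.mulVec (spin σ))
  let s : Fin k → (Λ → Bool) → ℝ := fun i => ls (b i)
  let d : (Λ → Bool) → ℝ := fun σ => (1/2) * ∑ x, (Real.sqrt (F (spinFlip x σ)) - Real.sqrt (F σ)) ^ 2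
  let fld : (Fin k → ℝ) → Λ → ℝ := fun φ x => h x + ∑ i, φ i * b i x
  have hls : ∀ φ σ, ls (fld φ) σ = ls h σ + ∑ i, φ i * ls (b i) σ := by
    intro φ σ
    rw [← ls_comb]
    simp only [ls, fld, add_mul, Finset.sum_add_distrib]
  have hee : ∀ t φ, ee (ls h) q s t φ = Ham (Jt A t) (fld φ) := by
    intro t φ; ext σ
    rw [← Ham_Jt]
    have : fld φ ⬝ᵥ spin σ = ls (fld φ) σ := rfl
    rw [this, hls]
    simp only [ee, q, s]; ring
  have hee0 : ∀ φ, ee (ls h) q s 0 φ = ls (fld φ) := by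
    intro φ; ext σ
    rw [hls]; simp [ee, s]
  have hq : ∀ σ, q σ = (1/2) * ∑ i, s i σ * s i σ + (-(Fintype.card Λ : ℝ) / 2) := by
    intro σ
    have h1 := hb (spin σ)
    have h2 : spin σ ⬝ᵥ spin σ = Fintype.card Λ := by simp [dotProduct, spin_sq]
    rw [h2] at h1
    have h3 : ∑ i, s i σ * s i σ = ∑ i, (b i ⬝ᵥ spin σ) * (b i ⬝ᵥ spin σ) := rfl
    rw [h3, h1]; simp only [q]; ring
  have hχ0 := chi_nonneg A χ hχ
  have main := core (ls h) q s _ hq F hF χ (chi_cont A χ hχ) hχ0 (fun t φ p ht => by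
      rw [hee]
      have e := gCov_comb (Ham (Jt A t) (fld φ)) b p
      have h1 := gVar_chi A (fun x y => (hAsymm.apply x y).symm) hferro χ hχ t ht (fld φ) (fun x => ∑ i, p i * b i x)
      have h2 := mul_le_mul_of_nonneg_left (comb_contract A hA0 b hb p) (hχ0 t)
      simp only [s]
      linarith) d (fun σ => by positivity) (fun φ => by
      unfold Gam
      rw [hee0, ← Finset.sum_mul]
      have hu : 0 < gE (ls (fld φ)) F := gE_pos _ hF
      simp only [s, gCov_sum_right]
      rw [hb]
      have h1 := hA0 (fun x => gE (ls (fld φ)) (fun σ => F σ * spin σ x) - gE (ls (fld φ)) F * gE (ls (fld φ)) (fun σ => spin σ x))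
      have h2 := Finset.sum_le_sum (fun x (_ : x ∈ Finset.univ) => cov_bound (fld φ) hF x)
      have h3 : gE (ls (fld φ)) d = (1/2) * ∑ x, gE (ls (fld φ)) (fun σ => (Real.sqrt (F (spinFlip x σ)) - Real.sqrt (F σ)) ^ 2) := by
        simp only [d]; rw [gE_mul, gE_sum]
      rw [← Finset.mul_sum] at h2
      have h4 : 0 ≤ ∑ x, gE (ls (fld φ)) (fun σ => (Real.sqrt (F (spinFlip x σ)) - Real.sqrt (F σ)) ^ 2) :=
        Finset.sum_nonneg fun x _ => gE_nonneg _ fun σ => sq_nonneg _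
      rw [h3]
      generalize gE (ls (fld φ)) F = u at *
      generalize (∑ x, gE (ls (fld φ)) (fun σ => (Real.sqrt (F (spinFlip x σ)) - Real.sqrt (F σ)) ^ 2)) = S at *
      have h5 : ∀ c : Λ → ℝ, c ⬝ᵥ c = ∑ x, (c x) ^ 2 := fun c =>
        Finset.sum_congr rfl fun x _ => (sq _).symm
      rw [h5]
      have h6 : u * S * (u⁻¹ / 4) = S / 4 := by field_simp
      refine le_trans (mul_le_mul_of_nonneg_right (b := _) (c := u * S) ?_ (by positivity)) (by linarith)
      linarith) (fun φ => by
      rw [hee0]; exact prod_lsi (fld φ) hF) β hβ.le 0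
  rw [hee] at main
  have hf0 : fld 0 = h := by ext x; simp [fld]
  rw [hf0] at main
  have e1 : dirichlet (isingProb A β h) (fun σ => Real.sqrt (F σ)) = gE (Ham (Jt A β) h) d := by
    unfold dirichlet
    simp only [isingProb_sum, d]
    rw [gE_mul, gE_sum]
  unfold fent
  rw [e1]
  simp only [isingProb_sum]
  exact main

lemma fent_cont (μ F : (Λ → Bool) → ℝ) : Continuous (fun ε : ℝ => fent μ (fun σ => F σ + ε)) := by
  unfold fent
  refine Continuous.sub (continuous_finsetSum _ fun σ _ => continuous_const.mul ?_) ?_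
  · exact Real.continuous_mul_log.comp (continuous_const.add continuous_id)
  · exact Real.continuous_mul_log.comp (g := fun x => x * Real.log x) (by fun_prop)

lemma dir_cont (μ F : (Λ → Bool) → ℝ) : Continuous (fun ε : ℝ => dirichlet μ (fun σ => Real.sqrt (F σ + ε))) := by
  unfold dirichlet
  fun_prop

end Fin

/-- Log-Sobolev inequality for ferromagnetic Ising models up to the critical point:
with `χ_t` the largest eigenvalue of the zero-field two-point matrix
`(E_{μ_{t,0}}[σ_x σ_y])_{x,y}`, the measure `μ_{β,h}` satisfies
`Ent(F) ≤ (1 + 2 ∫₀^β exp(2 ∫₀^t χ_s ds) dt) · D(√F)`. -/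
theorem ising_ferromagnetic_lsi {Λ : Type*} [Fintype Λ] [DecidableEq Λ] [Nonempty Λ]
    (A : Matrix Λ Λ ℝ) (hAsymm : A.IsSymm)
    (hApos : ∀ v : Λ → ℝ, v ≠ 0 → 0 < v ⬝ᵥ A.mulVec v)
    (hA1 : ∀ v : Λ → ℝ, v ⬝ᵥ A.mulVec v ≤ v ⬝ᵥ v)
    (hferro : ∀ x y : Λ, x ≠ y → A x y ≤ 0)
    (χ : ℝ → ℝ)
    (hχ : ∀ t, χ t = ⨆ v : {v : Λ → ℝ // v ⬝ᵥ v = 1},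
      (v : Λ → ℝ) ⬝ᵥ (Matrix.of fun x y =>
        ∑ σ : Λ → Bool, isingProb A t 0 σ * (spin σ x * spin σ y)).mulVec (v : Λ → ℝ))
    (β : ℝ) (hβ : 0 < β) (h : Λ → ℝ) :
    ∀ F : (Λ → Bool) → ℝ, (∀ σ, 0 ≤ F σ) →
      fent (isingProb A β h) F ≤
        (1 + 2 * ∫ t in (0:ℝ)..β, Real.exp (2 * ∫ s in (0:ℝ)..t, χ s)) *
        dirichlet (isingProb A β h) (fun σ => Real.sqrt (F σ)) := by
  intro F hF
  have hχ' : ∀ t, χ t = ⨆ v : {v : Λ → ℝ // v ⬝ᵥ v = 1}, qM A t v := by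
    intro t; rw [hχ t]; simp only [qM_eq]
  have hA0 : ∀ v : Λ → ℝ, 0 ≤ v ⬝ᵥ A.mulVec v := by
    intro v
    by_cases hv : v = 0
    · simp [hv]
    · exact (hApos v hv).le
  have c1 := ((fent_cont (isingProb A β h) F).tendsto 0).mono_left
    (nhdsWithin_le_nhds (s := Set.Ioi (0:ℝ)))
  have c2 := (((dir_cont (isingProb A β h) F).tendsto 0).mono_left
    (nhdsWithin_le_nhds (s := Set.Ioi (0:ℝ)))).const_mul
      (1 + 2 * ∫ t in (0:ℝ)..β, Real.exp (2 * ∫ s in (0:ℝ)..t, χ s))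
  have key := le_of_tendsto_of_tendsto c1 c2 (by
    filter_upwards [self_mem_nhdsWithin] with ε hε
    have hε' : 0 < ε := hε
    exact lsi_pos A hAsymm hA0 hA1 hferro χ hχ' β hβ h (fun σ => F σ + ε)
      (fun σ => add_pos_of_nonneg_of_pos (hF σ) hε'))
  simpa only [add_zero] using key

end
end

section
/- (Hessian of the Ising renormalised potential.) Let Λ be a finite set, C a positive definite symmetric Λ×Λ matrix, and h ∈ ℝ^Λ. Define V : ℝ^Λ → ℝ by V(φ) = −log Σ_{σ∈{−1,+1}^Λ} exp(−(1/2)(σ − φ, C^{−1}(σ − φ)) + (h,σ)). For g ∈ ℝ^Λ, let Σ(g) be the covariance matrix (Cov_{μ_g}(σ_x, σ_y))_{x,y∈Λ} of the Ising measure μ_g(σ) ∝ exp(−(1/2)(σ, C^{−1}σ) + (g,σ)) on {−1,+1}^Λ. Then for every φ ∈ ℝ^Λ, Hess V(φ) = C^{−1} − C^{−1} · Σ(C^{−1}φ + h) · C^{−1}. -/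
open Real Matrix

noncomputable section

/-- Partial derivative of `f : ℝ^Λ → ℝ` in direction `x` at `φ`. -/
def pderiv' {Λ : Type*} [DecidableEq Λ] (x : Λ) (f : (Λ → ℝ) → ℝ) (φ : Λ → ℝ) : ℝ :=
  deriv (fun t => f (Function.update φ x t)) (φ x)

/-- The Ising probability measure with coupling matrix `C⁻¹` and external field `g`:
`μ_g(σ) ∝ exp(−½(σ, C⁻¹σ) + (g,σ))`. -/
def isingProbC {Λ : Type*} [Fintype Λ] [DecidableEq Λ] (C : Matrix Λ Λ ℝ) (g : Λ → ℝ)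
    (σ : Λ → Bool) : ℝ :=
  Real.exp (-(1/2) * (spin σ ⬝ᵥ C⁻¹.mulVec (spin σ)) + g ⬝ᵥ spin σ) /
    ∑ σ' : Λ → Bool, Real.exp (-(1/2) * (spin σ' ⬝ᵥ C⁻¹.mulVec (spin σ')) + g ⬝ᵥ spin σ')

theorem update_eq_aux {Λ : Type*} [DecidableEq Λ] (φ : Λ → ℝ) (y : Λ) (t : ℝ) :
    Function.update φ y t = φ + (t - φ y) • Pi.single y (1 : ℝ) := by
  ext z
  by_cases hz : z = y
  · subst hz; simp
  · simp [hz]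

theorem hasDerivAt_dot_aux {Λ : Type*} [Fintype Λ] [DecidableEq Λ] (φ v : Λ → ℝ) (y : Λ) :
    HasDerivAt (fun t => Function.update φ y t ⬝ᵥ v) (v y) (φ y) := by
  have : (fun t => Function.update φ y t ⬝ᵥ v) = fun t => φ ⬝ᵥ v + (t - φ y) * v y := by
    funext t
    rw [update_eq_aux, add_dotProduct, smul_dotProduct, single_one_dotProduct, smul_eq_mul]
  rw [this]
  simpa using (((hasDerivAt_id (φ y)).sub_const (φ y)).mul_const (v y)).const_add (φ ⬝ᵥ v)

theorem dot_symm_aux {Λ : Type*} [Fintype Λ] (A : Matrix Λ Λ ℝ) (hA : Aᵀ = A) (u v : Λ → ℝ) :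
    u ⬝ᵥ A *ᵥ v = (A *ᵥ u) ⬝ᵥ v := by
  rw [dotProduct_mulVec, ← mulVec_transpose, hA]

theorem hasDerivAt_quad_aux {Λ : Type*} [Fintype Λ] [DecidableEq Λ] (A : Matrix Λ Λ ℝ)
    (hA : Aᵀ = A) (φ : Λ → ℝ) (y : Λ) :
    HasDerivAt (fun t => (1/2) * (Function.update φ y t ⬝ᵥ A *ᵥ Function.update φ y t))
      ((A *ᵥ φ) y) (φ y) := by
  have : (fun t => (1/2) * (Function.update φ y t ⬝ᵥ A *ᵥ Function.update φ y t)) =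
      fun t => (1/2) * (φ ⬝ᵥ A *ᵥ φ) + ((t - φ y) * (A *ᵥ φ) y
        + (t - φ y) ^ 2 * ((1/2) * (A *ᵥ Pi.single y (1 : ℝ)) y)) := by
    funext t
    rw [update_eq_aux, mulVec_add, mulVec_smul, add_dotProduct, dotProduct_add, dotProduct_add,
      smul_dotProduct, smul_dotProduct, dotProduct_smul, dotProduct_smul,
      dot_symm_aux A hA φ (Pi.single y 1),
      dotProduct_single_one, single_one_dotProduct, single_one_dotProduct]
    simp only [smul_eq_mul]
    ring
  rw [this]
  have h0 : HasDerivAt (fun t : ℝ => t - φ y) 1 (φ y) := (hasDerivAt_id (φ y)).sub_const (φ y)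
  have h1 := ((h0.mul_const ((A *ᵥ φ) y)).add
    ((h0.pow 2).mul_const ((1/2) * (A *ᵥ Pi.single y (1 : ℝ)) y))).const_add
      ((1/2) * (φ ⬝ᵥ A *ᵥ φ))
  simpa using h1

/-- Boltzmann weight in field `A φ + h`. -/
def wAux {Λ : Type*} [Fintype Λ] (A : Matrix Λ Λ ℝ) (h φ : Λ → ℝ) (σ : Λ → Bool) : ℝ :=
  Real.exp (-(1/2) * (spin σ ⬝ᵥ A *ᵥ spin σ) + (A *ᵥ φ + h) ⬝ᵥ spin σ)

theorem hasDerivAt_wsum_aux {Λ : Type*} [Fintype Λ] [DecidableEq Λ] (A : Matrix Λ Λ ℝ)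
    (hA : Aᵀ = A) (h φ : Λ → ℝ) (c : (Λ → Bool) → ℝ) (y : Λ) :
    HasDerivAt (fun t => ∑ σ, wAux A h (Function.update φ y t) σ * c σ)
      (∑ σ, wAux A h φ σ * (A *ᵥ spin σ) y * c σ) (φ y) := by
  apply HasDerivAt.fun_sum
  intro σ _
  apply HasDerivAt.mul_const
  have h1 := (((hasDerivAt_dot_aux φ (A *ᵥ spin σ) y).add_const (h ⬝ᵥ spin σ)).const_add
    (-(1/2) * (spin σ ⬝ᵥ A *ᵥ spin σ))).exp
  simp only [Function.update_eq_self] at h1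
  simpa only [wAux, add_dotProduct, ← dot_symm_aux A hA] using h1

theorem wsum_pos_aux {Λ : Type*} [Fintype Λ] [DecidableEq Λ] (A : Matrix Λ Λ ℝ)
    (h φ : Λ → ℝ) : 0 < ∑ σ, wAux A h φ σ :=
  Finset.sum_pos (fun _ _ => Real.exp_pos _) Finset.univ_nonempty

/-- Hessian of the Ising renormalised potential:
for `V(φ) = −log Σ_σ exp(−½(σ−φ, C⁻¹(σ−φ)) + (h,σ))`,
`Hess V(φ) = C⁻¹ − C⁻¹ Σ(C⁻¹φ + h) C⁻¹`, where `Σ(g)` is the covariance matrix of the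
Ising measure with coupling matrix `C⁻¹` and external field `g`. -/
theorem ising_renormalised_potential_hessian {Λ : Type*} [Fintype Λ] [DecidableEq Λ]
    (C : Matrix Λ Λ ℝ) (hC : C.PosDef) (h : Λ → ℝ)
    (V : (Λ → ℝ) → ℝ)
    (hV : ∀ φ, V φ = -Real.log (∑ σ : Λ → Bool,
      Real.exp (-(1/2) * ((spin σ - φ) ⬝ᵥ C⁻¹.mulVec (spin σ - φ)) + h ⬝ᵥ spin σ)))
    (Sig : (Λ → ℝ) → Matrix Λ Λ ℝ)
    (hSig : ∀ g x y, Sig g x y =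
      (∑ σ : Λ → Bool, isingProbC C g σ * (spin σ x * spin σ y)) -
      (∑ σ : Λ → Bool, isingProbC C g σ * spin σ x) *
        (∑ σ : Λ → Bool, isingProbC C g σ * spin σ y)) :
    ∀ φ : Λ → ℝ, (Matrix.of fun x y => pderiv' x (pderiv' y V) φ) =
      C⁻¹ - C⁻¹ * Sig (C⁻¹.mulVec φ + h) * C⁻¹ := by
  intro φ
  have hA : (C⁻¹)ᵀ = C⁻¹ := by
    have := hC.inv.isHermitian
    simpa [Matrix.IsHermitian, conjTranspose_eq_transpose_of_trivial] using this
  have hP : ∀ σ, isingProbC C (C⁻¹ *ᵥ φ + h) σ = wAux C⁻¹ h φ σ / ∑ σ', wAux C⁻¹ h φ σ' :=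
    fun σ => rfl
  generalize C⁻¹ = A at *
  have hV1 : ∀ φ, V φ = (1/2) * (φ ⬝ᵥ A *ᵥ φ) - Real.log (∑ σ, wAux A h φ σ) := by
    intro φ
    have : (∑ σ : Λ → Bool,
        Real.exp (-(1/2) * ((spin σ - φ) ⬝ᵥ A.mulVec (spin σ - φ)) + h ⬝ᵥ spin σ)) =
        Real.exp (-((1/2) * (φ ⬝ᵥ A *ᵥ φ))) * ∑ σ, wAux A h φ σ := by
      rw [Finset.mul_sum]
      refine Finset.sum_congr rfl fun σ _ => ?_
      rw [wAux, ← Real.exp_add]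
      congr 1
      rw [mulVec_sub, sub_dotProduct, dotProduct_sub, dotProduct_sub, add_dotProduct,
        dot_symm_aux A hA φ (spin σ), dotProduct_comm (spin σ) (A *ᵥ φ)]
      ring
    rw [hV, this, Real.log_mul (Real.exp_ne_zero _) (wsum_pos_aux A h φ).ne', Real.log_exp]
    ring
  have hD1 : ∀ y, pderiv' y V = fun φ => (A *ᵥ φ) y -
      (∑ σ, wAux A h φ σ * (A *ᵥ spin σ) y) / ∑ σ, wAux A h φ σ := by
    intro y
    funext φ
    unfold pderiv'
    simp only [hV1]
    have hs := hasDerivAt_wsum_aux A hA h φ (fun _ => 1) y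
    simp only [mul_one] at hs
    have hl := hs.log (by simpa using (wsum_pos_aux A h φ).ne')
    simp only [Function.update_eq_self] at hl
    exact ((hasDerivAt_quad_aux A hA φ y).sub hl).deriv
  have hE : ∀ f : (Λ → Bool) → ℝ, ∑ σ, isingProbC C (A *ᵥ φ + h) σ * f σ =
      (∑ σ, wAux A h φ σ * f σ) / ∑ σ, wAux A h φ σ := by
    intro f
    rw [Finset.sum_div]
    refine Finset.sum_congr rfl fun σ _ => ?_
    rw [hP]
    ring
  have hsym : ∀ i j, A i j = A j i := fun i j => congrFun (congrFun hA j) i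
  -- the covariance side
  have hcov : ∀ x y, (A * Sig (A *ᵥ φ + h) * A) x y =
      (∑ σ, isingProbC C (A *ᵥ φ + h) σ * ((A *ᵥ spin σ) x * (A *ᵥ spin σ) y)) -
      (∑ σ, isingProbC C (A *ᵥ φ + h) σ * (A *ᵥ spin σ) x) *
      (∑ σ, isingProbC C (A *ᵥ φ + h) σ * (A *ᵥ spin σ) y) := by
    intro x y
    have hSigp := hSig (A *ᵥ φ + h)
    clear hE hP
    generalize isingProbC C (A *ᵥ φ + h) = p at *
    have hm : ∀ x, ∑ σ, p σ * (A *ᵥ spin σ) x = ∑ u, A x u * ∑ σ, p σ * spin σ u := by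
      intro x
      simp only [mulVec, dotProduct, Finset.mul_sum]
      rw [Finset.sum_comm]
      exact Finset.sum_congr rfl fun _ _ => Finset.sum_congr rfl fun _ _ => by ring
    have hc : ∑ σ, p σ * ((A *ᵥ spin σ) x * (A *ᵥ spin σ) y) =
        ∑ v, ∑ u, A x u * (∑ σ, p σ * (spin σ u * spin σ v)) * A v y := by
      simp only [mulVec, dotProduct, Finset.mul_sum, Finset.sum_mul]
      rw [Finset.sum_comm, Finset.sum_comm' (t' := Finset.univ) (s' := fun _ => Finset.univ)
        (by simp)]
      rw [Finset.sum_comm]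
      simp only [Finset.sum_comm (s := (Finset.univ : Finset (Λ → Bool)))]
      refine Finset.sum_congr rfl fun v _ => Finset.sum_congr rfl fun u _ =>
        Finset.sum_congr rfl fun σ _ => ?_
      rw [hsym v y]
      ring
    rw [hc, hm x, hm y, Finset.sum_mul_sum, Finset.sum_comm (γ := Λ) (f := fun i j =>
      (A x i * ∑ σ, p σ * spin σ i) * (A y j * ∑ σ, p σ * spin σ j)), ← Finset.sum_sub_distrib]
    simp only [Matrix.mul_apply, Finset.sum_mul]
    refine Finset.sum_congr rfl fun v _ => ?_
    rw [← Finset.sum_sub_distrib]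
    refine Finset.sum_congr rfl fun u _ => ?_
    rw [hSigp, hsym v y]
    ring
  ext x y
  rw [Matrix.sub_apply, hcov, hE, hE, hE, Matrix.of_apply, hD1]
  unfold pderiv'
  have hZ := (wsum_pos_aux A h φ).ne'
  have hs := hasDerivAt_wsum_aux A hA h φ (fun _ => 1) x
  simp only [mul_one] at hs
  have hn := hasDerivAt_wsum_aux A hA h φ (fun σ => (A *ᵥ spin σ) y) x
  have hl : HasDerivAt (fun t => (A *ᵥ Function.update φ x t) y) (A x y) (φ x) := by
    have := hasDerivAt_dot_aux φ (A y) x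
    rw [hsym x y]
    simpa only [mulVec, dotProduct_comm] using this
  have hq := hn.fun_div hs (by simpa using hZ)
  simp only [Function.update_eq_self] at hq
  rw [(hl.fun_sub hq).deriv]
  simp only [mul_assoc]
  field_simp

end
end
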